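/- Let q be a positive integer and let 𝓛_q(s) := ∏_{χ (mod q)} L(s, χ) denote the product of the L-functions of all φ(q) Dirichlet characters modulo q. Then 𝓛_q has at most one zero s = σ + it in the region σ ≥ 1 − 1/(9.646·log max{q, q|t|, 10}); if such a zero exists, it is real and is a zero of L(s, χ) for some non-principal real Dirichlet character χ modulo q. -/

import Mathlib

open Real

open Complex in
/-- Entire functions symmetric under `s ↦ 1 - conj s` up to modulus, zero-free right of `Re s = 1`,
and of growth order at most `3/2`. -/
structure SymEntire (f : ℂ → ℂ) : Prop where
  diff : Differentiable ℂ f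
  symm : ∀ s, ‖f (1 - (starRingEnd ℂ) s)‖ = ‖f s‖
  ne_zero : ∀ s : ℂ, 1 < s.re → f s ≠ 0
  growth : ∃ C r : ℝ, 0 < C ∧ ∀ s : ℂ, r ≤ ‖s‖ → ‖f s‖ ≤ Real.exp (C * ‖s‖ ^ (3 / 2 : ℝ))

lemma exists_entire_factor {f : ℂ → ℂ} (hf : Differentiable ℂ f) {ρ : ℂ} (h0 : f ρ = 0) :
    ∃ g : ℂ → ℂ, Differentiable ℂ g ∧ ∀ z, f z = (z - ρ) * g z := by
  refine ⟨dslope f ρ, ?_, fun z => ?_⟩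
  · rw [← differentiableOn_univ] at hf ⊢
    exact (Complex.differentiableOn_dslope Filter.univ_mem).2 hf
  · have := sub_smul_dslope f ρ z
    rw [h0, sub_zero, smul_eq_mul] at this
    exact this.symm

lemma norm_symm_of_mul {f p g : ℂ → ℂ} (hg : Differentiable ℂ g) (hp : {z | p z = 0}.Finite)
    (hfs : ∀ s, ‖f (1 - (starRingEnd ℂ) s)‖ = ‖f s‖)
    (hps : ∀ s, ‖p (1 - (starRingEnd ℂ) s)‖ = ‖p s‖) (h : ∀ z, f z = p z * g z) (s : ℂ) :
    ‖g (1 - (starRingEnd ℂ) s)‖ = ‖g s‖ := by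
  have hd : Dense ({z | p z = 0}ᶜ) := hp.countable.dense_compl ℂ
  have hc : Continuous g := hg.continuous
  have := Continuous.ext_on (f := fun s => ‖g (1 - (starRingEnd ℂ) s)‖) (g := fun s => ‖g s‖) hd
    ((hc.comp (continuous_const.sub Complex.continuous_conj)).norm) hc.norm ?_
  · exact congrFun this s
  · intro z hz
    have h1 := hfs z
    rw [h, h, norm_mul, norm_mul, hps] at h1
    exact mul_left_cancel₀ (norm_ne_zero_iff.2 hz) h1

lemma norm_sub_reflect (s ρ : ℂ) :
    ‖1 - (starRingEnd ℂ) s - (1 - (starRingEnd ℂ) ρ)‖ = ‖s - ρ‖ := by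
  rw [← Complex.norm_conj (s - ρ), ← norm_neg]
  congr 1; simp

lemma one_le_norm_sub {s ρ : ℂ} (h : 1 + ‖ρ‖ ≤ ‖s‖) : 1 ≤ ‖s - ρ‖ := by
  have := norm_sub_norm_le s ρ
  linarith

lemma SymEntire.of_factor {f p g : ℂ → ℂ} (hf : SymEntire f) (hg : Differentiable ℂ g)
    (hp : {z | p z = 0}.Finite) (hps : ∀ s, ‖p (1 - (starRingEnd ℂ) s)‖ = ‖p s‖)
    (hp1 : ∃ r : ℝ, ∀ s : ℂ, r ≤ ‖s‖ → 1 ≤ ‖p s‖) (h : ∀ z, f z = p z * g z) : SymEntire g := by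
  refine ⟨hg, norm_symm_of_mul hg hp hf.symm hps h, fun s hs h0 => hf.ne_zero s hs ?_, ?_⟩
  · rw [h, h0, mul_zero]
  · obtain ⟨C, r, hC, hr⟩ := hf.growth
    obtain ⟨r', hr'⟩ := hp1
    refine ⟨C, max r r', hC, fun s hs => ?_⟩
    refine le_trans ?_ (hr s (le_trans (le_max_left _ _) hs))
    rw [h, norm_mul]
    exact le_mul_of_one_le_left (norm_nonneg _) (hr' s (le_trans (le_max_right _ _) hs))

lemma SymEntire.factor {f : ℂ → ℂ} (hf : SymEntire f) {ρ : ℂ} (h0 : f ρ = 0) :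
    ∃ g : ℂ → ℂ, SymEntire g ∧
      ((ρ.re = 1 / 2 ∧ ∀ z, f z = (z - ρ) * g z) ∨
        (ρ.re ≠ 1 / 2 ∧ ∀ z, f z = (z - ρ) * (z - (1 - (starRingEnd ℂ) ρ)) * g z)) := by
  obtain ⟨g, hg, hfg⟩ := exists_entire_factor hf.diff h0
  by_cases hρ : ρ.re = 1 / 2
  · have e : 1 - (starRingEnd ℂ) ρ = ρ := by
      apply Complex.ext <;> simp [hρ]; norm_num
    refine ⟨g, hf.of_factor (p := fun z => z - ρ) hg ?_ ?_ ?_ hfg, Or.inl ⟨hρ, hfg⟩⟩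
    · simp [sub_eq_zero]
    · intro s
      have := norm_sub_reflect s ρ
      rwa [e] at this
    · exact ⟨_, fun s hs => one_le_norm_sub hs⟩
  · set ρ' := 1 - (starRingEnd ℂ) ρ with hρ'
    have hne : ρ' ≠ ρ := by
      intro h
      apply hρ
      have := congrArg Complex.re h
      simp [hρ'] at this
      linarith
    have h0' : g ρ' = 0 := by
      have h1 := hf.symm ρ
      rw [h0, norm_zero, norm_eq_zero, ← hρ', hfg] at h1
      exact (mul_eq_zero.1 h1).resolve_left (sub_ne_zero.2 hne)
    obtain ⟨k, hk, hgk⟩ := exists_entire_factor hg h0'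
    have hfk : ∀ z, f z = (z - ρ) * (z - ρ') * k z := fun z => by rw [hfg, hgk, mul_assoc]
    refine ⟨k, hf.of_factor (p := fun z => (z - ρ) * (z - ρ')) hk ?_ ?_ ?_ hfk, Or.inr ⟨hρ, hfk⟩⟩
    · refine (Set.toFinite ({ρ, ρ'} : Set ℂ)).subset fun z hz => ?_
      simpa [sub_eq_zero] using hz
    · intro s
      have h1 := norm_sub_reflect s ρ
      have h2 := norm_sub_reflect s ρ'
      have e : 1 - (starRingEnd ℂ) ρ' = ρ := by simp [hρ']
      rw [e] at h2
      rw [norm_mul, norm_mul, h1, h2, mul_comm]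
    · refine ⟨max (1 + ‖ρ‖) (1 + ‖ρ'‖), fun s hs => ?_⟩
      rw [norm_mul]
      exact one_le_mul_of_one_le_of_one_le (one_le_norm_sub (le_trans (le_max_left _ _) hs))
        (one_le_norm_sub (le_trans (le_max_right _ _) hs))

lemma SymEntire.zero_mem_strip {f : ℂ → ℂ} (hf : SymEntire f) {ρ : ℂ} (h0 : f ρ = 0) :
    0 ≤ ρ.re ∧ ρ.re ≤ 1 := by
  constructor
  · by_contra! h
    refine hf.ne_zero (1 - (starRingEnd ℂ) ρ) (by simp; linarith) ?_
    rw [← norm_eq_zero, hf.symm, h0, norm_zero]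
  · by_contra! h
    exact hf.ne_zero ρ h h0

/-- The contribution of a zero `ρ`, paired with its reflection `1 - conj ρ`. -/
noncomputable def zeroPair (s ρ : ℂ) : ℝ :=
  (1 / (s - ρ) + 1 / (s - (1 - (starRingEnd ℂ) ρ))).re

lemma logDeriv_sub_const (ρ z : ℂ) : logDeriv (fun z => z - ρ) z = 1 / (z - ρ) := by
  simp [logDeriv_apply]

lemma logDeriv_factor_one {f g : ℂ → ℂ} (hg : Differentiable ℂ g) {ρ : ℂ}
    (h : ∀ z, f z = (z - ρ) * g z) {s : ℂ} (hs : f s ≠ 0) :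
    logDeriv f s = 1 / (s - ρ) + logDeriv g s := by
  have hf : f = fun z => (z - ρ) * g z := funext h
  have h' := hs
  rw [h] at h'
  rw [hf, logDeriv_mul s (left_ne_zero_of_mul h') (right_ne_zero_of_mul h') (by fun_prop) (hg s),
    logDeriv_sub_const]

lemma logDeriv_factor_two {f g : ℂ → ℂ} (hg : Differentiable ℂ g) {ρ ρ' : ℂ}
    (h : ∀ z, f z = (z - ρ) * (z - ρ') * g z) {s : ℂ} (hs : f s ≠ 0) :
    logDeriv f s = 1 / (s - ρ) + 1 / (s - ρ') + logDeriv g s := by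
  rw [logDeriv_factor_one (g := fun z => (z - ρ') * g z) (by fun_prop)
    (fun z => by rw [h, mul_assoc]) hs, logDeriv_factor_one (g := g) hg (fun z => rfl), add_assoc]
  rw [h, mul_assoc] at hs
  exact right_ne_zero_of_mul hs

lemma SymEntire.factor_stechkin {f : ℂ → ℂ} (hf : SymEntire f) {ρ : ℂ} (h0 : f ρ = 0) {κ : ℝ}
    {s s₁ : ℂ} (hs : f s ≠ 0) (hs₁ : f s₁ ≠ 0) (hG : κ * zeroPair s₁ ρ ≤ zeroPair s ρ) {c : ℂ}
    (hc : c.re = 1 / 2) {R : ℝ} (hρ : ‖ρ - c‖ ≤ R) (hsc : ‖s - c‖ ≤ R / 4) :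
    ∃ g : ℂ → ℂ, SymEntire g ∧
      (logDeriv g s).re - κ * (logDeriv g s₁).re ≤ (logDeriv f s).re - κ * (logDeriv f s₁).re ∧
      (∀ z, g z = 0 → f z = 0) ∧
      ∀ z, ‖z - c‖ = 3 * R → ‖f s‖ * ‖g z‖ ≤ 5 / 8 * (‖g s‖ * ‖f z‖) := by
  have key : ∀ ρ : ℂ, ‖ρ - c‖ ≤ R → ∀ z, ‖z - c‖ = 3 * R → ‖s - ρ‖ ≤ 5 / 8 * ‖z - ρ‖ := by
    intro ρ hρ z hz
    have h1 : ‖s - ρ‖ ≤ ‖s - c‖ + ‖ρ - c‖ := by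
      have := norm_sub_le (s - c) (ρ - c)
      simpa using this
    have h2 : ‖z - c‖ - ‖ρ - c‖ ≤ ‖z - ρ‖ := by
      have := norm_sub_norm_le (z - c) (ρ - c)
      simpa using this
    linarith
  obtain ⟨g, hg, ⟨hre, hfg⟩ | ⟨hre, hfg⟩⟩ := hf.factor h0
  · refine ⟨g, hg, ?_, fun z hz => by rw [hfg, hz, mul_zero], fun z hz => ?_⟩
    · rw [logDeriv_factor_one hg.diff hfg hs, logDeriv_factor_one hg.diff hfg hs₁]
      have e : 1 - (starRingEnd ℂ) ρ = ρ := by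
        apply Complex.ext <;> simp [hre]; norm_num
      simp only [zeroPair, e, Complex.add_re] at hG
      simp only [Complex.add_re]
      linarith
    · have := key ρ hρ z hz
      rw [hfg s, hfg z, norm_mul, norm_mul]
      have : 0 ≤ ‖g s‖ * ‖g z‖ * (5 / 8 * ‖z - ρ‖ - ‖s - ρ‖) :=
        mul_nonneg (by positivity) (by linarith)
      linarith
  · refine ⟨g, hg, ?_, fun z hz => by rw [hfg, hz, mul_zero], fun z hz => ?_⟩
    · rw [logDeriv_factor_two hg.diff hfg hs, logDeriv_factor_two hg.diff hfg hs₁]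
      rw [zeroPair, zeroPair] at hG
      rw [Complex.add_re, Complex.add_re _ (logDeriv g s₁)]
      linarith
    · have h1 := key ρ hρ z hz
      have hρ' : ‖(1 - (starRingEnd ℂ) ρ) - c‖ ≤ R := by
        have e : 1 - (starRingEnd ℂ) c = c := by
          apply Complex.ext <;> simp [hc]; norm_num
        have := norm_sub_reflect ρ c
        rw [e] at this
        rwa [this]
      have h2 := key _ hρ' z hz
      rw [hfg s, hfg z, norm_mul, norm_mul, norm_mul, norm_mul]
      have h3 : ‖s - ρ‖ * ‖s - (1 - (starRingEnd ℂ) ρ)‖ ≤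
          5 / 8 * (‖z - ρ‖ * ‖z - (1 - (starRingEnd ℂ) ρ)‖) := by
        calc _ ≤ (5 / 8 * ‖z - ρ‖) * (5 / 8 * ‖z - (1 - (starRingEnd ℂ) ρ)‖) := by gcongr
          _ ≤ _ := by nlinarith [mul_nonneg (norm_nonneg (z - ρ))
                        (norm_nonneg (z - (1 - (starRingEnd ℂ) ρ)))]
      have h4 := mul_le_mul_of_nonneg_left h3 (mul_nonneg (norm_nonneg (g s)) (norm_nonneg (g z)))
      linarith

lemma exists_log_of_ne_zero {g : ℂ → ℂ} (hg : Differentiable ℂ g) {s : ℂ} {r : ℝ} (hr : 0 < r)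
    (h0 : ∀ z ∈ Metric.ball s r, g z ≠ 0) :
    ∃ h : ℂ → ℂ, (∀ z ∈ Metric.ball s r, HasDerivAt h (logDeriv g z) z) ∧ h s = 0 ∧
      ∀ z ∈ Metric.ball s r, g z = g s * Complex.exp (h z) := by
  have hd : DifferentiableOn ℂ (logDeriv g) (Metric.ball s r) := by
    intro z hz
    have : DifferentiableAt ℂ (logDeriv g) z :=
      ((hg.contDiff (n := 2)).differentiable_deriv_two z).div (hg z) (h0 z hz)
    exact this.differentiableWithinAt
  obtain ⟨h, hh, hval⟩ := hd.isExactOn_ball.with_val_at s 0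
  have hs : s ∈ Metric.ball s r := Metric.mem_ball_self hr
  refine ⟨h, fun z hz => hval z hz, hh, fun z hz => ?_⟩
  have hk : ∀ z ∈ Metric.ball s r, HasDerivAt (fun z => g z * Complex.exp (- h z)) 0 z := by
    intro z hz
    have h1 := (hg z).hasDerivAt.mul ((hval z hz).neg.cexp)
    refine h1.congr_deriv ?_
    have := h0 z hz
    rw [logDeriv_apply]
    field_simp
    ring
  have := (convex_ball s r).is_const_of_fderivWithin_eq_zero (𝕜 := ℂ)
    (f := fun z => g z * Complex.exp (- h z))
    (fun z hz => (hk z hz).differentiableAt.differentiableWithinAt)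
    (fun z hz => by
      rw [fderivWithin_of_isOpen Metric.isOpen_ball hz]
      ext; simp [(hk z hz).deriv]) hz hs
  simp only [hh, neg_zero, Complex.exp_zero, mul_one] at this
  rw [← this, mul_assoc, ← Complex.exp_add]
  simp

lemma re_logDeriv_eq_zero_of_symm {g : ℂ → ℂ} (hg : Differentiable ℂ g)
    (hsymm : ∀ s, ‖g (1 - (starRingEnd ℂ) s)‖ = ‖g s‖) {c : ℂ} (hc : c.re = 1 / 2) :
    (logDeriv g c).re = 0 := by
  have hev : ∀ x : ℝ, ‖g (c + (-x : ℝ))‖ = ‖g (c + x)‖ := by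
    intro x
    rw [← hsymm]
    congr 2
    apply Complex.ext <;> simp [hc]; ring
  have hd : HasDerivAt (fun x : ℝ => g (c + x)) (deriv g c) 0 := by
    have h1 : HasDerivAt g (deriv g c) (c + ((0 : ℝ) : ℂ)) := by simpa using (hg c).hasDerivAt
    have h2 : HasDerivAt (fun x : ℝ => c + (x : ℂ)) 1 0 :=
      (Complex.ofRealCLM.hasDerivAt (x := (0 : ℝ))).const_add c
    have h3 := h1.comp_of_eq (0 : ℝ) h2 rfl
    rw [mul_one] at h3
    exact h3
  have hn := hd.norm_sq
  have hn' : HasDerivAt (fun x : ℝ => ‖g (c + x)‖ ^ 2)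
      (-(2 * inner ℝ (g (c + (0 : ℝ))) (deriv g c))) 0 := by
    have h3 : HasDerivAt (fun x : ℝ => ‖g (c + x)‖ ^ 2)
      (2 * inner ℝ (g (c + (0 : ℝ))) (deriv g c)) (-0 : ℝ) := by simpa using hn
    have h4 := h3.comp (0 : ℝ) (hasDerivAt_neg (0 : ℝ))
    rw [mul_neg_one] at h4
    refine h4.congr_of_eventuallyEq (Filter.Eventually.of_forall fun x => ?_)
    simp only [Function.comp]
    rw [hev]
  have h5 := hn.unique hn'
  have h6 : inner ℝ (g c) (deriv g c) = (0 : ℝ) := by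
    simp only [Complex.ofReal_zero, add_zero] at h5
    linarith
  rw [logDeriv_apply, Complex.div_re]
  rw [Complex.inner] at h6
  simp only [Complex.mul_re, Complex.conj_re, Complex.conj_im] at h6
  rw [← add_div]
  rw [div_eq_zero_iff]
  left
  linarith

lemma abs_re_logDeriv_le {g : ℂ → ℂ} (hg : Differentiable ℂ g)
    (hsymm : ∀ s, ‖g (1 - (starRingEnd ℂ) s)‖ = ‖g s‖) {c : ℂ} (hc : c.re = 1 / 2) {R A : ℝ}
    (hR : 0 < R) (hA : 0 < A) {s w : ℂ} (hs : ‖s - c‖ < R / 16) (hw : ‖w - s‖ < R / 16)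
    (h0 : ∀ z, ‖z - c‖ ≤ R → g z ≠ 0)
    (hb : ∀ z, ‖z - c‖ ≤ R → ‖g z‖ ≤ Real.exp A * ‖g s‖) :
    |(logDeriv g w).re| ≤ 256 * A / R ^ 2 * ‖w - c‖ := by
  have hball : ∀ z ∈ Metric.ball s (R / 2), ‖z - c‖ ≤ R := by
    intro z hz
    rw [mem_ball_iff_norm] at hz
    have := norm_add_le (z - s) (s - c)
    rw [sub_add_sub_cancel] at this
    linarith
  obtain ⟨h, hh, hhs, hexp⟩ := exists_log_of_ne_zero hg (r := R / 2) (s := s) (by positivity)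
    fun z hz => h0 z (hball z hz)
  have hgs : g s ≠ 0 := h0 s (by linarith)
  have hre : ∀ z ∈ Metric.ball s (R / 2), (h z).re ≤ A := by
    intro z hz
    have h1 := hb z (hball z hz)
    rw [hexp z hz, norm_mul, Complex.norm_exp, mul_comm] at h1
    exact Real.exp_le_exp.1 (le_of_mul_le_mul_right h1 (norm_pos_iff.2 hgs))
  have hB : ∀ z, ‖z - s‖ ≤ R / 4 → ‖h z‖ ≤ 2 * A := by
    intro z hz
    have hmem : ∀ x ∈ Metric.ball (0 : ℂ) (R / 2), s + x ∈ Metric.ball s (R / 2) := by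
      intro x hx
      simpa [mem_ball_iff_norm] using hx
    have := Complex.borelCaratheodory_zero (f := fun x => h (s + x)) (R := R / 2) (z := z - s) hA
      (fun x hx => ((hh _ (hmem x hx)).differentiableAt.comp x
        ((differentiableAt_const s).add differentiableAt_id)).differentiableWithinAt)
      (fun x hx => hre _ (hmem x hx)) (by positivity)
      (by rw [mem_ball_zero_iff]; linarith) (by simpa using hhs)
    simp only [add_sub_cancel] at this
    refine this.trans ?_
    rw [div_le_iff₀ (by linarith)]
    nlinarith
  have hsub : ∀ {x y : ℂ} {a b : ℝ}, ‖x - s‖ ≤ a → ‖y - x‖ ≤ b → ‖y - s‖ ≤ a + b := by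
    intro x y a b h1 h2
    have := norm_add_le (y - x) (x - s)
    rw [sub_add_sub_cancel] at this
    linarith
  have hmb : ∀ {y : ℂ} {a : ℝ}, ‖y - s‖ ≤ a → a < R / 2 → y ∈ Metric.ball s (R / 2) := by
    intro y a h1 h2
    rw [mem_ball_iff_norm]
    linarith
  have hD : ∀ z, ‖z - s‖ ≤ R / 8 → ‖logDeriv g z‖ ≤ 16 * A / R := by
    intro z hz
    have h1 := Complex.norm_deriv_le_of_forall_mem_sphere_norm_le (f := h) (c := z) (R := R / 8)
      (C := 2 * A) (by positivity) ?_ ?_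
    · rw [(hh z (hmb hz (by linarith))).deriv] at h1
      refine h1.trans (le_of_eq ?_)
      field_simp
      ring
    · apply DifferentiableOn.diffContOnCl_ball (U := Metric.ball s (R / 2))
      · exact fun x hx => (hh x hx).differentiableAt.differentiableWithinAt
      · intro y hy
        rw [mem_closedBall_iff_norm] at hy
        exact hmb (hsub hz hy) (by linarith)
    · intro y hy
      rw [mem_sphere_iff_norm] at hy
      refine hB y ((hsub hz hy.le).trans (by linarith))
  have hdd : ∀ z ∈ Metric.ball s (R / 2), DifferentiableAt ℂ (logDeriv g) z := fun z hz =>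
    ((hg.contDiff (n := 2)).differentiable_deriv_two z).div (hg z) (h0 z (hball z hz))
  have hDD : ∀ z, ‖z - s‖ ≤ R / 16 → ‖deriv (logDeriv g) z‖ ≤ 256 * A / R ^ 2 := by
    intro z hz
    have h1 := Complex.norm_deriv_le_of_forall_mem_sphere_norm_le (f := logDeriv g) (c := z)
      (R := R / 16) (C := 16 * A / R) (by positivity) ?_ ?_
    · refine h1.trans (le_of_eq ?_)
      field_simp
      ring
    · apply DifferentiableOn.diffContOnCl_ball (U := Metric.ball s (R / 2))
      · exact fun x hx => (hdd x hx).differentiableWithinAt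
      · intro y hy
        rw [mem_closedBall_iff_norm] at hy
        exact hmb (hsub hz hy) (by linarith)
    · intro y hy
      rw [mem_sphere_iff_norm] at hy
      refine hD y ((hsub hz hy.le).trans (by linarith))
  have hfin := (convex_ball s (R / 16)).norm_image_sub_le_of_norm_deriv_le (f := logDeriv g)
    (x := c) (y := w) (C := 256 * A / R ^ 2)
    (fun z hz => hdd z (hmb (mem_ball_iff_norm.1 hz).le (by linarith)))
    (fun z hz => hDD z (mem_ball_iff_norm.1 hz).le)
    (by rw [mem_ball_iff_norm, norm_sub_rev]; exact hs) (by rw [mem_ball_iff_norm]; exact hw)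
  have hz := re_logDeriv_eq_zero_of_symm hg hsymm hc
  have := Complex.abs_re_le_norm (logDeriv g w - logDeriv g c)
  rw [Complex.sub_re, hz, sub_zero] at this
  exact this.trans hfin

/-- One can divide out all zeros in a large disc without increasing the Stechkin difference. -/
lemma SymEntire.exists_zero_free {f : ℂ → ℂ} (hf : SymEntire f) {κ : ℝ}
    {s s₁ : ℂ} (hs : f s ≠ 0) (hs₁ : f s₁ ≠ 0)
    (hG : ∀ ρ, f ρ = 0 → κ * zeroPair s₁ ρ ≤ zeroPair s ρ) {c : ℂ}
    (hc : c.re = 1 / 2) {R : ℝ} (hR : 0 < R) (hsc : ‖s - c‖ ≤ R / 4) {B : ℝ}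
    (hB : ∀ z, ‖z - c‖ = 3 * R → ‖f z‖ ≤ B) :
    ∃ g : ℂ → ℂ, SymEntire g ∧ g s ≠ 0 ∧
      (logDeriv g s).re - κ * (logDeriv g s₁).re ≤ (logDeriv f s).re - κ * (logDeriv f s₁).re ∧
      (∀ z, ‖z - c‖ ≤ R → g z ≠ 0) ∧
      ∀ z, ‖z - c‖ = 3 * R → ‖f s‖ * ‖g z‖ ≤ ‖g s‖ * B := by
  by_contra! hcon
  have key : ∀ n : ℕ, ∃ g : ℂ → ℂ, SymEntire g ∧
      (logDeriv g s).re - κ * (logDeriv g s₁).re ≤ (logDeriv f s).re - κ * (logDeriv f s₁).re ∧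
      (∀ z, g z = 0 → f z = 0) ∧
      ∀ z, ‖z - c‖ = 3 * R → ‖f s‖ * ‖g z‖ ≤ (5 / 8) ^ n * (‖g s‖ * ‖f z‖) := by
    intro n
    induction n with
    | zero => exact ⟨f, hf, le_rfl, fun _ => id, fun z _ => by simp⟩
    | succ n ih =>
      obtain ⟨g, hg, hΦ, hz, hbd⟩ := ih
      have hgs : g s ≠ 0 := fun h => hs (hz s h)
      have hgs₁ : g s₁ ≠ 0 := fun h => hs₁ (hz s₁ h)
      have hex : ∃ ρ, ‖ρ - c‖ ≤ R ∧ g ρ = 0 := by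
        by_contra! hno
        obtain ⟨z, hz1, hz2⟩ := hcon g hg hgs hΦ hno
        have h1 := hbd z hz1
        have h2 : (5 / 8 : ℝ) ^ n * (‖g s‖ * ‖f z‖) ≤ 1 * (‖g s‖ * B) := by
          gcongr
          · exact pow_le_one₀ (by norm_num) (by norm_num)
          · exact hB z hz1
        linarith
      obtain ⟨ρ, hρ, hρ0⟩ := hex
      obtain ⟨k, hk, hΦk, hzk, hbk⟩ := hg.factor_stechkin hρ0 hgs hgs₁ (hG ρ (hz ρ hρ0)) hc hρ hsc
      refine ⟨k, hk, hΦk.trans hΦ, fun z h => hz z (hzk z h), fun z hzR => ?_⟩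
      have h1 := mul_le_mul (hbd z hzR) (hbk z hzR) (by positivity) (by positivity)
      have h2 : 0 < ‖g s‖ := norm_pos_iff.2 hgs
      by_cases hgz : g z = 0
      · have h3 := hbk z hzR
        rw [hgz, norm_zero, mul_zero, mul_zero] at h3
        have h4 : ‖k z‖ = 0 := by
          have := norm_nonneg (k z)
          nlinarith
        rw [h4, mul_zero]; positivity
      · have h3 : 0 < ‖g z‖ := norm_pos_iff.2 hgz
        have h4 : 0 < ‖g s‖ * ‖g z‖ := by positivity
        rw [pow_succ]
        refine le_of_mul_le_mul_left ?_ h4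
        linarith
  obtain ⟨n, hn⟩ : ∃ n : ℕ, (5 / 8 : ℝ) ^ n * B < ‖f s‖ := by
    have h1 : Filter.Tendsto (fun n : ℕ => (5 / 8 : ℝ) ^ n * B) Filter.atTop (nhds (0 * B)) :=
      (tendsto_pow_atTop_nhds_zero_of_lt_one (by norm_num) (by norm_num)).mul_const B
    rw [zero_mul] at h1
    exact (h1.eventually (gt_mem_nhds (norm_pos_iff.2 hs))).exists
  obtain ⟨g, hg, -, hz, hbd⟩ := key n
  have hgs : 0 < ‖g s‖ := norm_pos_iff.2 fun h => hs (hz s h)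
  have hfs : 0 < ‖f s‖ := norm_pos_iff.2 hs
  have hmax : ‖g s‖ ≤ (5 / 8) ^ n * (‖g s‖ * B) / ‖f s‖ := by
    refine Complex.norm_le_of_forall_mem_frontier_norm_le (U := Metric.ball c (3 * R))
      Metric.isBounded_ball hg.diff.diffContOnCl ?_ ?_
    · intro z hz
      rw [frontier_ball c (by positivity), mem_sphere_iff_norm] at hz
      rw [le_div_iff₀ hfs, mul_comm]
      refine (hbd z hz).trans ?_
      gcongr
      exact hB z hz
    · apply subset_closure
      rw [mem_ball_iff_norm]
      linarith
  rw [le_div_iff₀ hfs] at hmax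
  have : ‖g s‖ * ((5 / 8) ^ n * B) < ‖g s‖ * ‖f s‖ := by gcongr
  linarith

lemma SymEntire.stechkin_nonneg {f : ℂ → ℂ} (hf : SymEntire f) {κ : ℝ}
    {s s₁ : ℂ} (hs : f s ≠ 0) (hs₁ : f s₁ ≠ 0)
    (hG : ∀ ρ, f ρ = 0 → κ * zeroPair s₁ ρ ≤ zeroPair s ρ) :
    0 ≤ (logDeriv f s).re - κ * (logDeriv f s₁).re := by
  obtain ⟨C, r, hC, hr⟩ := hf.growth
  set c : ℂ := ⟨1 / 2, s.im⟩ with hc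
  set D := |Real.log ‖f s‖| with hD
  set K := ‖s - c‖ + |κ| * ‖s₁ - c‖ with hK
  have hev : ∀ᶠ R : ℝ in Filter.atTop,
      -(256 * (C * (4 * R) ^ (3 / 2 : ℝ) + D) / R ^ 2 * K) ≤
        (logDeriv f s).re - κ * (logDeriv f s₁).re := by
    filter_upwards [Filter.eventually_gt_atTop 0, Filter.eventually_gt_atTop (r + ‖c‖),
      Filter.eventually_gt_atTop ‖c‖, Filter.eventually_gt_atTop (16 * ‖s - c‖),
      Filter.eventually_gt_atTop (16 * ‖s₁ - s‖)] with R hR hRr hRc hRs hRs₁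
    set A := C * (4 * R) ^ (3 / 2 : ℝ) + D with hA
    have hApos : 0 < A := by positivity
    obtain ⟨g, hg, hgs, hΦ, hz, hbd⟩ := hf.exists_zero_free hs hs₁ hG (c := c) rfl hR
      (by linarith [norm_nonneg (s - c)]) (B := Real.exp (C * (4 * R) ^ (3 / 2 : ℝ))) (by
        intro z hz
        have h1 : ‖z‖ ≤ ‖z - c‖ + ‖c‖ := by simpa using norm_add_le (z - c) c
        have h2 : ‖z - c‖ ≤ ‖z‖ + ‖c‖ := norm_sub_le z c
        refine (hr z (by linarith)).trans ?_
        gcongr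
        linarith)
    have hfs : 0 < ‖f s‖ := norm_pos_iff.2 hs
    have hb : ∀ z, ‖z - c‖ = 3 * R → ‖g z‖ ≤ Real.exp A * ‖g s‖ := by
      intro z hz
      have h1 := hbd z hz
      have h2 : 1 ≤ Real.exp D * ‖f s‖ := by
        rw [← Real.exp_log hfs, ← Real.exp_add]
        apply Real.one_le_exp
        linarith [neg_abs_le (Real.log ‖f s‖)]
      calc ‖g z‖ ≤ (Real.exp D * ‖f s‖) * ‖g z‖ := le_mul_of_one_le_left (norm_nonneg _) h2
        _ = Real.exp D * (‖f s‖ * ‖g z‖) := by ring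
        _ ≤ Real.exp D * (‖g s‖ * Real.exp (C * (4 * R) ^ (3 / 2 : ℝ))) := by gcongr
        _ = Real.exp A * ‖g s‖ := by rw [hA, Real.exp_add]; ring
    have hb' : ∀ z, ‖z - c‖ ≤ R → ‖g z‖ ≤ Real.exp A * ‖g s‖ := by
      intro z hz
      refine Complex.norm_le_of_forall_mem_frontier_norm_le (U := Metric.ball c (3 * R))
        Metric.isBounded_ball hg.diff.diffContOnCl ?_ ?_
      · intro w hw
        rw [frontier_ball c (by positivity), mem_sphere_iff_norm] at hw
        exact hb w hw
      · apply subset_closure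
        rw [mem_ball_iff_norm]
        linarith
    have h1 := abs_re_logDeriv_le hg.diff hg.symm (c := c) rfl hR hApos (s := s) (w := s)
      (by linarith) (by simpa using hR) hz hb'
    have h2 := abs_re_logDeriv_le hg.diff hg.symm (c := c) rfl hR hApos (s := s) (w := s₁)
      (by linarith) (by linarith) hz hb'
    refine le_trans ?_ hΦ
    have h3 : κ * (logDeriv g s₁).re ≤ |κ| * (256 * A / R ^ 2 * ‖s₁ - c‖) := by
      refine (le_abs_self _).trans ?_
      rw [abs_mul]
      gcongr
    have h4 := neg_abs_le (logDeriv g s).re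
    rw [hK]
    linarith
  have hlim : Filter.Tendsto (fun R : ℝ => -(256 * (C * (4 * R) ^ (3 / 2 : ℝ) + D) / R ^ 2 * K))
      Filter.atTop (nhds (-(256 * (C * 4 ^ (3 / 2 : ℝ) * 0 + D * 0) * K))) := by
    have e : (fun R : ℝ => -(256 * (C * 4 ^ (3 / 2 : ℝ) * R ^ (-(1 / 2) : ℝ) + D * (R ^ 2)⁻¹) * K))
        =ᶠ[Filter.atTop] (fun R : ℝ => -(256 * (C * (4 * R) ^ (3 / 2 : ℝ) + D) / R ^ 2 * K)) := by
      filter_upwards [Filter.eventually_gt_atTop 0] with R hR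
      have h1 : R ^ (-(1 / 2) : ℝ) = R ^ (3 / 2 : ℝ) * (R ^ 2)⁻¹ := by
        rw [← Real.rpow_natCast R 2, ← Real.rpow_neg hR.le, ← Real.rpow_add hR]
        norm_num
      rw [h1, Real.mul_rpow (by norm_num) hR.le]
      field_simp
    refine Filter.Tendsto.congr' e ?_
    have t1 := tendsto_rpow_neg_atTop (y := 1 / 2) (by norm_num)
    have t2 : Filter.Tendsto (fun R : ℝ => (R ^ 2)⁻¹) Filter.atTop (nhds 0) :=
      (Filter.tendsto_pow_atTop (by norm_num)).inv_tendsto_atTop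
    exact ((((t1.const_mul _).add (t2.const_mul _)).const_mul _).mul_const _).neg
  have := le_of_tendsto hlim hev
  simpa using this

/-- Hadamard-type inequality: finitely many zeros to the right of the critical line, each with
its reflection, contribute at most the full Stechkin difference. -/
lemma SymEntire.sum_zeroPair_le {κ : ℝ} {s s₁ : ℂ} (S : Finset ℂ) :
    ∀ {f : ℂ → ℂ}, SymEntire f → f s ≠ 0 → f s₁ ≠ 0 →
    (∀ ρ, f ρ = 0 → κ * zeroPair s₁ ρ ≤ zeroPair s ρ) →
    (∀ ρ ∈ S, f ρ = 0 ∧ 1 / 2 < ρ.re) →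
    ∑ ρ ∈ S, (zeroPair s ρ - κ * zeroPair s₁ ρ) ≤ (logDeriv f s).re - κ * (logDeriv f s₁).re := by
  induction S using Finset.induction_on with
  | empty => intro f hf hs hs₁ hG _; simpa using hf.stechkin_nonneg hs hs₁ hG
  | insert ρ S hρS ih =>
    intro f hf hs hs₁ hG hS
    obtain ⟨h0, hre⟩ := hS ρ (Finset.mem_insert_self _ _)
    obtain ⟨g, hg, ⟨h, -⟩ | ⟨-, hfg⟩⟩ := hf.factor h0
    · linarith
    · have hz : ∀ z, g z = 0 → f z = 0 := fun z hz => by rw [hfg, hz, mul_zero]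
      have := ih hg (fun h => hs (hz s h)) (fun h => hs₁ (hz s₁ h)) (fun ρ h => hG ρ (hz ρ h)) ?_
      · rw [Finset.sum_insert hρS, logDeriv_factor_two hg.diff hfg hs,
          logDeriv_factor_two hg.diff hfg hs₁, zeroPair, zeroPair, Complex.add_re _ (logDeriv g s),
          Complex.add_re _ (logDeriv g s₁)]
        linarith
      · intro ρ' hρ'
        obtain ⟨h0', hre'⟩ := hS ρ' (Finset.mem_insert_of_mem hρ')
        refine ⟨?_, hre'⟩
        rw [hfg] at h0'
        refine (mul_eq_zero.1 h0').resolve_left (mul_ne_zero ?_ ?_)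
        · intro h
          rw [sub_eq_zero] at h
          exact hρS (h ▸ hρ')
        · intro h
          have := congrArg Complex.re h
          simp at this
          linarith

/-- Stechkin's coefficient, slightly below `1 / √5`. -/
noncomputable def stechkinCoeff : ℝ := 0.447213
/-- Stechkin's shift, slightly above `(√5 - 1) / 2`. -/
noncomputable def stechkinShift : ℝ := 0.618034

lemma zeroPair_eq (s ρ : ℂ) : zeroPair s ρ =
    (s.re - ρ.re) / ((s.re - ρ.re) ^ 2 + (s.im - ρ.im) ^ 2) +
      (s.re + ρ.re - 1) / ((s.re + ρ.re - 1) ^ 2 + (s.im - ρ.im) ^ 2) := by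
  have h : ∀ z : ℂ, (1 / z).re = z.re / (z.re ^ 2 + z.im ^ 2) := by
    intro z
    rw [one_div, Complex.inv_re, Complex.normSq_apply, sq, sq]
  rw [zeroPair, Complex.add_re, h, h]
  congr 1
  all_goals
    simp
    ring

lemma pair_eq {a b Y : ℝ} (h1 : 0 < a - b) (h2 : 0 < a + b) (hY : 0 ≤ Y) :
    (a - b) / ((a - b) ^ 2 + Y) + (a + b) / ((a + b) ^ 2 + Y) =
      2 * a * (a ^ 2 - b ^ 2 + Y) / ((a ^ 2 - b ^ 2 + Y) ^ 2 + 4 * b ^ 2 * Y) := by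
  have e : (a ^ 2 - b ^ 2 + Y) ^ 2 + 4 * b ^ 2 * Y = ((a - b) ^ 2 + Y) * ((a + b) ^ 2 + Y) := by
    ring
  have : 0 < (a - b) ^ 2 + Y := by positivity
  have : 0 < (a + b) ^ 2 + Y := by positivity
  rw [e]
  field_simp
  ring

lemma stechkin_pair {a a₁ b Y κ : ℝ} (ha : 1 / 2 < a) (ha₁ : a ≤ a₁) (hb : |b| ≤ 1 / 2)
    (hY : 0 ≤ Y) (hκ : 0 ≤ κ) (hm : κ * a₁ ≤ a) (hΔ : κ * a₁ ≤ a * (a₁ ^ 2 - a ^ 2)) :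
    κ * ((a₁ - b) / ((a₁ - b) ^ 2 + Y) + (a₁ + b) / ((a₁ + b) ^ 2 + Y)) ≤
      (a - b) / ((a - b) ^ 2 + Y) + (a + b) / ((a + b) ^ 2 + Y) := by
  obtain ⟨hb1, hb2⟩ := abs_le.1 hb
  rw [pair_eq (by linarith) (by linarith) hY, pair_eq (by linarith) (by linarith) hY]
  have hB : 4 * b ^ 2 ≤ 1 := by nlinarith
  have hU0 : 0 < a ^ 2 - b ^ 2 := by nlinarith
  have hV0 : 0 < a₁ ^ 2 - b ^ 2 := by nlinarith
  set U := a ^ 2 - b ^ 2 + Y with hU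
  have hVU : a₁ ^ 2 - b ^ 2 + Y = U + (a₁ ^ 2 - a ^ 2) := by rw [hU]; ring
  set V := a₁ ^ 2 - b ^ 2 + Y with hV
  have hUp : 0 < U := by linarith
  have hVp : 0 < V := by linarith
  set m := κ * a₁ with hm'
  have hm0 : 0 ≤ m := mul_nonneg hκ (by linarith)
  have h4 : 0 ≤ 4 * b ^ 2 * Y := by positivity
  rw [show κ * (2 * a₁ * V / (V ^ 2 + 4 * b ^ 2 * Y)) = 2 * m * V / (V ^ 2 + 4 * b ^ 2 * Y) by
    rw [hm']; ring, div_le_div_iff₀ (by positivity) (by positivity)]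
  have hYU : Y ≤ U := by linarith
  have h5 : m ≤ a * V - m * U := by rw [hVU]; nlinarith
  have h6 : U * V * m ≤ U * V * (a * V - m * U) := by gcongr
  have h7 : 4 * b ^ 2 * Y * (m * V) ≤ 1 * U * (m * V) := by gcongr
  have h8 : 0 ≤ 4 * b ^ 2 * Y * (a * U) := by positivity
  nlinarith

lemma stechkin_zeroPair {s s₁ ρ : ℂ} (hs : 1 < s.re) (hre : s₁.re = s.re + stechkinShift)
    (him : s₁.im = s.im) (h0 : 0 ≤ ρ.re) (h1 : ρ.re ≤ 1) :
    stechkinCoeff * zeroPair s₁ ρ ≤ zeroPair s ρ := by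
  have hk : stechkinCoeff = 0.447213 := rfl
  have ht : stechkinShift = 0.618034 := rfl
  have hm : stechkinCoeff * (s.re - 1 / 2 + stechkinShift) ≤ s.re - 1 / 2 := by
    rw [hk, ht]; norm_num; linarith
  have := stechkin_pair (a := s.re - 1 / 2) (a₁ := s.re - 1 / 2 + stechkinShift) (b := ρ.re - 1 / 2)
    (Y := (s.im - ρ.im) ^ 2) (κ := stechkinCoeff) (by linarith) (by rw [ht]; norm_num)
    (abs_le.2 ⟨by linarith, by linarith⟩) (by positivity) (by rw [hk]; norm_num) hm
    (by rw [hk, ht]; norm_num; nlinarith)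
  rw [zeroPair_eq, zeroPair_eq, hre, him]
  convert this using 2 <;> ring_nf

lemma zeroPair_nonneg {s ρ : ℂ} (hs : 1 < s.re) (h0 : 0 ≤ ρ.re) (h1 : ρ.re ≤ 1) :
    0 ≤ zeroPair s ρ := by
  rw [zeroPair_eq]
  have : 0 ≤ s.re - ρ.re := by linarith
  have : 0 ≤ s.re + ρ.re - 1 := by linarith
  positivity

lemma shift_loss_aux {m p V Y η : ℝ} (hη : 0 ≤ η) (hY : 0 ≤ Y) (hV1 : 1 ≤ V)
    (hp1 : 0.95 ≤ p) (hVp : m * p ≤ V) (hpm : m - p ≤ η) :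
    m / (V + Y) ≤ p / (p ^ 2 + Y) + η * Y / (0.9 + Y) := by
  norm_num at hp1
  have h2 : η * Y / (p ^ 2 + Y) ≤ η * Y / (0.9 + Y) := by
    gcongr
    norm_num
    nlinarith
  have hp0 : 0 < p := by linarith
  have h3 : m / (V + Y) ≤ (p + η * Y) / (p ^ 2 + Y) := by
    rw [div_le_div_iff₀ (by positivity) (by positivity)]
    have h4 : 0 ≤ η * Y := by positivity
    have h5 : η * Y * 1 ≤ η * Y * (V + Y) := by gcongr; linarith
    have h6 : (m - p) * Y ≤ η * Y := by gcongr
    have h7 : m * p * p ≤ V * p := by gcongr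
    linarith
  rw [add_div] at h3
  linarith

lemma stechkin_zeroPair_ge {s s₁ ρ : ℂ} (hs : 1 < s.re)
    (hre : s₁.re = s.re + stechkinShift) (him : s₁.im = s.im) (h0 : 0.95 ≤ ρ.re)
    (h1 : ρ.re ≤ 1) :
    (s.re - ρ.re) / ((s.re - ρ.re) ^ 2 + (s.im - ρ.im) ^ 2) - (1 - ρ.re) *
        (s.im - ρ.im) ^ 2 / (0.9 + (s.im - ρ.im) ^ 2) ≤
      zeroPair s ρ - stechkinCoeff * zeroPair s₁ ρ := by
  have hk : stechkinCoeff = 0.447213 := rfl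
  have ht : stechkinShift = 0.618034 := rfl
  rw [zeroPair_eq, zeroPair_eq, hre, him]
  set Y := (s.im - ρ.im) ^ 2
  have hY : 0 ≤ Y := by positivity
  set a₁ := s.re - 1 / 2 + stechkinShift with ha₁
  have e1 : s.re + stechkinShift - ρ.re = a₁ - (ρ.re - 1 / 2) := by rw [ha₁]; ring
  have e2 : s.re + stechkinShift + ρ.re - 1 = a₁ + (ρ.re - 1 / 2) := by rw [ha₁]; ring
  rw [ht] at ha₁
  norm_num at ha₁ h0
  rw [e1, e2, pair_eq (by linarith) (by linarith) hY]
  set p := s.re + ρ.re - 1 with hp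
  set V₀ := a₁ ^ 2 - (ρ.re - 1 / 2) ^ 2 with hV₀
  set m := 2 * stechkinCoeff * a₁ with hm
  have hm0 : 0 < m := by rw [hm, hk]; norm_num; linarith
  have hp0 : 0 < p := by linarith
  have hV1 : 1 ≤ V₀ := by rw [hV₀]; nlinarith
  have hVp : m * p ≤ V₀ := by
    rw [hm, hk, hV₀, hp]; norm_num
    nlinarith
  have hpm : m - p ≤ 1 - ρ.re := by
    rw [hm, hk, hp]; norm_num
    linarith
  have hV : stechkinCoeff * (2 * a₁ * (V₀ + Y) / ((V₀ + Y) ^ 2 + 4 * (ρ.re - 1 / 2) ^ 2 * Y)) ≤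
      m / (V₀ + Y) := by
    rw [← mul_div_assoc, div_le_div_iff₀ (by positivity) (by positivity)]
    have : 0 ≤ m * (4 * (ρ.re - 1 / 2) ^ 2 * Y) := by positivity
    rw [hm] at this ⊢
    nlinarith
  have hq := shift_loss_aux (η := 1 - ρ.re) (by linarith) hY hV1 (by linarith) hVp hpm
  have := hV.trans hq
  have e : V₀ + Y = a₁ ^ 2 - (ρ.re - 1 / 2) ^ 2 + Y := rfl
  rw [e] at this
  have e3 : s.re + ρ.re - 1 = p := rfl
  generalize stechkinCoeff * _ = w at this ⊢
  norm_num at this ⊢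
  linarith

lemma stechkin_pole_le_real {s s₁ : ℂ} (hs : 1 < s.re)
    (hre : s₁.re = s.re + stechkinShift) (him : s₁.im = s.im) (h1 : s.re ≤ 1.15) (h0 : s.im = 0) :
    zeroPair s 1 - stechkinCoeff * zeroPair s₁ 1 ≤ 1 / (s.re - 1) + 0.036 := by
  have hk : stechkinCoeff = 0.447213 := rfl
  have ht : stechkinShift = 0.618034 := rfl
  rw [zeroPair_eq, zeroPair_eq, hre, him, h0, hk, ht]
  norm_num at *
  set x := s.re with hx
  have hx1 : (x - 1) / (x - 1) ^ 2 = (x - 1)⁻¹ := by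
    have : x - 1 ≠ 0 := by linarith
    field_simp
  have hx2 : x / x ^ 2 = x⁻¹ := by
    have : x ≠ 0 := by linarith
    field_simp
  have hx3 : (x + 309017 / 500000 - 1) / (x + 309017 / 500000 - 1) ^ 2 =
      (x + 309017 / 500000 - 1)⁻¹ := by
    have : x + 309017 / 500000 - 1 ≠ 0 := by linarith
    field_simp
  have hx4 : (x + 309017 / 500000) / (x + 309017 / 500000) ^ 2 = (x + 309017 / 500000)⁻¹ := by
    have : x + 309017 / 500000 ≠ 0 := by linarith
    field_simp
  rw [hx1, hx2, hx3, hx4]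
  have h4 : 0 < x := by linarith
  have key : x⁻¹ ≤ 447213 / 1000000 * ((x + 309017 / 500000 - 1)⁻¹ + (x + 309017 / 500000)⁻¹) +
      9 / 250 := by
    have h2 : 0 < x + 309017 / 500000 - 1 := by linarith
    obtain ⟨v, hv⟩ : ∃ v, v = x + 309017 / 500000 - 1 := ⟨_, rfl⟩
    rw [show x + 309017 / 500000 = v + 1 by rw [hv]; ring] at h2 ⊢
    rw [add_sub_cancel_right] at h2 ⊢
    rw [← sub_nonneg]
    have : 447213 / 1000000 * (v⁻¹ + (v + 1)⁻¹) +
      9 / 250 - x⁻¹ = (447213 / 1000000 * (v + (v + 1)) * x +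
        9 / 250 * ((v + 1) * v * x) - (v + 1) * v) / ((v + 1) * v * x) := by
      field_simp
      ring
    rw [this]
    apply div_nonneg _ (by positivity)
    rw [hv]
    nlinarith [mul_nonneg (sub_nonneg.2 hs.le) (sub_nonneg.2 h1),
      mul_nonneg (mul_nonneg (sub_nonneg.2 hs.le) (sub_nonneg.2 h1)) h4.le]
  linarith

lemma stechkin_pole_le {s s₁ : ℂ} (hs : 1 < s.re)
    (hre : s₁.re = s.re + stechkinShift) (him : s₁.im = s.im) (h1 : s.re ≤ 1.15) :
    zeroPair s 1 - stechkinCoeff * zeroPair s₁ 1 ≤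
      (s.re - 1) / ((s.re - 1) ^ 2 + s.im ^ 2) + 0.15 := by
  have hk : stechkinCoeff = 0.447213 := rfl
  have ht : stechkinShift = 0.618034 := rfl
  rw [zeroPair_eq, zeroPair_eq, hre, him]
  simp only [Complex.one_re, Complex.one_im, sub_zero]
  set Y := s.im ^ 2
  have hY : 0 ≤ Y := by positivity
  set a₁ := s.re - 1 / 2 + stechkinShift with ha₁
  rw [show s.re + stechkinShift - 1 = a₁ - 1 / 2 by rw [ha₁]; ring,
    show s.re + stechkinShift + 1 - 1 = a₁ + 1 / 2 by rw [ha₁]; ring]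
  rw [ht] at ha₁
  norm_num at ha₁ h1
  rw [pair_eq (by linarith) (by linarith) hY]
  norm_num
  set d := s.re - 1 with hd
  have hp : s.re = 1 + d := by rw [hd]; ring
  have hd0 : 0 < d := by linarith
  have hd1 : d ≤ 3 / 20 := by linarith
  have ha : a₁ = 559017 / 500000 + d := by rw [ha₁, hd]; ring
  have hs0 : s.re = 1 + d := by rw [hd]; ring
  set V := a₁ ^ 2 - 1 / 4 + Y with hV
  have hVp : 0 < V := by rw [hV, ha]; nlinarith
  rw [hs0, hk]
  have key : (1 + d) / ((1 + d) ^ 2 + Y) ≤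
      447213 / 1000000 * (2 * a₁ * V / (V ^ 2 + Y)) + 3 / 20 := by
    rw [show (447213 / 1000000 * (2 * a₁ * V / (V ^ 2 + Y)) + 3 / 20 : ℝ) =
      (447213 / 1000000 * (2 * a₁ * V) + 3 / 20 * (V ^ 2 + Y)) / (V ^ 2 + Y) by
        have : V ^ 2 + Y ≠ 0 := by positivity
        field_simp, div_le_div_iff₀ (by positivity) (by positivity), hV, ha]
    have h1 := sq_nonneg (Y - 1 / 3)
    have hm : ∀ i j : ℕ, 0 ≤ d ^ i * Y ^ j := fun i j => by positivity
    nlinarith [hm 1 0, hm 2 0, hm 3 0, hm 4 0, hm 5 0, hm 6 0, hm 1 1, hm 2 1, hm 3 1, hm 4 1,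
      hm 1 2, hm 2 2, hm 0 3]
  norm_num at *
  linarith

open Filter Topology in
/-- A pointwise limit of locally bounded holomorphic functions: derivatives converge. -/
lemma tendsto_deriv_of_bounded {F : ℕ → ℂ → ℂ} {f : ℂ → ℂ} {z : ℂ} {r B : ℝ} (hr : 0 < r)
    (hF : ∀ᶠ n in atTop, DifferentiableOn ℂ (F n) (Metric.closedBall z r))
    (hf : DifferentiableOn ℂ f (Metric.closedBall z r))
    (hB : ∀ᶠ n in atTop, ∀ w ∈ Metric.closedBall z r, ‖F n w‖ ≤ B)
    (hlim : ∀ w ∈ Metric.closedBall z r, Tendsto (fun n => F n w) atTop (𝓝 (f w))) :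
    Tendsto (fun n => deriv (F n) z) atTop (𝓝 (deriv f z)) := by
  have hmem : ∀ θ : ℝ, circleMap z r θ ∈ Metric.closedBall z r := fun θ =>
    circleMap_mem_closedBall z hr.le θ
  have key : ∀ {g : ℂ → ℂ}, DifferentiableOn ℂ g (Metric.closedBall z r) →
      deriv g z = (2 * π * Complex.I)⁻¹ • ∮ w in C(z, r), (1 / (w - z) ^ 2) • g w := by
    intro g hg
    rw [hg.deriv_eq_smul_circleIntegral hr, smul_smul, inv_mul_cancel₀ Complex.two_pi_I_ne_zero,
      one_smul]
  rw [key hf]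
  have h1 : Tendsto (fun n => (2 * π * Complex.I : ℂ)⁻¹ •
      ∮ w in C(z, r), (1 / (w - z) ^ 2) • F n w) atTop
      (𝓝 ((2 * π * Complex.I : ℂ)⁻¹ • ∮ w in C(z, r), (1 / (w - z) ^ 2) • f w)) := by
    refine Tendsto.const_smul ?_ _
    unfold circleIntegral
    have hc : Continuous fun θ : ℝ => (1 : ℂ) / (circleMap z r θ - z) ^ 2 := by
      refine continuous_const.div (by fun_prop) fun θ => ?_
      simp [circleMap, hr.ne']
    refine intervalIntegral.tendsto_integral_filter_of_dominated_convergence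
      (fun θ => r * (‖(1 : ℂ) / (circleMap z r θ - z) ^ 2‖ * B)) ?_ ?_ ?_ ?_
    · filter_upwards [hF] with n hn
      refine Continuous.aestronglyMeasurable ?_
      have h2 : Continuous fun θ : ℝ => F n (circleMap z r θ) :=
        hn.continuousOn.comp_continuous (continuous_circleMap z r) hmem
      have h3 : Continuous fun θ : ℝ => deriv (circleMap z r) θ := by
        simp only [deriv_circleMap]
        fun_prop
      exact h3.smul (hc.smul h2)
    · filter_upwards [hB] with n hn
      refine Eventually.of_forall fun θ _ => ?_
      rw [norm_smul, norm_smul, deriv_circleMap, norm_mul, Complex.norm_I, mul_one,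
        norm_circleMap_zero, abs_of_pos hr]
      gcongr
      exact hn _ (hmem θ)
    · exact ((hc.norm.mul continuous_const).const_mul r).intervalIntegrable _ _
    · refine Eventually.of_forall fun θ _ => ?_
      exact ((hlim _ (hmem θ)).const_smul _).const_smul _
  refine h1.congr' ?_
  filter_upwards [hF] with n hn
  rw [key hn]

lemma norm_GammaSeq_le {z : ℂ} (hz : 0 < z.re) {n : ℕ} (hn : n ≠ 0) :
    ‖Complex.GammaSeq z n‖ ≤ Real.Gamma z.re := by
  have hn0 : (0 : ℝ) < n := by exact_mod_cast Nat.pos_of_ne_zero hn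
  have h1 : ‖Complex.GammaSeq z n‖ ≤ Real.exp (Real.BohrMollerup.logGammaSeq z.re n) := by
    rw [Complex.GammaSeq, Real.BohrMollerup.logGammaSeq, Real.exp_sub, Real.exp_add, Real.exp_sum,
      norm_div, norm_mul, norm_prod, Complex.norm_natCast_cpow_of_pos (Nat.pos_of_ne_zero hn),
      Real.exp_log (by positivity), Complex.norm_natCast, mul_comm z.re, ← Real.rpow_def_of_pos hn0]
    have h3 : ∀ j ∈ Finset.range (n + 1), (0 : ℝ) < z.re + j := fun j _ => by positivity
    have h2 : ∏ j ∈ Finset.range (n + 1), Real.exp (Real.log (z.re + j)) ≤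
        ∏ j ∈ Finset.range (n + 1), ‖z + j‖ := by
      refine Finset.prod_le_prod (fun j _ => (Real.exp_pos _).le) fun j hj => ?_
      rw [Real.exp_log (h3 j hj)]
      refine le_trans (le_of_eq ?_) (Complex.re_le_norm _)
      simp
    gcongr
  refine h1.trans ?_
  have h2 := Real.BohrMollerup.ge_logGammaSeq (f := Real.log ∘ Real.Gamma)
    Real.convexOn_log_Gamma (fun {y} hy => by
      simp only [Function.comp]
      rw [Real.Gamma_add_one hy.ne', Real.log_mul hy.ne' (Real.Gamma_pos_of_pos hy).ne', add_comm])
    hz hn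
  simp only [Function.comp, Real.Gamma_one, Real.log_one, zero_add] at h2
  rw [← Real.exp_log (Real.Gamma_pos_of_pos hz)]
  exact Real.exp_le_exp.2 h2

lemma hasDerivAt_GammaSeq {z : ℂ} (hz : 0 < z.re) {n : ℕ} (hn : n ≠ 0) :
    HasDerivAt (fun z => Complex.GammaSeq z n) (Complex.GammaSeq z n *
      (Real.log n - ∑ j ∈ Finset.range (n + 1), 1 / (z + j))) z := by
  have h0 : ∀ j ∈ Finset.range (n + 1), z + (j : ℂ) ≠ 0 := by
    intro j _ h
    have := congrArg Complex.re h
    simp at this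
    have : (0 : ℝ) ≤ j := Nat.cast_nonneg j
    linarith
  have hnC : (n : ℂ) ≠ 0 := by exact_mod_cast hn
  have hP : HasDerivAt (fun z : ℂ => ∏ j ∈ Finset.range (n + 1), (z + j))
      ((∏ j ∈ Finset.range (n + 1), (z + j)) * ∑ j ∈ Finset.range (n + 1), 1 / (z + j)) z := by
    have := HasDerivAt.fun_finsetProd (u := Finset.range (n + 1)) (f := fun j z => z + (j : ℂ))
      (f' := fun _ => 1) (x := z) fun j _ => (hasDerivAt_id z).add_const _
    refine this.congr_deriv ?_
    rw [Finset.mul_sum]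
    refine Finset.sum_congr rfl fun j hj => ?_
    rw [← Finset.mul_prod_erase _ _ hj, smul_eq_mul, mul_one]
    have := h0 j hj
    field_simp
  have hN : HasDerivAt (fun z : ℂ => (n : ℂ) ^ z * (n.factorial : ℂ))
      ((n : ℂ) ^ z * (Real.log n : ℂ) * n.factorial) z := by
    have := ((hasDerivAt_id z).const_cpow (Or.inl hnC)).mul_const (n.factorial : ℂ)
    refine this.congr_deriv ?_
    simp
  have hP0 : ∏ j ∈ Finset.range (n + 1), (z + (j : ℂ)) ≠ 0 := Finset.prod_ne_zero_iff.2 h0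
  refine (hN.div hP hP0).congr_deriv ?_
  rw [Complex.GammaSeq]
  field_simp

open Filter Topology in
lemma tendsto_digamma {z : ℂ} (hz : 0 < z.re) :
    Tendsto (fun n : ℕ => (Real.log n : ℂ) - ∑ j ∈ Finset.range (n + 1), 1 / (z + j)) atTop
      (𝓝 (Complex.digamma z)) := by
  set r := z.re / 2 with hr
  have hr0 : 0 < r := by positivity
  have hre : ∀ w ∈ Metric.closedBall z r, w.re ∈ Set.Icc r (3 * r) := by
    intro w hw
    rw [mem_closedBall_iff_norm] at hw
    have := (Complex.abs_re_le_norm (w - z)).trans hw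
    rw [Complex.sub_re, abs_le] at this
    constructor <;> linarith
  have hcont : ContinuousOn Real.Gamma (Set.Icc r (3 * r)) := by
    intro x hx
    exact (Real.differentiableAt_Gamma fun m h => by
      have : (0 : ℝ) ≤ m := Nat.cast_nonneg m
      linarith [hx.1]).continuousAt.continuousWithinAt
  obtain ⟨B, hB⟩ := (isCompact_Icc.bddAbove_image hcont)
  have hGne : Complex.Gamma z ≠ 0 := Complex.Gamma_ne_zero_of_re_pos hz
  have h1 : Tendsto (fun n : ℕ => deriv (fun z => Complex.GammaSeq z n) z) atTop
      (𝓝 (deriv Complex.Gamma z)) := by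
    refine tendsto_deriv_of_bounded (B := B) hr0 ?_ ?_ ?_ ?_
    · filter_upwards [eventually_ne_atTop 0] with n hn w hw
      exact (hasDerivAt_GammaSeq (hr0.trans_le (hre w hw).1)
        hn).differentiableAt.differentiableWithinAt
    · intro w hw
      refine (Complex.differentiableAt_Gamma w fun m h => ?_).differentiableWithinAt
      have h2 := (hre w hw).1
      rw [h] at h2
      simp at h2
      have : (0 : ℝ) ≤ m := Nat.cast_nonneg m
      linarith
    · filter_upwards [eventually_ne_atTop 0] with n hn w hw
      exact (norm_GammaSeq_le (hr0.trans_le (hre w hw).1) hn).trans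
        (hB (Set.mem_image_of_mem _ (hre w hw)))
    · exact fun w _ => Complex.GammaSeq_tendsto_Gamma w
  have h2 := h1.div (Complex.GammaSeq_tendsto_Gamma z) hGne
  rw [Complex.digamma_def, logDeriv_apply]
  refine h2.congr' ?_
  have h3 := (Complex.GammaSeq_tendsto_Gamma z).eventually_ne hGne
  filter_upwards [eventually_ne_atTop 0, h3] with n hn h0
  change deriv (fun z => Complex.GammaSeq z n) z / Complex.GammaSeq z n = _
  rw [(hasDerivAt_GammaSeq hz hn).deriv, mul_div_cancel_left₀ _ h0]

lemma log_sub_log_le_div_sqrt {A B : ℝ} (hA : 0 < A) (hAB : A ≤ B) :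
    Real.log B - Real.log A ≤ (B - A) / √(A * B) := by
  have hB : 0 < B := hA.trans_le hAB
  set u := (Real.log B - Real.log A) / 2 with hu
  have hu0 : 0 ≤ u := by
    have := Real.log_le_log hA hAB
    linarith
  have h1 := Real.self_le_sinh_iff.2 hu0
  have h2 : Real.sinh u = (√(B / A) - √(A / B)) / 2 := by
    rw [Real.sinh_eq]
    have e1 : Real.exp u = √(B / A) := by
      rw [← Real.exp_log (div_pos hB hA), ← Real.exp_half, Real.log_div hB.ne' hA.ne']
    have e2 : Real.exp (-u) = √(A / B) := by
      rw [← Real.exp_log (div_pos hA hB), ← Real.exp_half, Real.log_div hA.ne' hB.ne', hu]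
      congr 1
      ring
    rw [e1, e2]
  have h3 : √(B / A) - √(A / B) = (B - A) / √(A * B) := by
    rw [Real.sqrt_div hB.le, Real.sqrt_div hA.le, Real.sqrt_mul hA.le]
    have := Real.sqrt_pos.2 hA
    have := Real.sqrt_pos.2 hB
    field_simp
    rw [Real.sq_sqrt hA.le, Real.sq_sqrt hB.le]
  rw [h3] at h2
  linarith

lemma log_step_le {x N : ℝ} (hx : 1 / 2 ≤ x) (hN : x ^ 2 ≤ N) :
    Real.log (N + x + 1 / 2) / 2 - Real.log (N - x + 1 / 2) / 2 ≤ x / N := by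
  have hN0 : 0 < N := lt_of_lt_of_le (by positivity) hN
  have hA : 0 < N - x + 1 / 2 := by nlinarith [sq_nonneg (x - 1 / 2)]
  have h1 := log_sub_log_le_div_sqrt hA (B := N + x + 1 / 2) (by linarith)
  have h2 : N ≤ √((N - x + 1 / 2) * (N + x + 1 / 2)) := by
    refine Real.le_sqrt_of_sq_le ?_
    nlinarith
  have h3 : (N + x + 1 / 2 - (N - x + 1 / 2)) / √((N - x + 1 / 2) * (N + x + 1 / 2)) ≤
      2 * x / N := by
    rw [show N + x + 1 / 2 - (N - x + 1 / 2) = 2 * x by ring]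
    gcongr
  rw [mul_div_assoc] at h3
  linarith

lemma le_log_step {x N : ℝ} (hx : 0 < x) (hN : x < N) :
    x / N ≤ Real.log (N + x) / 2 - Real.log (N - x) / 2 := by
  have hN0 : 0 < N := hx.trans hN
  have hA : 0 < N - x := by linarith
  have h1 := Real.le_log_one_add_of_nonneg (x := 2 * x / (N - x)) (by positivity)
  have h2 : 1 + 2 * x / (N - x) = (N + x) / (N - x) := by
    field_simp
    ring
  have h3 : 2 * (2 * x / (N - x)) / (2 * x / (N - x) + 2) = 2 * (x / N) := by
    field_simp
    ring
  rw [h2, h3, Real.log_div (by positivity) hA.ne'] at h1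
  linarith

lemma re_one_div_add_natCast (z : ℂ) (j : ℕ) :
    (1 / (z + j)).re = (z.re + j) / ((z.re + j) ^ 2 + z.im ^ 2) := by
  rw [one_div, Complex.inv_re, Complex.normSq_apply]
  simp [sq]

open Filter Topology in
lemma tendsto_digamma_re {z : ℂ} (hz : 0 < z.re) :
    Tendsto (fun n : ℕ => Real.log n - ∑ j ∈ Finset.range (n + 1),
      (z.re + j) / ((z.re + j) ^ 2 + z.im ^ 2)) atTop (𝓝 (Complex.digamma z).re) := by
  have := (Complex.continuous_re.tendsto _).comp (tendsto_digamma hz)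
  refine this.congr fun n => ?_
  simp only [Function.comp, Complex.sub_re, Complex.ofReal_re, Complex.re_sum,
    re_one_div_add_natCast]

lemma digamma_re_le {z : ℂ} (hz : 1 / 2 ≤ z.re) :
    (Complex.digamma z).re ≤ Real.log (z.re ^ 2 + z.im ^ 2 - z.re + 1 / 2) / 2 := by
  refine le_of_tendsto (tendsto_digamma_re (by linarith)) ?_
  filter_upwards [Filter.eventually_ne_atTop 0] with n hn
  have key : ∀ m : ℕ, Real.log ((z.re + m) ^ 2 + z.im ^ 2 - (z.re + m) + 1 / 2) / 2 -
      Real.log (z.re ^ 2 + z.im ^ 2 - z.re + 1 / 2) / 2 ≤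
      ∑ j ∈ Finset.range m, (z.re + j) / ((z.re + j) ^ 2 + z.im ^ 2) := by
    intro m
    induction m with
    | zero => simp
    | succ m ih =>
      rw [Finset.sum_range_succ]
      have hm : (0 : ℝ) ≤ m := Nat.cast_nonneg m
      have := log_step_le (x := z.re + m) (N := (z.re + m) ^ 2 + z.im ^ 2) (by linarith)
        (by nlinarith [sq_nonneg z.im])
      have e : (z.re + (m + 1 : ℕ)) ^ 2 + z.im ^ 2 - (z.re + (m + 1 : ℕ)) + 1 / 2 =
          (z.re + m) ^ 2 + z.im ^ 2 + (z.re + m) + 1 / 2 := by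
        push_cast
        ring
      rw [e]
      linarith
  have h1 := key (n + 1)
  have hn0 : (0 : ℝ) < n := by exact_mod_cast Nat.pos_of_ne_zero hn
  have h2 : Real.log n ≤ Real.log ((z.re + (n + 1 : ℕ)) ^ 2 + z.im ^ 2 -
      (z.re + (n + 1 : ℕ)) + 1 / 2) / 2 := by
    rw [le_div_iff₀ two_pos, mul_comm, ← Real.log_rpow hn0]
    refine Real.log_le_log (by positivity) ?_
    push_cast
    rw [Real.rpow_two]
    nlinarith [sq_nonneg z.im, mul_nonneg hn0.le (by linarith : 0 ≤ z.re)]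
  linarith

open Filter Topology in
lemma tendsto_log_sub_log_quadratic (a b : ℝ) :
    Tendsto (fun n : ℕ => Real.log n - Real.log ((n : ℝ) ^ 2 + a * n + b) / 2) atTop (𝓝 0) := by
  have h1 : Tendsto (fun n : ℕ => 1 + a * ((n : ℝ))⁻¹ + b * ((n : ℝ)⁻¹ * (n : ℝ)⁻¹)) atTop
      (𝓝 1) := by
    have := tendsto_inv_atTop_nhds_zero_nat (𝕜 := ℝ)
    have := (tendsto_const_nhds (x := (1 : ℝ)).add (this.const_mul a)).add
      ((this.mul this).const_mul b)
    simpa using this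
  have h2 := (Real.continuousAt_log (one_ne_zero)).tendsto.comp h1
  have h3 := (h2.div_const 2).neg
  simp only [Real.log_one, zero_div, neg_zero] at h3
  refine h3.congr' ?_
  filter_upwards [eventually_ne_atTop 0, h1.eventually_ne one_ne_zero] with n hn h0
  have hn0 : (n : ℝ) ≠ 0 := by exact_mod_cast hn
  have e : (n : ℝ) ^ 2 + a * n + b =
      (n : ℝ) ^ 2 * (1 + a * ((n : ℝ))⁻¹ + b * ((n : ℝ)⁻¹ * (n : ℝ)⁻¹)) := by
    field_simp
  rw [e, Real.log_mul (by positivity) h0, Real.log_pow]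
  simp only [Function.comp]
  push_cast
  ring

open Filter Topology in
lemma le_digamma_re {z : ℂ} (hz : 0 < z.re) :
    Real.log (z.re ^ 2 + z.im ^ 2 + z.re) / 2 - z.re / (z.re ^ 2 + z.im ^ 2) ≤
      (Complex.digamma z).re := by
  have key : ∀ m : ℕ, ∑ j ∈ Finset.range (m + 1), (z.re + j) / ((z.re + j) ^ 2 + z.im ^ 2) ≤
      z.re / (z.re ^ 2 + z.im ^ 2) + (Real.log ((z.re + m) ^ 2 + z.im ^ 2 + (z.re + m)) / 2 -
      Real.log (z.re ^ 2 + z.im ^ 2 + z.re) / 2) := by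
    intro m
    induction m with
    | zero => simp
    | succ m ih =>
      rw [Finset.sum_range_succ]
      have hm : (0 : ℝ) ≤ m := Nat.cast_nonneg m
      have := le_log_step (x := z.re + (m + 1 : ℕ)) (N := (z.re + (m + 1 : ℕ)) ^ 2 + z.im ^ 2)
        (by positivity) (by push_cast; nlinarith [sq_nonneg z.im])
      have e : (z.re + (m + 1 : ℕ)) ^ 2 + z.im ^ 2 - (z.re + (m + 1 : ℕ)) =
          (z.re + m) ^ 2 + z.im ^ 2 + (z.re + m) := by
        push_cast
        ring
      rw [e] at this
      linarith
  have h1 := tendsto_digamma_re hz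
  have h2 := (tendsto_log_sub_log_quadratic (2 * z.re + 1) (z.re ^ 2 + z.im ^ 2 + z.re)).add_const
    (Real.log (z.re ^ 2 + z.im ^ 2 + z.re) / 2 - z.re / (z.re ^ 2 + z.im ^ 2))
  rw [zero_add] at h2
  refine le_of_tendsto_of_tendsto' h2 h1 fun n => ?_
  have := key n
  have e : (z.re + n) ^ 2 + z.im ^ 2 + (z.re + n) =
      (n : ℝ) ^ 2 + (2 * z.re + 1) * n + (z.re ^ 2 + z.im ^ 2 + z.re) := by ring
  rw [e] at this
  linarith

lemma two_mul_sub_div_add_le_log {A B : ℝ} (hA : 0 < A) (hAB : A ≤ B) :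
    2 * (B - A) / (A + B) ≤ Real.log B - Real.log A := by
  have hB : 0 < B := hA.trans_le hAB
  have h1 := Real.le_log_one_add_of_nonneg (x := (B - A) / A)
    (div_nonneg (by linarith) hA.le)
  have h2 : 1 + (B - A) / A = B / A := by
    field_simp
    ring
  have h3 : 2 * ((B - A) / A) / ((B - A) / A + 2) = 2 * (B - A) / (A + B) := by
    have : A + B ≠ 0 := by positivity
    have e : (B - A) / A + 2 = (A + B) / A := by
      field_simp
      ring
    rw [e]
    field_simp
  rw [h2, h3, Real.log_div hB.ne' hA.ne'] at h1
  exact h1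

lemma stechkin_digamma_aux {k x A N S c ε : ℝ} (hA : 0 < A) (hN : 0 < N) (hS : 0 < S)
    (B : ℝ)
    (h : 0 ≤ ε * A * N * S + c * N * S - k / 2 * (x * S * A - (B - A) * N * A)) :
    -(c / A) + k / 2 * (x / N - (B - A) / S) ≤ ε := by
  have e : ε - (-(c / A) + k / 2 * (x / N - (B - A) / S)) =
      (ε * A * N * S + c * N * S - k / 2 * (x * S * A - (B - A) * N * A)) / (A * N * S) := by
    field_simp
    ring
  have := div_nonneg h (by positivity : 0 ≤ A * N * S)
  linarith

/-- The real part of the digamma terms for odd characters. -/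
lemma stechkin_digamma_odd {s s₁ : ℂ} (hs : 1 < s.re) (hre : s₁.re = s.re + stechkinShift)
    (him : s₁.im = s.im) :
    (Complex.digamma ((s + 1) / 2)).re / 2
      - stechkinCoeff * ((Complex.digamma ((s₁ + 1) / 2)).re / 2) ≤
    (1 - stechkinCoeff) / 2 * (Real.log ((s.re ^ 2 + 1 + s.im ^ 2) / 4) / 2) + 0.045 := by
  have r0 : ((s + 1) / 2).re = (s.re + 1) / 2 := by simp
  have i0 : ((s + 1) / 2).im = s.im / 2 := by simp
  have r1 : ((s₁ + 1) / 2).re = (s.re + stechkinShift + 1) / 2 := by simp [hre]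
  have i1 : ((s₁ + 1) / 2).im = s.im / 2 := by simp [him]
  have h0 := digamma_re_le (z := (s + 1) / 2) (by rw [r0]; linarith)
  have h1 := le_digamma_re (z := (s₁ + 1) / 2) (by rw [r1]; unfold stechkinShift; linarith)
  rw [r0, i0] at h0
  rw [r1, i1] at h1
  obtain ⟨d, hd⟩ : ∃ d, s.re = 1 + d := ⟨s.re - 1, by ring⟩
  have hd0 : 0 < d := by linarith
  obtain ⟨v, hv⟩ : ∃ v, v = (s.im / 2) ^ 2 := ⟨_, rfl⟩
  have hv0 : 0 ≤ v := hv ▸ sq_nonneg _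
  have e0 : ((s.re + 1) / 2) ^ 2 + (s.im / 2) ^ 2 - (s.re + 1) / 2 + 1 / 2 =
      ((1 + d) ^ 2 + 1) / 4 + v := by rw [hd, hv]; ring
  have e1 : (s.re ^ 2 + 1 + s.im ^ 2) / 4 = ((1 + d) ^ 2 + 1) / 4 + v := by rw [hd, hv]; ring
  rw [e0] at h0
  rw [hd, ← hv] at h1
  rw [e1]
  unfold stechkinCoeff stechkinShift at *
  have hl := two_mul_sub_div_add_le_log (A := ((1 + d) ^ 2 + 1) / 4 + v)
    (B := ((1 + d + 0.618034 + 1) / 2) ^ 2 + v + (1 + d + 0.618034 + 1) / 2)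
    (by positivity) (by nlinarith)
  have := stechkin_digamma_aux (k := 0.447213) (x := (1 + d + 0.618034 + 1) / 2)
    (A := ((1 + d) ^ 2 + 1) / 4 + v) (N := ((1 + d + 0.618034 + 1) / 2) ^ 2 + v)
    (S := ((1 + d) ^ 2 + 1) / 4 + v + (((1 + d + 0.618034 + 1) / 2) ^ 2 + v +
      (1 + d + 0.618034 + 1) / 2)) (c := 0) (ε := 0.045)
    (by positivity) (by positivity) (by positivity)
    (((1 + d + 0.618034 + 1) / 2) ^ 2 + v + (1 + d + 0.618034 + 1) / 2)
    (by ring_nf; positivity)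
  rw [zero_div, neg_zero, zero_add] at this
  rw [mul_div_assoc] at hl
  linarith

/-- The real part of the digamma terms for even characters. -/
lemma stechkin_digamma_even {s s₁ : ℂ} (hs : 1 < s.re) (hre : s₁.re = s.re + stechkinShift)
    (him : s₁.im = s.im) :
    (Complex.digamma (s / 2)).re / 2 - stechkinCoeff * ((Complex.digamma (s₁ / 2)).re / 2) ≤
    (1 - stechkinCoeff) / 2 * (Real.log ((s.re ^ 2 + 1 + s.im ^ 2) / 4) / 2) + 0.045 := by
  have r0 : (s / 2).re = s.re / 2 := by simp
  have i0 : (s / 2).im = s.im / 2 := by simp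
  have r1 : (s₁ / 2).re = (s.re + stechkinShift) / 2 := by simp [hre]
  have i1 : (s₁ / 2).im = s.im / 2 := by simp [him]
  have h0 := digamma_re_le (z := s / 2) (by rw [r0]; linarith)
  have h1 := le_digamma_re (z := s₁ / 2) (by rw [r1]; unfold stechkinShift; linarith)
  rw [r0, i0] at h0
  rw [r1, i1] at h1
  obtain ⟨d, hd⟩ : ∃ d, s.re = 1 + d := ⟨s.re - 1, by ring⟩
  have hd0 : 0 < d := by linarith
  obtain ⟨v, hv⟩ : ∃ v, v = (s.im / 2) ^ 2 := ⟨_, rfl⟩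
  have hv0 : 0 ≤ v := hv ▸ sq_nonneg _
  have hA : 0 < ((1 + d) ^ 2 + 1) / 4 + v := by positivity
  have e0 : (s.re / 2) ^ 2 + (s.im / 2) ^ 2 - s.re / 2 + 1 / 2 =
      (((1 + d) ^ 2 + 1) / 4 + v) * (1 - (1 + 2 * d) / 4 / (((1 + d) ^ 2 + 1) / 4 + v)) := by
    rw [hd, ← hv]
    field_simp
    ring
  have e1 : (s.re ^ 2 + 1 + s.im ^ 2) / 4 = ((1 + d) ^ 2 + 1) / 4 + v := by rw [hd, hv]; ring
  have hlt : (1 + 2 * d) / 4 / (((1 + d) ^ 2 + 1) / 4 + v) < 1 := by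
    rw [div_lt_one hA]
    nlinarith
  have hpos : 0 < 1 - (1 + 2 * d) / 4 / (((1 + d) ^ 2 + 1) / 4 + v) := by linarith
  have hlog := Real.log_le_sub_one_of_pos hpos
  rw [e0, Real.log_mul hA.ne' hpos.ne'] at h0
  rw [hd, ← hv] at h1
  rw [e1]
  unfold stechkinCoeff stechkinShift at *
  have hl := two_mul_sub_div_add_le_log (A := ((1 + d) ^ 2 + 1) / 4 + v)
    (B := ((1 + d + 0.618034) / 2) ^ 2 + v + (1 + d + 0.618034) / 2)
    (by positivity) (by nlinarith)
  have := stechkin_digamma_aux (k := 0.447213) (x := (1 + d + 0.618034) / 2)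
    (A := ((1 + d) ^ 2 + 1) / 4 + v) (N := ((1 + d + 0.618034) / 2) ^ 2 + v)
    (S := ((1 + d) ^ 2 + 1) / 4 + v + (((1 + d + 0.618034) / 2) ^ 2 + v +
      (1 + d + 0.618034) / 2)) (c := (1 + 2 * d) / 16) (ε := 0.045)
    (by positivity) (by positivity) (by positivity)
    (((1 + d + 0.618034) / 2) ^ 2 + v + (1 + d + 0.618034) / 2)
    (by ring_nf; positivity)
  have e2 : (1 + 2 * d) / 16 / (((1 + d) ^ 2 + 1) / 4 + v) =
      (1 + 2 * d) / 4 / (((1 + d) ^ 2 + 1) / 4 + v) / 4 := by ring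
  rw [e2] at this
  rw [mul_div_assoc] at hl
  linarith

/-- The digamma terms for the zeta function at a real point. -/
lemma stechkin_digamma_real {s s₁ : ℂ} (hs : 1 < s.re) (hs' : s.re ≤ 1.1473) (hs0 : s.im = 0)
    (hre : s₁.re = s.re + stechkinShift) (him : s₁.im = s.im) :
    (Complex.digamma (s / 2)).re / 2 - stechkinCoeff * ((Complex.digamma (s₁ / 2)).re / 2) ≤
    -0.57 := by
  have r0 : (s / 2 + 1).re = s.re / 2 + 1 := by simp
  have i0 : (s / 2 + 1).im = 0 := by simp [hs0]
  have r1 : (s₁ / 2).re = (s.re + stechkinShift) / 2 := by simp [hre]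
  have i1 : (s₁ / 2).im = 0 := by simp [him, hs0]
  have h0 := digamma_re_le (z := s / 2 + 1) (by rw [r0]; linarith)
  have h1 := le_digamma_re (z := s₁ / 2) (by rw [r1]; unfold stechkinShift; linarith)
  have hsum := Complex.digamma_apply_add_one (s / 2) (fun m h => by
    have h2 := congrArg Complex.re h
    have : (0 : ℝ) ≤ m := Nat.cast_nonneg m
    simp at h2
    linarith)
  have hinv : ((s / 2)⁻¹).re = 2 / s.re := by
    have : s / 2 = ((s.re / 2 : ℝ) : ℂ) := by
      apply Complex.ext <;> simp [hs0]
    rw [this, ← Complex.ofReal_inv, Complex.ofReal_re, inv_div]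
  have hsum' := congrArg Complex.re hsum
  rw [Complex.add_re] at hsum'
  rw [r0, i0] at h0
  rw [r1, i1] at h1
  have hl2 := Real.log_two_lt_d9
  have hl2' := Real.log_two_gt_d9
  have ha : Real.log ((s.re / 2 + 1) ^ 2 + 0 ^ 2 - (s.re / 2 + 1) + 1 / 2) ≤
      Real.log 2 / 2 := by
    rw [le_div_iff₀ two_pos, mul_comm, ← Real.log_rpow (by nlinarith)]
    refine Real.log_le_log (Real.rpow_pos_of_pos (by nlinarith) _) ?_
    rw [Real.rpow_two]
    have h3 : (s.re / 2 + 1) ^ 2 + 0 ^ 2 - (s.re / 2 + 1) + 1 / 2 ≤ 1.403 := by nlinarith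
    have h4 : 0 ≤ (s.re / 2 + 1) ^ 2 + 0 ^ 2 - (s.re / 2 + 1) + 1 / 2 := by nlinarith
    nlinarith
  have hb : Real.log 2 / 2 ≤
      Real.log (((s.re + stechkinShift) / 2) ^ 2 + 0 ^ 2 + (s.re + stechkinShift) / 2) := by
    unfold stechkinShift
    rw [div_le_iff₀ two_pos, mul_comm, ← Real.log_rpow (by positivity)]
    refine Real.log_le_log two_pos ?_
    rw [Real.rpow_two]
    have h3 : 1.46 ≤ ((s.re + 0.618034) / 2) ^ 2 + 0 ^ 2 + (s.re + 0.618034) / 2 := by nlinarith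
    nlinarith
  have hc : (s.re + stechkinShift) / 2 / (((s.re + stechkinShift) / 2) ^ 2 + 0 ^ 2) =
      2 / (s.re + stechkinShift) := by
    have : s.re + stechkinShift ≠ 0 := by unfold stechkinShift; linarith
    field_simp
    ring
  have hd : -(1 / s.re) + stechkinCoeff * (1 / (s.re + stechkinShift)) ≤ -0.6182 := by
    unfold stechkinCoeff stechkinShift
    have p1 : 0 < s.re := by linarith
    have p2 : 0 < s.re + 0.618034 := by linarith
    have : -(1 / s.re) + 0.447213 * (1 / (s.re + 0.618034)) - (-0.6182) =
      (0.6182 * s.re * (s.re + 0.618034) - (s.re + 0.618034) + 0.447213 * s.re) /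
        (s.re * (s.re + 0.618034)) := by
      field_simp
      ring
    have h5 : (0.6182 * s.re * (s.re + 0.618034) - (s.re + 0.618034) + 0.447213 * s.re) /
        (s.re * (s.re + 0.618034)) ≤ 0 := by
      apply div_nonpos_of_nonpos_of_nonneg _ (by positivity)
      nlinarith
    linarith
  rw [hc] at h1
  rw [hsum', hinv] at h0
  have hd1 : 2 / s.re = 2 * (1 / s.re) := by ring
  have hd2 : 2 / (s.re + stechkinShift) = 2 * (1 / (s.re + stechkinShift)) := by ring
  rw [hd1] at h0
  rw [hd2] at h1
  unfold stechkinCoeff at *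
  linarith

open MeasureTheory in
/-- A Mellin transform that converges everywhere is bounded on vertical strips. -/
lemma exists_norm_mellin_le {f : ℝ → ℂ} (hf : ∀ s : ℂ, MellinConvergent f s) (a b : ℝ) :
    ∃ C, ∀ s : ℂ, a ≤ s.re → s.re ≤ b → ‖mellin f s‖ ≤ C := by
  refine ⟨∫ t in Set.Ioi (0 : ℝ), (‖(t : ℂ) ^ ((a : ℂ) - 1) • f t‖ +
    ‖(t : ℂ) ^ ((b : ℂ) - 1) • f t‖), fun s ha hb => ?_⟩
  refine norm_integral_le_of_norm_le ((hf a).norm.add (hf b).norm) ?_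
  refine (ae_restrict_iff' measurableSet_Ioi).2 (Filter.Eventually.of_forall fun t ht => ?_)
  have ht0 : (0 : ℝ) < t := ht
  simp only [norm_smul, Complex.norm_cpow_eq_rpow_re_of_pos ht0, Complex.sub_re,
    Complex.one_re, Complex.ofReal_re]
  rw [← add_mul]
  gcongr
  rcases le_total t 1 with h | h
  · have := Real.rpow_le_rpow_of_exponent_ge ht0 h (sub_le_sub_right ha 1)
    have h2 := (Real.rpow_pos_of_pos ht0 (b - 1)).le
    linarith
  · have := Real.rpow_le_rpow_of_exponent_le h (sub_le_sub_right hb 1)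
    have h2 := (Real.rpow_pos_of_pos ht0 (a - 1)).le
    linarith

lemma WeakFEPair.exists_norm_Λ₀_le (P : WeakFEPair ℂ) (a b : ℝ) :
    ∃ C, ∀ s : ℂ, a ≤ s.re → s.re ≤ b → ‖P.Λ₀ s‖ ≤ C :=
  exists_norm_mellin_le (fun s => (P.isStrongFEPair_toStrongFEPair.hasMellin s).1) a b

lemma IsStrongFEPair.exists_norm_Λ_le {P : WeakFEPair ℂ} (hP : IsStrongFEPair P) (a b : ℝ) :
    ∃ C, ∀ s : ℂ, a ≤ s.re → s.re ≤ b → ‖P.Λ s‖ ≤ C := by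
  rw [hP.Λ_eq]
  exact exists_norm_mellin_le (fun s => (hP.hasMellin s).1) a b

lemma exists_norm_completedHurwitzZetaEven₀_le (x : UnitAddCircle) (a b : ℝ) :
    ∃ C, ∀ s : ℂ, a ≤ s.re → s.re ≤ b → ‖HurwitzZeta.completedHurwitzZetaEven₀ x s‖ ≤ C := by
  obtain ⟨C, hC⟩ := (HurwitzZeta.hurwitzEvenFEPair x).exists_norm_Λ₀_le (a / 2) (b / 2)
  refine ⟨C / 2, fun s ha hb => ?_⟩
  rw [HurwitzZeta.completedHurwitzZetaEven₀, norm_div, Complex.norm_two]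
  gcongr
  refine hC _ ?_ ?_ <;> simpa using by linarith

lemma exists_norm_completedHurwitzZetaOdd_le (x : UnitAddCircle) (a b : ℝ) :
    ∃ C, ∀ s : ℂ, a ≤ s.re → s.re ≤ b → ‖HurwitzZeta.completedHurwitzZetaOdd x s‖ ≤ C := by
  obtain ⟨C, hC⟩ := (HurwitzZeta.isStrong_hurwitzOddFEPair x).exists_norm_Λ_le
    ((a + 1) / 2) ((b + 1) / 2)
  refine ⟨C / 2, fun s ha hb => ?_⟩
  rw [HurwitzZeta.completedHurwitzZetaOdd, norm_div, Complex.norm_two]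
  gcongr
  refine hC _ ?_ ?_ <;> simpa using by linarith

lemma norm_natCast_cpow_le {N : ℕ} (hN : 0 < N) {s : ℂ} {b : ℝ} (hs : s.re ≤ b) :
    ‖(N : ℂ) ^ s‖ ≤ (N : ℝ) ^ b := by
  rw [Complex.norm_natCast_cpow_of_pos hN]
  exact Real.rpow_le_rpow_of_exponent_le (by exact_mod_cast hN) hs

/-- The completed `L`-function of a nontrivial character is bounded on vertical strips. -/
lemma exists_norm_completedLFunction_le {N : ℕ} [NeZero N] {χ : DirichletCharacter ℂ N}
    (hχ : χ ≠ 1) (a b : ℝ) :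
    ∃ C, ∀ s : ℂ, a ≤ s.re → s.re ≤ b → ‖DirichletCharacter.completedLFunction χ s‖ ≤ C := by
  choose C hC using fun j : ZMod N =>
    exists_norm_completedHurwitzZetaEven₀_le (ZMod.toAddCircle j) a b
  choose D hD using fun j : ZMod N =>
    exists_norm_completedHurwitzZetaOdd_le (ZMod.toAddCircle j) a b
  refine ⟨(N : ℝ) ^ (-a) * ∑ j, ‖χ j‖ * C j + (N : ℝ) ^ (-a) * ∑ j, ‖χ j‖ * D j,
    fun s ha hb => ?_⟩
  have h0 : χ 0 = 0 := χ.map_zero' (hχ ∘ DirichletCharacter.level_one' _)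
  have h1 : ∑ j, χ j = 0 := χ.sum_eq_zero_of_ne_one hχ
  have hN := norm_natCast_cpow_le (NeZero.pos N) (s := -s) (b := -a) (by simpa using ha)
  rw [DirichletCharacter.completedLFunction, ZMod.completedLFunction_eq, h0, h1]
  simp only [mul_zero, zero_div, sub_zero]
  rw [ZMod.completedLFunction₀]
  refine (norm_add_le _ _).trans (add_le_add ?_ ?_) <;> rw [norm_mul] <;>
    refine mul_le_mul hN ((norm_sum_le _ _).trans (Finset.sum_le_sum fun j _ => ?_))
      (norm_nonneg _) (by positivity) <;> rw [norm_mul] <;> gcongr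
  · exact hC j s ha hb
  · exact hD j s ha hb

lemma Gamma_le_exp_rpow {x : ℝ} (hx : 1 ≤ x) :
    Real.Gamma x ≤ Real.exp (2 * (3 * x) ^ (3 / 2 : ℝ)) := by
  have hx0 : 0 < x := by linarith
  set m := ⌈x⌉₊ with hm
  have hm1 : x ≤ m := Nat.le_ceil x
  have hm2 : (m : ℝ) < x + 1 := Nat.ceil_lt_add_one hx0.le
  have h1 : Real.Gamma x ≤ Real.Gamma (x + 2) := by
    have e : Real.Gamma (x + 2) = (x + 1) * (x * Real.Gamma x) := by
      rw [show x + 2 = (x + 1) + 1 by ring, Real.Gamma_add_one (by linarith),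
        Real.Gamma_add_one hx0.ne']
    have h := Real.Gamma_pos_of_pos hx0
    rw [e]
    nlinarith [mul_pos hx0 h]
  have h2 : Real.Gamma (x + 2) ≤ Real.Gamma ((m + 1 : ℕ) + 1) :=
    Real.Gamma_strictMonoOn_Ici.monotoneOn (by simp [hx0.le]) (by
      simp only [Set.mem_Ici]; push_cast; linarith) (by push_cast; linarith)
  rw [Real.Gamma_nat_eq_factorial] at h2
  have h3 : (((m + 1).factorial : ℕ) : ℝ) ≤ ((m + 1 : ℕ) : ℝ) ^ (m + 1) := by
    exact_mod_cast Nat.factorial_le_pow (m + 1)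
  have hy : (0 : ℝ) < ((m + 1 : ℕ) : ℝ) := by positivity
  have h4 : Real.log ((m + 1 : ℕ) : ℝ) ≤ 2 * ((m + 1 : ℕ) : ℝ) ^ (1 / 2 : ℝ) := by
    have := Real.log_le_sub_one_of_pos (Real.rpow_pos_of_pos hy (1 / 2))
    rw [Real.log_rpow hy] at this
    linarith
  have h5 : ((m + 1 : ℕ) : ℝ) ^ (m + 1) = Real.exp ((m + 1 : ℕ) * Real.log ((m + 1 : ℕ) : ℝ)) := by
    rw [mul_comm, Real.exp_mul, Real.exp_log hy, Real.rpow_natCast]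
  refine h1.trans (h2.trans (h3.trans ?_))
  rw [h5]
  refine Real.exp_le_exp.2 ?_
  calc ((m + 1 : ℕ) : ℝ) * Real.log ((m + 1 : ℕ) : ℝ)
      ≤ ((m + 1 : ℕ) : ℝ) * (2 * ((m + 1 : ℕ) : ℝ) ^ (1 / 2 : ℝ)) := by gcongr
    _ = 2 * ((m + 1 : ℕ) : ℝ) ^ (3 / 2 : ℝ) := by
        rw [show (3 / 2 : ℝ) = 1 + 1 / 2 by norm_num, Real.rpow_add hy, Real.rpow_one]
        ring
    _ ≤ _ := by
        gcongr
        push_cast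
        linarith

lemma norm_Gammaℝ_le {s : ℂ} (hs : 2 ≤ s.re) :
    ‖Complex.Gammaℝ s‖ ≤ Real.exp (2 * (3 * s.re) ^ (3 / 2 : ℝ)) := by
  have h2 : (s / 2).re = s.re / 2 := by simp
  have h1 : ‖Complex.Gamma (s / 2)‖ ≤ Real.Gamma (s.re / 2) := by
    refine le_of_tendsto ((Complex.GammaSeq_tendsto_Gamma (s / 2)).norm) ?_
    filter_upwards [Filter.eventually_ne_atTop 0] with n hn
    have := norm_GammaSeq_le (z := s / 2) (by rw [h2]; linarith) hn
    rwa [h2] at this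
  have h3 : ‖(π : ℂ) ^ (-s / 2)‖ ≤ 1 := by
    rw [Complex.norm_cpow_eq_rpow_re_of_pos Real.pi_pos]
    refine Real.rpow_le_one_of_one_le_of_nonpos (by linarith [Real.pi_gt_three]) ?_
    simp
    linarith
  rw [Complex.Gammaℝ_def, norm_mul]
  calc _ ≤ 1 * Real.Gamma (s.re / 2) := by gcongr
    _ ≤ Real.exp (2 * (3 * (s.re / 2)) ^ (3 / 2 : ℝ)) := by
        rw [one_mul]
        exact Gamma_le_exp_rpow (by linarith)
    _ ≤ _ := by
        gcongr
        linarith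

lemma SymEntire.of_bounds {f : ℂ → ℂ} (hd : Differentiable ℂ f)
    (hsymm : ∀ s, ‖f (1 - (starRingEnd ℂ) s)‖ = ‖f s‖) (hne : ∀ s : ℂ, 1 < s.re → f s ≠ 0)
    {C D : ℝ} (hC : 0 < C)
    (hright : ∀ s : ℂ, 2 ≤ s.re → ‖f s‖ ≤ Real.exp (C * ‖s‖ ^ (3 / 2 : ℝ)))
    (hstrip : ∀ s : ℂ, -1 ≤ s.re → s.re ≤ 2 → 1 ≤ ‖s‖ →
      ‖f s‖ ≤ Real.exp (D * ‖s‖ ^ (3 / 2 : ℝ))) : SymEntire f := by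
  refine ⟨hd, hsymm, hne, max (C * 2 ^ (3 / 2 : ℝ)) D, 1, lt_max_of_lt_left (by positivity),
    fun s hs => ?_⟩
  have h1 : (1 : ℝ) ≤ 2 ^ (3 / 2 : ℝ) := Real.one_le_rpow (by norm_num) (by norm_num)
  have hs3 : 0 ≤ ‖s‖ ^ (3 / 2 : ℝ) := by positivity
  have hCmax : C * 2 ^ (3 / 2 : ℝ) ≤ max (C * 2 ^ (3 / 2 : ℝ)) D := le_max_left _ _
  rcases le_total 2 s.re with h2 | h2
  · refine (hright s h2).trans (Real.exp_le_exp.2 ?_)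
    gcongr
    nlinarith
  rcases le_total (-1) s.re with h3 | h3
  · refine (hstrip s h3 h2 hs).trans (Real.exp_le_exp.2 ?_)
    gcongr
    exact le_max_right _ _
  · rw [← hsymm s]
    refine (hright _ (by simp; linarith)).trans (Real.exp_le_exp.2 ?_)
    have h4 : ‖1 - (starRingEnd ℂ) s‖ ≤ 2 * ‖s‖ := by
      refine (norm_sub_le _ _).trans ?_
      rw [norm_one, RCLike.norm_conj]
      linarith
    calc C * ‖1 - (starRingEnd ℂ) s‖ ^ (3 / 2 : ℝ) ≤ C * (2 * ‖s‖) ^ (3 / 2 : ℝ) := by gcongr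
      _ = C * 2 ^ (3 / 2 : ℝ) * ‖s‖ ^ (3 / 2 : ℝ) := by
        rw [Real.mul_rpow (by norm_num) (norm_nonneg _)]
        ring
      _ ≤ _ := by gcongr

lemma conj_natCast_cpow (n : ℕ) (s : ℂ) :
    (starRingEnd ℂ) ((n : ℂ) ^ s) = (n : ℂ) ^ ((starRingEnd ℂ) s) := by
  have h := Complex.conj_cpow (n : ℂ) ((starRingEnd ℂ) s)
    (by rw [Complex.natCast_arg]; exact Real.pi_pos.ne)
  rw [Complex.conj_conj, Complex.conj_natCast] at h
  exact h.symm

namespace DirichletCharacter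

lemma LFunction_inv_conj {N : ℕ} [NeZero N] (χ : DirichletCharacter ℂ N) {s : ℂ} (hs : 1 < s.re) :
    LFunction χ⁻¹ ((starRingEnd ℂ) s) = (starRingEnd ℂ) (LFunction χ s) := by
  rw [LFunction_eq_LSeries _ hs, LFunction_eq_LSeries _ (by simpa using hs), LSeries, LSeries,
    Complex.conj_tsum]
  refine tsum_congr fun n => ?_
  rcases eq_or_ne n 0 with rfl | hn
  · simp
  · rw [LSeries.term_of_ne_zero hn, LSeries.term_of_ne_zero hn, map_div₀, conj_natCast_cpow,
      ← MulChar.star_apply', RCLike.star_def]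

lemma Even.inv {N : ℕ} {χ : DirichletCharacter ℂ N} (h : χ.Even) : (χ⁻¹).Even := by
  rw [Even, ← MulChar.star_apply', show χ (-1) = 1 from h, star_one]

lemma Odd.inv {N : ℕ} {χ : DirichletCharacter ℂ N} (h : χ.Odd) : (χ⁻¹).Odd := by
  rw [Odd, ← MulChar.star_apply', show χ (-1) = -1 from h, star_neg, star_one]

lemma _root_.Complex.Gammaℝ_conj (s : ℂ) :
    Complex.Gammaℝ ((starRingEnd ℂ) s) = (starRingEnd ℂ) (Complex.Gammaℝ s) := by
  have h := Complex.conj_cpow (π : ℂ) (-(starRingEnd ℂ) s / 2)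
    (by rw [Complex.arg_ofReal_of_nonneg Real.pi_pos.le]; exact Real.pi_pos.ne)
  rw [Complex.conj_ofReal] at h
  rw [Complex.Gammaℝ_def, Complex.Gammaℝ_def, map_mul, h, ← Complex.Gamma_conj]
  simp [map_div₀, Complex.conj_ofNat]

lemma gammaFactor_inv_conj {N : ℕ} [NeZero N] (χ : DirichletCharacter ℂ N) (s : ℂ) :
    gammaFactor χ⁻¹ ((starRingEnd ℂ) s) = (starRingEnd ℂ) (gammaFactor χ s) := by
  rcases χ.even_or_odd with h | h
  · rw [h.gammaFactor_def, h.inv.gammaFactor_def, Complex.Gammaℝ_conj]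
  · rw [h.gammaFactor_def, h.inv.gammaFactor_def, ← Complex.Gammaℝ_conj]
    simp

lemma gammaFactor_ne_zero {N : ℕ} (χ : DirichletCharacter ℂ N) {s : ℂ} (hs : 0 < s.re) :
    gammaFactor χ s ≠ 0 := by
  rcases χ.even_or_odd with h | h <;> rw [h.gammaFactor_def]
  · exact Complex.Gammaℝ_ne_zero_of_re_pos hs
  · exact Complex.Gammaℝ_ne_zero_of_re_pos (by simp; linarith)

lemma completedLFunction_eq_mul {N : ℕ} [NeZero N] (χ : DirichletCharacter ℂ N) {s : ℂ} (hs : 0 < s.re) :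
    completedLFunction χ s = gammaFactor χ s * LFunction χ s := by
  rw [LFunction_eq_completed_div_gammaFactor χ s (Or.inl (by rintro rfl; simp at hs)),
    mul_div_cancel₀ _ (gammaFactor_ne_zero χ hs)]

lemma completedLFunction_inv_conj {N : ℕ} [NeZero N] {χ : DirichletCharacter ℂ N} (hχ : χ ≠ 1) (s : ℂ) :
    completedLFunction χ⁻¹ ((starRingEnd ℂ) s) = (starRingEnd ℂ) (completedLFunction χ s) := by
  have h1 : Differentiable ℂ (starRingEnd ℂ ∘ completedLFunction χ ∘ starRingEnd ℂ) :=
    fun s => by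
      have := (differentiable_completedLFunction hχ ((starRingEnd ℂ) s)).conj_conj
      rwa [Complex.conj_conj] at this
  have h2 : Differentiable ℂ (completedLFunction χ⁻¹) :=
    differentiable_completedLFunction (inv_ne_one.2 hχ)
  have h3 := AnalyticOnNhd.eq_of_eventuallyEq (fun s _ => h2.analyticAt s)
    (fun s _ => h1.analyticAt s) (z₀ := 2) (by
      have hV : {s : ℂ | 1 < s.re} ∈ nhds (2 : ℂ) :=
        (isOpen_lt continuous_const Complex.continuous_re).mem_nhds (by simp)
      filter_upwards [hV] with z hz
      have hz1 : 1 < z.re := hz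
      have hz2 : 1 < ((starRingEnd ℂ) z).re := by simpa using hz1
      have e := LFunction_inv_conj χ hz2
      have e' := gammaFactor_inv_conj χ ((starRingEnd ℂ) z)
      rw [Complex.conj_conj] at e e'
      simp only [Function.comp]
      rw [completedLFunction_eq_mul _ (by linarith), completedLFunction_eq_mul _ (by linarith),
        map_mul, e, e'])
  have := congrFun h3 ((starRingEnd ℂ) s)
  simpa using this

lemma completedLFunction_ne_zero {N : ℕ} [NeZero N] (χ : DirichletCharacter ℂ N) {s : ℂ} (hs : 1 < s.re) :
    completedLFunction χ s ≠ 0 := by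
  rw [completedLFunction_eq_mul _ (by linarith)]
  exact mul_ne_zero (gammaFactor_ne_zero χ (by linarith))
    (LFunction_ne_zero_of_one_le_re χ (Or.inr (by rintro rfl; simp at hs)) hs.le)

lemma IsPrimitive.inv {N : ℕ} {χ : DirichletCharacter ℂ N} (h : χ.IsPrimitive) : (χ⁻¹).IsPrimitive := by
  rw [isPrimitive_def, conductor_inv]
  exact h

lemma norm_rootNumber {N : ℕ} [NeZero N] {χ : DirichletCharacter ℂ N} (hp : χ.IsPrimitive) (hχ : χ ≠ 1) :
    ‖rootNumber χ‖ = 1 := by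
  have hN := NeZero.pos N
  have a1 := congrArg norm (hp.completedLFunction_one_sub 2)
  have a2 := congrArg norm (hp.inv.completedLFunction_one_sub (-1))
  have c1 : ‖completedLFunction χ⁻¹ 2‖ = ‖completedLFunction χ 2‖ := by
    have := congrArg norm (completedLFunction_inv_conj hχ 2)
    rwa [RCLike.norm_conj, map_ofNat] at this
  have c2 : ‖completedLFunction χ⁻¹ (-1)‖ = ‖completedLFunction χ (-1)‖ := by
    have := congrArg norm (completedLFunction_inv_conj hχ (-1))
    rwa [RCLike.norm_conj, map_neg, map_one] at this
  have c3 := norm_pos_iff.2 (completedLFunction_ne_zero χ (s := 2) (by simp))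
  have b1 := congrArg norm (hp.inv.completedLFunction_one_sub 2)
  rw [inv_inv] at b1 a2
  rw [norm_mul, norm_mul, Complex.norm_natCast_cpow_of_pos hN] at a1 a2 b1
  norm_num at a1 a2 b1
  rw [c1] at a1 a2
  rw [c2] at b1
  have hn0 : (0 : ℝ) < (N : ℝ) ^ (3 / 2 : ℝ) := by positivity
  have hn1 : (N : ℝ) ^ (-(3 / 2) : ℝ) * (N : ℝ) ^ (3 / 2 : ℝ) = 1 := by
    rw [← Real.rpow_add (by exact_mod_cast hN)]
    norm_num
  have hW : ‖rootNumber χ‖ = ‖rootNumber χ⁻¹‖ := by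
    have : (N : ℝ) ^ (3 / 2 : ℝ) * ‖completedLFunction χ 2‖ * ‖rootNumber χ‖ =
        (N : ℝ) ^ (3 / 2 : ℝ) * ‖completedLFunction χ 2‖ * ‖rootNumber χ⁻¹‖ := by linarith
    exact mul_left_cancel₀ (by positivity) this
  rw [← hW, a1] at a2
  have h1 : ‖completedLFunction χ 2‖ * (‖rootNumber χ‖ ^ 2) = ‖completedLFunction χ 2‖ * 1 := by
    linear_combination (‖completedLFunction χ 2‖ * ‖rootNumber χ‖ ^ 2) * (-hn1) - a2
  have h2 := mul_left_cancel₀ c3.ne' h1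
  nlinarith [norm_nonneg (rootNumber χ)]

end DirichletCharacter

namespace DirichletCharacter

lemma exists_norm_LFunction_le {N : ℕ} [NeZero N] (χ : DirichletCharacter ℂ N) :
    ∃ K, 0 < K ∧ ∀ s : ℂ, 2 ≤ s.re → ‖LFunction χ s‖ ≤ K := by
  have hsum : LSeriesSummable (fun n => χ n) 2 := LSeriesSummable_of_one_lt_re χ (by simp)
  refine ⟨(∑' n, ‖LSeries.term (fun n => χ n) 2 n‖) + 1,
    add_pos_of_nonneg_of_pos (tsum_nonneg fun _ => norm_nonneg _) one_pos, fun s hs => ?_⟩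
  rw [LFunction_eq_LSeries χ (by linarith), LSeries]
  have hs' : LSeriesSummable (fun n => χ n) s := LSeriesSummable_of_one_lt_re χ (by linarith)
  refine (norm_tsum_le_tsum_norm hs'.norm).trans (le_add_of_le_of_nonneg ?_ zero_le_one)
  exact hs'.norm.tsum_le_tsum (fun n => LSeries.norm_term_le_of_re_le_re _ (by simpa using hs) n)
    hsum.norm

lemma norm_gammaFactor_le {N : ℕ} (χ : DirichletCharacter ℂ N) {s : ℂ} (hs : 2 ≤ s.re) :
    ‖gammaFactor χ s‖ ≤ Real.exp (2 * (6 * s.re) ^ (3 / 2 : ℝ)) := by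
  rcases χ.even_or_odd with h | h <;> rw [h.gammaFactor_def]
  · refine (norm_Gammaℝ_le hs).trans (Real.exp_le_exp.2 ?_)
    gcongr
    norm_num
  · refine (norm_Gammaℝ_le (by simp; linarith)).trans (Real.exp_le_exp.2 ?_)
    have : 3 * (s + 1).re ≤ 6 * s.re := by simp; linarith
    gcongr
    simp
    linarith

/-- The completed `L`-function, normalised so that it is symmetric under `s ↦ 1 - conj s`. -/
noncomputable def xiFunction {N : ℕ} [NeZero N] (χ : DirichletCharacter ℂ N) (s : ℂ) : ℂ :=
  (N : ℂ) ^ (s / 2) * completedLFunction χ s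

lemma norm_xiFunction_symm {N : ℕ} [NeZero N] {χ : DirichletCharacter ℂ N} (hp : χ.IsPrimitive)
    (hχ : χ ≠ 1) (s : ℂ) : ‖xiFunction χ (1 - (starRingEnd ℂ) s)‖ = ‖xiFunction χ s‖ := by
  have hN := NeZero.pos N
  have hN' : (0 : ℝ) < N := by exact_mod_cast hN
  rw [xiFunction, xiFunction, hp.completedLFunction_one_sub, completedLFunction_inv_conj hχ]
  simp only [norm_mul, RCLike.norm_conj, norm_rootNumber hp hχ,
    Complex.norm_natCast_cpow_of_pos hN, mul_one]
  rw [← mul_assoc, ← Real.rpow_add hN']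
  congr 2
  simp
  ring

lemma differentiable_xiFunction {N : ℕ} [NeZero N] {χ : DirichletCharacter ℂ N}
    (hχ : χ ≠ 1) : Differentiable ℂ (xiFunction χ) := by
  have hN : (N : ℂ) ≠ 0 := by exact_mod_cast NeZero.ne N
  have h1 : Differentiable ℂ fun s : ℂ => (N : ℂ) ^ (s / 2) := fun s =>
    (differentiableAt_id.div_const 2).const_cpow (Or.inl hN)
  exact h1.mul (differentiable_completedLFunction hχ)

lemma one_le_norm_rpow {x : ℝ} (h : 1 ≤ x) : x ≤ x ^ (3 / 2 : ℝ) := by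
  simpa using Real.rpow_le_rpow_of_exponent_le h (show (1 : ℝ) ≤ 3 / 2 by norm_num)

lemma symEntire_xiFunction {N : ℕ} [NeZero N] {χ : DirichletCharacter ℂ N} (hp : χ.IsPrimitive)
    (hχ : χ ≠ 1) : SymEntire (xiFunction χ) := by
  have hN := NeZero.pos N
  have hN' : (1 : ℝ) ≤ N := by exact_mod_cast hN
  have hlog : 0 ≤ Real.log N := Real.log_nonneg hN'
  obtain ⟨K, hK0, hK⟩ := exists_norm_LFunction_le χ
  obtain ⟨B, hB⟩ := exists_norm_completedLFunction_le hχ (-1) 2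
  refine SymEntire.of_bounds (C := Real.log N + 2 * 6 ^ (3 / 2 : ℝ) + K) (D := Real.log N + |B|)
    (differentiable_xiFunction hχ) (norm_xiFunction_symm hp hχ)
    (fun s hs => mul_ne_zero ?_ (completedLFunction_ne_zero χ hs)) (by positivity)
    (fun s hs => ?_) (fun s h1 h2 hs => ?_)
  · exact (Complex.cpow_ne_zero_iff_of_exponent_ne_zero (by
      intro h
      have := congrArg Complex.re h
      simp at this
      linarith)).2 (by exact_mod_cast NeZero.ne N)
  · have hre : s.re ≤ ‖s‖ := Complex.re_le_norm s
    have hs2 : 2 ≤ ‖s‖ := hs.trans hre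
    have h32 := one_le_norm_rpow (show 1 ≤ ‖s‖ by linarith)
    have n1 : ‖(N : ℂ) ^ (s / 2)‖ ≤ Real.exp (Real.log N * ‖s‖ ^ (3 / 2 : ℝ)) := by
      rw [Complex.norm_natCast_cpow_of_pos hN, Real.rpow_def_of_pos (by linarith)]
      refine Real.exp_le_exp.2 (mul_le_mul_of_nonneg_left ?_ hlog)
      simp
      linarith
    have n2 : ‖gammaFactor χ s‖ ≤ Real.exp (2 * 6 ^ (3 / 2 : ℝ) * ‖s‖ ^ (3 / 2 : ℝ)) := by
      refine (norm_gammaFactor_le χ hs).trans (Real.exp_le_exp.2 ?_)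
      rw [mul_assoc, ← Real.mul_rpow (by norm_num) (norm_nonneg _)]
      gcongr
    have n3 : ‖LFunction χ s‖ ≤ Real.exp (K * ‖s‖ ^ (3 / 2 : ℝ)) := by
      refine (hK s hs).trans ?_
      have := Real.add_one_le_exp (K * ‖s‖ ^ (3 / 2 : ℝ))
      nlinarith
    rw [xiFunction, completedLFunction_eq_mul _ (by linarith), norm_mul, norm_mul]
    calc _ ≤ Real.exp (Real.log N * ‖s‖ ^ (3 / 2 : ℝ)) *
          (Real.exp (2 * 6 ^ (3 / 2 : ℝ) * ‖s‖ ^ (3 / 2 : ℝ)) *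
            Real.exp (K * ‖s‖ ^ (3 / 2 : ℝ))) := by gcongr
      _ = _ := by
        rw [← Real.exp_add, ← Real.exp_add]
        ring_nf
  · have h32 := one_le_norm_rpow hs
    have n1 : ‖(N : ℂ) ^ (s / 2)‖ ≤ Real.exp (Real.log N * ‖s‖ ^ (3 / 2 : ℝ)) := by
      rw [Complex.norm_natCast_cpow_of_pos hN, Real.rpow_def_of_pos (by linarith)]
      refine Real.exp_le_exp.2 (mul_le_mul_of_nonneg_left ?_ hlog)
      simp
      linarith
    have n2 : ‖completedLFunction χ s‖ ≤ Real.exp (|B| * ‖s‖ ^ (3 / 2 : ℝ)) := by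
      refine (hB s h1 h2).trans ?_
      have := Real.add_one_le_exp (|B| * ‖s‖ ^ (3 / 2 : ℝ))
      nlinarith [abs_nonneg B, le_abs_self B]
    rw [xiFunction, norm_mul]
    calc _ ≤ Real.exp (Real.log N * ‖s‖ ^ (3 / 2 : ℝ)) *
            Real.exp (|B| * ‖s‖ ^ (3 / 2 : ℝ)) := by gcongr
      _ = _ := by
        rw [← Real.exp_add]
        ring_nf

lemma xiFunction_eq_zero_iff {N : ℕ} [NeZero N] (χ : DirichletCharacter ℂ N) {s : ℂ}
    (hs : 0 < s.re) : xiFunction χ s = 0 ↔ LFunction χ s = 0 := by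
  rw [xiFunction, completedLFunction_eq_mul _ hs, mul_eq_zero, mul_eq_zero]
  have h1 : (N : ℂ) ^ (s / 2) ≠ 0 := fun h =>
    NeZero.ne N (by exact_mod_cast (Complex.cpow_eq_zero_iff _ _).1 h |>.1)
  simp [h1, gammaFactor_ne_zero χ hs]

lemma LFunction_inv_conj_eq_zero {N : ℕ} [NeZero N] {χ : DirichletCharacter ℂ N} (hχ : χ ≠ 1)
    {s : ℂ} (hs : 0 < s.re) (h : LFunction χ s = 0) :
    LFunction χ⁻¹ ((starRingEnd ℂ) s) = 0 := by
  rw [← xiFunction_eq_zero_iff _ (by simpa using hs), xiFunction, completedLFunction_inv_conj hχ,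
    completedLFunction_eq_mul _ hs, h]
  simp

end DirichletCharacter

lemma Complex.logDeriv_Gammaℝ {s : ℂ} (hs : 0 < s.re) :
    logDeriv Complex.Gammaℝ s = -(Real.log π : ℂ) / 2 + Complex.digamma (s / 2) / 2 := by
  have hπ : (π : ℂ) ≠ 0 := by exact_mod_cast Real.pi_ne_zero
  have h2 : 0 < (s / 2).re := by simpa using hs
  have hG : DifferentiableAt ℂ Complex.Gamma (s / 2) := Complex.differentiableAt_Gamma _ (by
    intro m h
    rw [h] at h2
    simp at h2
    linarith [Nat.cast_nonneg (α := ℝ) m])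
  have d1 : HasDerivAt (fun s : ℂ => (π : ℂ) ^ (-s / 2))
      ((π : ℂ) ^ (-s / 2) * Complex.log π * (-1 / 2)) s :=
    ((hasDerivAt_id s).neg.div_const 2).const_cpow (Or.inl hπ)
  have d2 : HasDerivAt (fun s : ℂ => Complex.Gamma (s / 2)) (deriv Complex.Gamma (s / 2) * (1 / 2)) s :=
    HasDerivAt.comp s hG.hasDerivAt ((hasDerivAt_id s).div_const 2)
  have hp : (π : ℂ) ^ (-s / 2) ≠ 0 := fun h => hπ ((Complex.cpow_eq_zero_iff _ _).1 h).1
  have hg : Complex.Gamma (s / 2) ≠ 0 := Complex.Gamma_ne_zero_of_re_pos h2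
  have e : Complex.Gammaℝ = fun s : ℂ => (π : ℂ) ^ (-s / 2) * Complex.Gamma (s / 2) :=
    funext Complex.Gammaℝ_def
  rw [e, logDeriv_mul s hp hg d1.differentiableAt d2.differentiableAt, logDeriv_apply, logDeriv_apply,
    d1.deriv, d2.deriv, Complex.digamma_def, logDeriv_apply, Complex.ofReal_log Real.pi_pos.le]
  field_simp

namespace DirichletCharacter

lemma logDeriv_xiFunction {N : ℕ} [NeZero N] {χ : DirichletCharacter ℂ N} (hχ : χ ≠ 1) {s : ℂ}
    (hs : 1 < s.re) : logDeriv (xiFunction χ) s =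
      (Real.log N : ℂ) / 2 + logDeriv (gammaFactor χ) s + logDeriv (LFunction χ) s := by
  have hs0 : 0 < s.re := by linarith
  have hN : (N : ℂ) ≠ 0 := by exact_mod_cast NeZero.ne N
  have d1 : HasDerivAt (fun s : ℂ => (N : ℂ) ^ (s / 2))
      ((N : ℂ) ^ (s / 2) * Complex.log N * (1 / 2)) s :=
    ((hasDerivAt_id s).div_const 2).const_cpow (Or.inl hN)
  have hp : (N : ℂ) ^ (s / 2) ≠ 0 := fun h => hN ((Complex.cpow_eq_zero_iff _ _).1 h).1
  have dg : DifferentiableAt ℂ (gammaFactor χ) s := by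
    have hG : ∀ z : ℂ, 0 < z.re → DifferentiableAt ℂ Complex.Gammaℝ z := fun z hz => by
      have := (Complex.differentiable_Gammaℝ_inv z).inv
        (inv_ne_zero (Complex.Gammaℝ_ne_zero_of_re_pos hz))
      have e : (fun s => (Complex.Gammaℝ s)⁻¹)⁻¹ = Complex.Gammaℝ := funext fun s => inv_inv _
      rwa [e] at this
    rcases χ.even_or_odd with h | h
    · rw [funext h.gammaFactor_def]
      exact hG s hs0
    · rw [funext h.gammaFactor_def]
      exact (hG (s + 1) (by simp; linarith)).comp s (differentiableAt_id.add_const 1)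
  have dL := differentiableAt_LFunction χ s (Or.inr hχ)
  have hL : LFunction χ s ≠ 0 := LFunction_ne_zero_of_one_le_re χ (Or.inl hχ) hs.le
  have he : xiFunction χ =ᶠ[nhds s] fun s => (N : ℂ) ^ (s / 2) * (gammaFactor χ s * LFunction χ s) := by
    have hV : {s : ℂ | 0 < s.re} ∈ nhds s :=
      (isOpen_lt continuous_const Complex.continuous_re).mem_nhds hs0
    filter_upwards [hV] with z hz
    rw [xiFunction, completedLFunction_eq_mul _ hz]
  have hgL : (fun s => gammaFactor χ s * LFunction χ s) s ≠ 0 :=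
    _root_.mul_ne_zero (gammaFactor_ne_zero χ hs0) hL
  have dgL : DifferentiableAt ℂ (fun s => gammaFactor χ s * LFunction χ s) s := dg.mul dL
  rw [logDeriv_apply, he.deriv_eq, he.eq_of_nhds, ← logDeriv_apply,
    logDeriv_mul s hp hgL d1.differentiableAt dgL,
    logDeriv_mul s (gammaFactor_ne_zero χ hs0) hL dg dL, logDeriv_apply (fun s : ℂ => (N : ℂ) ^ (s / 2)),
    d1.deriv, Complex.natCast_log]
  field_simp
  ring

lemma logDeriv_gammaFactor_even {N : ℕ} {χ : DirichletCharacter ℂ N} (h : χ.Even) {s : ℂ}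
    (hs : 0 < s.re) : logDeriv (gammaFactor χ) s =
      -(Real.log π : ℂ) / 2 + Complex.digamma (s / 2) / 2 := by
  rw [funext h.gammaFactor_def, Complex.logDeriv_Gammaℝ hs]

lemma logDeriv_gammaFactor_odd {N : ℕ} {χ : DirichletCharacter ℂ N} (h : χ.Odd) {s : ℂ}
    (hs : 0 < s.re) : logDeriv (gammaFactor χ) s =
      -(Real.log π : ℂ) / 2 + Complex.digamma ((s + 1) / 2) / 2 := by
  rw [← Complex.logDeriv_Gammaℝ (s := s + 1) (by simp; linarith), funext h.gammaFactor_def,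
    logDeriv_apply, logDeriv_apply, deriv_comp_add_const]

end DirichletCharacter

/-- The entire function `s (s - 1) Λ(s)`, where `Λ` is the completed Riemann zeta function. -/
noncomputable def riemannXi (s : ℂ) : ℂ := s * (s - 1) * completedRiemannZeta₀ s + 1

lemma differentiable_riemannXi : Differentiable ℂ riemannXi :=
  ((differentiable_id.mul (differentiable_id.sub_const 1)).mul
    differentiable_completedZeta₀).add_const 1

lemma riemannXi_eq {s : ℂ} (hs : 0 < s.re) (hs' : s ≠ 1) :
    riemannXi s = s * ((s - 1) * (Complex.Gammaℝ s * riemannZeta s)) := by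
  have h0 : s ≠ 0 := by rintro rfl; simp at hs
  rw [riemannZeta_def_of_ne_zero h0, mul_div_cancel₀ _ (Complex.Gammaℝ_ne_zero_of_re_pos hs),
    completedRiemannZeta_eq, riemannXi]
  have h1 : 1 - s ≠ 0 := sub_ne_zero.2 hs'.symm
  field_simp
  ring

lemma riemannXi_conj (s : ℂ) : riemannXi ((starRingEnd ℂ) s) = (starRingEnd ℂ) (riemannXi s) := by
  have h1 : Differentiable ℂ (starRingEnd ℂ ∘ riemannXi ∘ starRingEnd ℂ) :=
    fun s => by
      have := (differentiable_riemannXi ((starRingEnd ℂ) s)).conj_conj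
      rwa [Complex.conj_conj] at this
  have h3 := AnalyticOnNhd.eq_of_eventuallyEq
    (fun s _ => differentiable_riemannXi.analyticAt s)
    (fun s _ => h1.analyticAt s) (z₀ := 2) (by
      have hV : {s : ℂ | 1 < s.re} ∈ nhds (2 : ℂ) :=
        (isOpen_lt continuous_const Complex.continuous_re).mem_nhds (by simp)
      filter_upwards [hV] with z hz
      have hz1 : 1 < z.re := hz
      have hz2 : 0 < ((starRingEnd ℂ) z).re := by simp; linarith
      have ne1 : z ≠ 1 := by rintro rfl; simp at hz1
      have ne2 : (starRingEnd ℂ) z ≠ 1 := by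
        intro h
        have := congrArg Complex.re h
        simp at this
        linarith
      simp only [Function.comp]
      rw [riemannXi_eq (by linarith) ne1, riemannXi_eq hz2 ne2, Complex.Gammaℝ_conj,
        riemannZeta_conj]
      simp)
  have := congrFun h3 ((starRingEnd ℂ) s)
  simpa using this

lemma norm_riemannXi_symm (s : ℂ) : ‖riemannXi (1 - (starRingEnd ℂ) s)‖ = ‖riemannXi s‖ := by
  have : riemannXi (1 - (starRingEnd ℂ) s) = riemannXi ((starRingEnd ℂ) s) := by
    rw [riemannXi, riemannXi, completedRiemannZeta₀_one_sub]
    ring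
  rw [this, riemannXi_conj, RCLike.norm_conj]

lemma riemannXi_ne_zero {s : ℂ} (hs : 1 < s.re) : riemannXi s ≠ 0 := by
  have ne0 : s ≠ 0 := by rintro rfl; simp at hs; linarith
  have ne1 : s ≠ 1 := by rintro rfl; simp at hs
  rw [riemannXi_eq (by linarith) ne1]
  exact mul_ne_zero ne0 (mul_ne_zero (sub_ne_zero.2 ne1)
    (mul_ne_zero (Complex.Gammaℝ_ne_zero_of_re_pos (by linarith))
      (riemannZeta_ne_zero_of_one_le_re hs.le)))

lemma exists_norm_riemannZeta_le : ∃ K, 0 < K ∧ ∀ s : ℂ, 2 ≤ s.re → ‖riemannZeta s‖ ≤ K := by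
  obtain ⟨K, hK, h⟩ := DirichletCharacter.exists_norm_LFunction_le (1 : DirichletCharacter ℂ 1)
  refine ⟨K, hK, fun s hs => ?_⟩
  have := h s hs
  rwa [DirichletCharacter.LFunction_modOne_eq] at this

lemma symEntire_riemannXi : SymEntire riemannXi := by
  obtain ⟨K, hK0, hK⟩ := exists_norm_riemannZeta_le
  obtain ⟨B, hB⟩ := exists_norm_completedHurwitzZetaEven₀_le 0 (-1) 2
  have key : ∀ s : ℂ, ‖s * (s - 1)‖ ≤ Real.exp (2 * ‖s‖) := fun s => by
    rw [norm_mul, two_mul, Real.exp_add]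
    have h1 : ‖s - 1‖ ≤ ‖s‖ + 1 := (norm_sub_le _ _).trans (by rw [norm_one])
    have h2 := Real.add_one_le_exp ‖s‖
    have h3 := norm_nonneg s
    gcongr
    · linarith
    · linarith
  refine SymEntire.of_bounds (C := 2 + 2 * 3 ^ (3 / 2 : ℝ) + K) (D := 2 + |B|)
    differentiable_riemannXi norm_riemannXi_symm (fun s => riemannXi_ne_zero) (by positivity)
    (fun s hs => ?_) (fun s h1 h2 hs => ?_)
  · have hre : s.re ≤ ‖s‖ := Complex.re_le_norm s
    have hs2 : 2 ≤ ‖s‖ := hs.trans hre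
    have h32 := DirichletCharacter.one_le_norm_rpow (show 1 ≤ ‖s‖ by linarith)
    have n1 : ‖s * (s - 1)‖ ≤ Real.exp (2 * ‖s‖ ^ (3 / 2 : ℝ)) :=
      (key s).trans (Real.exp_le_exp.2 (by linarith))
    have n2 : ‖Complex.Gammaℝ s‖ ≤ Real.exp (2 * 3 ^ (3 / 2 : ℝ) * ‖s‖ ^ (3 / 2 : ℝ)) := by
      refine (norm_Gammaℝ_le hs).trans (Real.exp_le_exp.2 ?_)
      rw [mul_assoc, ← Real.mul_rpow (by norm_num) (norm_nonneg _)]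
      gcongr
    have n3 : ‖riemannZeta s‖ ≤ Real.exp (K * ‖s‖ ^ (3 / 2 : ℝ)) := by
      refine (hK s hs).trans ?_
      have := Real.add_one_le_exp (K * ‖s‖ ^ (3 / 2 : ℝ))
      nlinarith
    rw [riemannXi_eq (by linarith) (by rintro rfl; norm_num at hs), ← mul_assoc, norm_mul,
      norm_mul (Complex.Gammaℝ s)]
    calc _ ≤ Real.exp (2 * ‖s‖ ^ (3 / 2 : ℝ)) *
          (Real.exp (2 * 3 ^ (3 / 2 : ℝ) * ‖s‖ ^ (3 / 2 : ℝ)) *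
            Real.exp (K * ‖s‖ ^ (3 / 2 : ℝ))) := by gcongr
      _ = _ := by
        rw [← Real.exp_add, ← Real.exp_add]
        ring_nf
  · have h32 := DirichletCharacter.one_le_norm_rpow hs
    have n2 : ‖completedRiemannZeta₀ s‖ ≤ |B| := (hB s h1 h2).trans (le_abs_self B)
    have hB0 := abs_nonneg B
    have n3 : 1 ≤ Real.exp (2 * ‖s‖ ^ (3 / 2 : ℝ)) := Real.one_le_exp (by positivity)
    have n4 := Real.add_one_le_exp |B|
    calc ‖riemannXi s‖ ≤ ‖s * (s - 1)‖ * ‖completedRiemannZeta₀ s‖ + 1 := by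
          rw [riemannXi, ← norm_mul]
          exact (norm_add_le _ _).trans (by rw [norm_one])
      _ ≤ Real.exp (2 * ‖s‖ ^ (3 / 2 : ℝ)) * |B| + 1 := by
          gcongr
          exact (key s).trans (Real.exp_le_exp.2 (by linarith))
      _ ≤ Real.exp (2 * ‖s‖ ^ (3 / 2 : ℝ)) * Real.exp |B| := by nlinarith
      _ ≤ _ := by
          rw [← Real.exp_add]
          refine Real.exp_le_exp.2 ?_
          nlinarith

lemma logDeriv_riemannXi {s : ℂ} (hs : 1 < s.re) : logDeriv riemannXi s =
    1 / s + 1 / (s - 1) + (-(Real.log π : ℂ) / 2 + Complex.digamma (s / 2) / 2) +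
      logDeriv riemannZeta s := by
  have hs0 : 0 < s.re := by linarith
  have ne0 : s ≠ 0 := by rintro rfl; simp at hs0
  have ne1 : s ≠ 1 := by rintro rfl; simp at hs
  have ne1' : s - 1 ≠ 0 := sub_ne_zero.2 ne1
  have dG : DifferentiableAt ℂ Complex.Gammaℝ s := by
    have := (Complex.differentiable_Gammaℝ_inv s).inv
      (inv_ne_zero (Complex.Gammaℝ_ne_zero_of_re_pos hs0))
    have e : (fun s => (Complex.Gammaℝ s)⁻¹)⁻¹ = Complex.Gammaℝ := funext fun s => inv_inv _
    rwa [e] at this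
  have hG := Complex.Gammaℝ_ne_zero_of_re_pos hs0
  have dz := differentiableAt_riemannZeta ne1
  have hz := riemannZeta_ne_zero_of_one_le_re hs.le
  have h1 : (fun s => Complex.Gammaℝ s * riemannZeta s) s ≠ 0 := mul_ne_zero hG hz
  have d1 : DifferentiableAt ℂ (fun s => Complex.Gammaℝ s * riemannZeta s) s := dG.mul dz
  have h2 : (fun s : ℂ => (s - 1) * (Complex.Gammaℝ s * riemannZeta s)) s ≠ 0 := mul_ne_zero ne1' h1
  have ds : DifferentiableAt ℂ (fun s : ℂ => s - 1) s := differentiableAt_id.sub_const 1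
  have d2 : DifferentiableAt ℂ (fun s : ℂ => (s - 1) * (Complex.Gammaℝ s * riemannZeta s)) s :=
    ds.mul d1
  have he : riemannXi =ᶠ[nhds s]
      fun s => s * ((s - 1) * (Complex.Gammaℝ s * riemannZeta s)) := by
    have hV : {s : ℂ | 1 < s.re} ∈ nhds s :=
      (isOpen_lt continuous_const Complex.continuous_re).mem_nhds hs
    filter_upwards [hV] with z hz
    have hz1 : 1 < z.re := hz
    exact riemannXi_eq (by linarith) (by rintro rfl; simp at hz1)
  rw [logDeriv_apply, he.deriv_eq, he.eq_of_nhds, ← logDeriv_apply,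
    logDeriv_mul s (f := fun s => s) ne0 h2 differentiableAt_id d2, logDeriv_mul s ne1' h1 ds d1,
    logDeriv_mul s hG hz dG dz, Complex.logDeriv_Gammaℝ hs0, logDeriv_sub_const]
  have : logDeriv (fun s : ℂ => s) s = 1 / s := logDeriv_id s
  rw [this]
  ring

/-- Stechkin's combination `κ Re (f'/f)(s + τ) - Re (f'/f)(s)` of logarithmic derivatives. -/
noncomputable def stechkinLog (f : ℂ → ℂ) (s : ℂ) : ℝ :=
  stechkinCoeff * (logDeriv f (s + stechkinShift)).re - (logDeriv f s).re

/-- The contribution of a zero `ρ` to `stechkinLog`. -/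
noncomputable def stechkinZero (s ρ : ℂ) : ℝ :=
  zeroPair s ρ - stechkinCoeff * zeroPair (s + stechkinShift) ρ

lemma add_shift_re (s : ℂ) : (s + (stechkinShift : ℂ)).re = s.re + stechkinShift := by simp

lemma add_shift_im (s : ℂ) : (s + (stechkinShift : ℂ)).im = s.im := by simp

lemma SymEntire.sum_stechkinZero_le {f : ℂ → ℂ} (hf : SymEntire f) {s : ℂ} (hs : 1 < s.re)
    (S : Finset ℂ) (hS : ∀ ρ ∈ S, f ρ = 0 ∧ 1 / 2 < ρ.re) :
    ∑ ρ ∈ S, stechkinZero s ρ ≤ -stechkinLog f s := by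
  have h1 : 1 < (s + (stechkinShift : ℂ)).re := by
    rw [add_shift_re, stechkinShift]
    linarith
  refine (SymEntire.sum_zeroPair_le S hf (hf.ne_zero s hs) (hf.ne_zero _ h1) (fun ρ hρ => ?_)
    hS).trans_eq ?_
  · obtain ⟨a, b⟩ := hf.zero_mem_strip hρ
    exact stechkin_zeroPair hs (add_shift_re s) (add_shift_im s) a b
  · rw [stechkinLog]
    ring

/-- The coefficient `(1 - κ) / 2` of the logarithm of the conductor in Stechkin's method. -/
noncomputable def stechkinMain : ℝ := (1 - stechkinCoeff) / 2

/-- The archimedean main term. -/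
noncomputable def stechkinArch (s : ℂ) : ℝ := Real.log ((s.re ^ 2 + 1 + s.im ^ 2) / 4) / 2

lemma stechkinLog_xiFunction {N : ℕ} [NeZero N] {χ : DirichletCharacter ℂ N} (hχ : χ ≠ 1) {s : ℂ}
    (hs : 1 < s.re) : -stechkinLog χ.xiFunction s ≤ stechkinMain * (Real.log N - Real.log π +
      stechkinArch s) + 0.045 - stechkinLog χ.LFunction s := by
  have h1 : 1 < (s + (stechkinShift : ℂ)).re := by
    rw [add_shift_re, stechkinShift]
    linarith
  rw [stechkinLog, stechkinLog, DirichletCharacter.logDeriv_xiFunction hχ hs,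
    DirichletCharacter.logDeriv_xiFunction hχ h1, stechkinMain, stechkinArch]
  rcases χ.even_or_odd with h | h
  · rw [DirichletCharacter.logDeriv_gammaFactor_even h (by linarith),
      DirichletCharacter.logDeriv_gammaFactor_even h (by linarith)]
    have := stechkin_digamma_even hs (add_shift_re s) (add_shift_im s)
    simp only [Complex.add_re, Complex.div_ofNat_re, Complex.neg_re, Complex.ofReal_re] at this ⊢
    linarith
  · rw [DirichletCharacter.logDeriv_gammaFactor_odd h (by linarith),
      DirichletCharacter.logDeriv_gammaFactor_odd h (by linarith)]
    have := stechkin_digamma_odd hs (add_shift_re s) (add_shift_im s)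
    simp only [Complex.add_re, Complex.div_ofNat_re, Complex.neg_re, Complex.ofReal_re] at this ⊢
    linarith

lemma re_one_div_add_one_div (s : ℂ) :
    zeroPair s 1 = (1 / s + 1 / (s - 1)).re := by
  rw [zeroPair, map_one, sub_self, sub_zero, add_comm]

lemma stechkinLog_riemannXi_eq {s : ℂ} (hs : 1 < s.re) :
    -stechkinLog riemannXi s = stechkinZero s 1 - stechkinMain * Real.log π +
      ((Complex.digamma (s / 2)).re / 2 -
        stechkinCoeff * ((Complex.digamma ((s + stechkinShift) / 2)).re / 2)) -
        stechkinLog riemannZeta s := by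
  have h1 : 1 < (s + (stechkinShift : ℂ)).re := by
    rw [add_shift_re, stechkinShift]
    linarith
  rw [stechkinLog, stechkinLog, logDeriv_riemannXi hs, logDeriv_riemannXi h1, stechkinMain,
    stechkinZero, re_one_div_add_one_div, re_one_div_add_one_div]
  simp only [Complex.add_re, Complex.div_ofNat_re, Complex.neg_re, Complex.ofReal_re]
  ring

lemma stechkinLog_riemannXi {s : ℂ} (hs : 1 < s.re) :
    -stechkinLog riemannXi s ≤ stechkinZero s 1 + stechkinMain * (stechkinArch s - Real.log π) +
      0.045 - stechkinLog riemannZeta s := by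
  have := stechkin_digamma_even hs (add_shift_re s) (add_shift_im s)
  rw [stechkinLog_riemannXi_eq hs]
  rw [stechkinMain, stechkinArch]
  linarith

/-- The Riemann zeta function, on the real axis. -/
lemma stechkinLog_riemannZeta_real_le {s : ℂ} (hs : 1 < s.re) (hs' : s.re ≤ 1.1473)
    (h0 : s.im = 0) :
    stechkinLog riemannZeta s ≤ 1 / (s.re - 1) + 0.036 - stechkinMain * Real.log π - 0.57 := by
  have h1 := symEntire_riemannXi.sum_stechkinZero_le hs ∅ (by simp)
  rw [Finset.sum_empty, stechkinLog_riemannXi_eq hs] at h1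
  have h2 := stechkin_digamma_real hs hs' h0 (add_shift_re s) (add_shift_im s)
  have h3 := stechkin_pole_le_real hs (add_shift_re s) (add_shift_im s) (by linarith) h0
  rw [stechkinZero] at h1
  linarith

open Classical in
/-- The contribution of the pole, present for the trivial character only. -/
noncomputable def poleTerm {N : ℕ} (χ : DirichletCharacter ℂ N) (s : ℂ) : ℝ :=
  if χ = 1 then (s.re - 1) / ((s.re - 1) ^ 2 + s.im ^ 2) + 0.15 else 0

lemma DirichletCharacter.IsPrimitive.stechkinLog_le {N : ℕ} [NeZero N]
    {χ : DirichletCharacter ℂ N} (hp : χ.IsPrimitive) {s : ℂ} (hs : 1 < s.re)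
    (hs' : s.re ≤ 1.15) (S : Finset ℂ)
    (hS : ∀ ρ ∈ S, χ.LFunction ρ = 0 ∧ 1 / 2 < ρ.re ∧ ρ ≠ 1) :
    stechkinLog χ.LFunction s ≤ stechkinMain * (Real.log N - Real.log π + stechkinArch s) + 0.045 +
      poleTerm χ s - ∑ ρ ∈ S, stechkinZero s ρ := by
  by_cases hχ : χ = 1
  · have hN : N = 1 := by
      rw [DirichletCharacter.isPrimitive_def, hχ, DirichletCharacter.conductor_one] at hp
      exact hp.symm
    subst hN
    rw [poleTerm, if_pos hχ]
    rw [DirichletCharacter.LFunction_modOne_eq] at hS ⊢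
    have h1 := symEntire_riemannXi.sum_stechkinZero_le hs S (fun ρ hρ => by
      obtain ⟨a, b, c⟩ := hS ρ hρ
      refine ⟨?_, b⟩
      rw [riemannXi_eq (by linarith) c, a]
      simp)
    have h2 := stechkinLog_riemannXi hs
    have h3 := stechkin_pole_le hs (add_shift_re s) (add_shift_im s) hs'
    rw [stechkinZero] at h2
    rw [Nat.cast_one, Real.log_one]
    linarith
  · rw [poleTerm, if_neg hχ]
    have h1 := (DirichletCharacter.symEntire_xiFunction hp hχ).sum_stechkinZero_le hs S
      (fun ρ hρ => by
        obtain ⟨a, b, c⟩ := hS ρ hρ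
        exact ⟨(DirichletCharacter.xiFunction_eq_zero_iff χ (by linarith)).2 a, b⟩)
    have h2 := stechkinLog_xiFunction hχ hs
    linarith

lemma re_div_one_sub_ge {z : ℂ} {r : ℝ} (hz : ‖z‖ ≤ r) (hr : r < 1) :
    -(z / (1 - z)).re ≤ r / (1 + r) := by
  have hr0 : 0 ≤ r := (norm_nonneg z).trans hz
  have hne : 1 - z ≠ 0 := by
    intro h
    rw [← sub_eq_zero.1 h, norm_one] at hz
    linarith
  have hre : |z.re| ≤ r := (Complex.abs_re_le_norm z).trans hz
  have hx := (abs_le.1 hre).1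
  have hsq : z.re ^ 2 + z.im ^ 2 ≤ r ^ 2 := by
    have := Complex.sq_norm z
    rw [Complex.normSq_apply] at this
    nlinarith [norm_nonneg z]
  have e : (z / (1 - z)).re = (z.re - (z.re ^ 2 + z.im ^ 2)) / ((1 - z.re) ^ 2 + z.im ^ 2) := by
    rw [Complex.div_re, Complex.normSq_apply]
    simp only [Complex.sub_re, Complex.sub_im, Complex.one_re, Complex.one_im]
    ring
  have hpos : 0 < (1 - z.re) ^ 2 + z.im ^ 2 := by
    have := Complex.normSq_pos.2 hne
    rw [Complex.normSq_apply] at this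
    simp only [Complex.sub_re, Complex.sub_im, Complex.one_re, Complex.one_im] at this
    linarith
  rw [e, ← neg_div, div_le_div_iff₀ hpos (by linarith)]
  nlinarith [mul_nonneg (sub_nonneg.2 hr.le) (show 0 ≤ r + z.re by linarith)]

lemma re_div_one_sub_le {z : ℂ} {r : ℝ} (hz : ‖z‖ ≤ r) (hr : r < 1) :
    (z / (1 - z)).re ≤ r / (1 - r) := by
  refine (Complex.re_le_norm _).trans ?_
  rw [norm_div]
  have h1 : 1 - r ≤ ‖1 - z‖ := by
    have := norm_sub_norm_le (1 : ℂ) z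
    rw [norm_one] at this
    linarith
  exact div_le_div₀ ((norm_nonneg z).trans hz) hz (by linarith) h1

lemma logDeriv_eulerFactor {p : ℕ} (hp : p ≠ 0) (a s : ℂ) :
    logDeriv (fun s : ℂ => 1 - a * (p : ℂ) ^ (-s)) s =
      (Real.log p : ℂ) * (a * (p : ℂ) ^ (-s) / (1 - a * (p : ℂ) ^ (-s))) := by
  have hp' : (p : ℂ) ≠ 0 := by exact_mod_cast hp
  have d : HasDerivAt (fun s : ℂ => 1 - a * (p : ℂ) ^ (-s))
      (-(a * ((p : ℂ) ^ (-s) * Complex.log p * -1))) s := by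
    have := (((hasDerivAt_id s).neg.const_cpow (c := (p : ℂ)) (Or.inl hp')).const_mul a).const_sub 1
    simpa using this
  rw [logDeriv_apply, d.deriv, Complex.natCast_log]
  ring

lemma norm_eulerFactor_le {p : ℕ} (hp : 2 ≤ p) {a s : ℂ} (ha : ‖a‖ ≤ 1) (hs : 1 ≤ s.re) :
    ‖a * (p : ℂ) ^ (-s)‖ ≤ 1 / p := by
  have hp0 : (1 : ℝ) < p := by exact_mod_cast hp
  rw [norm_mul, Complex.norm_natCast_cpow_of_pos (by lia), Complex.neg_re]
  have h1 : (p : ℝ) ^ (-s.re) ≤ 1 / p := by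
    rw [one_div, ← Real.rpow_neg_one]
    exact Real.rpow_le_rpow_of_exponent_le hp0.le (by linarith)
  have h2 : 0 ≤ (p : ℝ) ^ (-s.re) := by positivity
  nlinarith [norm_nonneg a]

lemma norm_eulerFactor_shift_le {p : ℕ} (hp : 2 ≤ p) {a s : ℂ} (ha : ‖a‖ ≤ 1) (hs : 1 ≤ s.re)
    {c : ℝ} (hc : 0 < c) (hcp : c ^ 2 ≤ p) :
    ‖a * (p : ℂ) ^ (-(s + stechkinShift))‖ ≤ 1 / (p * c) := by
  have hp0 : (1 : ℝ) < p := by exact_mod_cast hp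
  rw [norm_mul, Complex.norm_natCast_cpow_of_pos (by lia), Complex.neg_re, add_shift_re]
  have h1 : (p : ℝ) ^ (-(s.re + stechkinShift)) ≤ 1 / (p * c) := by
    calc (p : ℝ) ^ (-(s.re + stechkinShift)) ≤ (p : ℝ) ^ (-1 + -(1 / 2) : ℝ) :=
          Real.rpow_le_rpow_of_exponent_le hp0.le (by rw [stechkinShift]; linarith)
      _ = 1 / (p * √p) := by
          rw [Real.rpow_add (by linarith), Real.rpow_neg_one, Real.rpow_neg (by linarith),
            ← Real.sqrt_eq_rpow]
          field_simp
      _ ≤ 1 / (p * c) := by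
          gcongr
          exact Real.le_sqrt_of_sq_le hcp
  have h2 : 0 ≤ (p : ℝ) ^ (-(s.re + stechkinShift)) := by positivity
  nlinarith [norm_nonneg a]

lemma stechkinLog_eulerFactor_le {p : ℕ} (hp : 2 ≤ p) {a s : ℂ} (ha : ‖a‖ ≤ 1) (hs : 1 ≤ s.re)
    {c : ℝ} (hc : 1 ≤ c) (hcp : c ^ 2 ≤ p) :
    stechkinLog (fun s : ℂ => 1 - a * (p : ℂ) ^ (-s)) s ≤
      Real.log p * (stechkinCoeff * (1 / (p * c - 1)) + 1 / (p + 1)) := by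
  have hp0 : (2 : ℝ) ≤ p := by exact_mod_cast hp
  have hpc : 1 < p * c := by nlinarith
  have h1 := re_div_one_sub_ge (norm_eulerFactor_le hp ha hs)
    (by rw [div_lt_one (by linarith)]; linarith)
  have h2 := re_div_one_sub_le (norm_eulerFactor_shift_le hp ha hs (by linarith) hcp)
    (by rw [div_lt_one (by linarith)]; linarith)
  have e1 : 1 / (p : ℝ) / (1 + 1 / p) = 1 / (p + 1) := by field_simp
  have e2 : 1 / (p * c) / (1 - 1 / (p * c)) = 1 / (p * c - 1) := by
    have : p * c - 1 ≠ 0 := by linarith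
    have : (p : ℝ) * c ≠ 0 := by linarith
    field_simp
  rw [e1] at h1
  rw [e2] at h2
  rw [stechkinLog, logDeriv_eulerFactor (by lia), logDeriv_eulerFactor (by lia),
    Complex.re_ofReal_mul, Complex.re_ofReal_mul]
  have hlog : 0 ≤ Real.log p := Real.log_nonneg (by linarith)
  have hk : (0 : ℝ) ≤ stechkinCoeff := by norm_num [stechkinCoeff]
  nlinarith [mul_le_mul_of_nonneg_left h1 hlog,
    mul_le_mul_of_nonneg_left h2 (mul_nonneg hk hlog)]

lemma log_three_le : Real.log 3 ≤ 1.6 * Real.log 2 := by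
  have h : Real.log ((3 : ℝ) ^ 5) ≤ Real.log (2 ^ 8) := Real.log_le_log (by norm_num) (by norm_num)
  rw [Real.log_pow, Real.log_pow] at h
  push_cast at h
  linarith

lemma stechkinLog_eulerFactor_le_main {p : ℕ} (hp : p.Prime) {a s : ℂ} (ha : ‖a‖ ≤ 1)
    (hs : 1 ≤ s.re) :
    stechkinLog (fun s : ℂ => 1 - a * (p : ℂ) ^ (-s)) s ≤ stechkinMain * Real.log p +
      ((if p = 2 then 0.2095 else 0) + (if p = 3 then 0.09 else 0)) := by
  have hl2 := Real.log_two_lt_d9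
  rcases eq_or_ne p 2 with rfl | h2
  · refine (stechkinLog_eulerFactor_le le_rfl ha hs (c := 1.414) (by norm_num)
      (by norm_num)).trans ?_
    norm_num [stechkinCoeff, stechkinMain]
    linarith
  rcases eq_or_ne p 3 with rfl | h3
  · refine (stechkinLog_eulerFactor_le (by norm_num) ha hs (c := 1.732) (by norm_num)
      (by norm_num)).trans ?_
    have := log_three_le
    norm_num [stechkinCoeff, stechkinMain] at this ⊢
    linarith
  have h5 : 5 ≤ p := by
    by_contra h
    have := hp.two_le
    interval_cases p <;> first | lia | exact absurd hp (by decide)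
  have h5' : (5 : ℝ) ≤ p := by exact_mod_cast h5
  refine (stechkinLog_eulerFactor_le hp.two_le ha hs (c := 2) (by norm_num)
      (by linarith)).trans ?_
  rw [if_neg h2, if_neg h3, add_zero, add_zero, mul_comm]
  refine mul_le_mul_of_nonneg_right ?_ (Real.log_nonneg (by linarith))
  have b1 : 1 / ((p : ℝ) * 2 - 1) ≤ 1 / 9 := by gcongr; linarith
  have b2 : 1 / ((p : ℝ) + 1) ≤ 1 / 6 := by gcongr; linarith
  norm_num [stechkinCoeff, stechkinMain] at b1 b2 ⊢
  linarith

lemma eulerFactor_ne_zero {p : ℕ} (hp : 2 ≤ p) {a s : ℂ} (ha : ‖a‖ ≤ 1) (hs : 0 < s.re) :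
    1 - a * (p : ℂ) ^ (-s) ≠ 0 := by
  have hp0 : (1 : ℝ) < p := by exact_mod_cast hp
  intro h
  have := congrArg norm (sub_eq_zero.1 h)
  rw [norm_one, norm_mul, Complex.norm_natCast_cpow_of_pos (by lia), Complex.neg_re] at this
  have h1 : (p : ℝ) ^ (-s.re) < 1 := Real.rpow_lt_one_of_one_lt_of_neg hp0 (by linarith)
  have h2 : 0 < (p : ℝ) ^ (-s.re) := by positivity
  nlinarith [norm_nonneg a]

lemma differentiable_eulerFactor {p : ℕ} (hp : p ≠ 0) (a : ℂ) :
    Differentiable ℂ fun s : ℂ => 1 - a * (p : ℂ) ^ (-s) := fun s =>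
  (((differentiableAt_id (x := s)).neg.const_cpow (c := (p : ℂ))
    (Or.inl (by exact_mod_cast hp))).const_mul a).const_sub 1

namespace DirichletCharacter

lemma logDeriv_LFunction_changeLevel {M N : ℕ} [NeZero M] [NeZero N] (hMN : M ∣ N)
    (χ : DirichletCharacter ℂ M) {s : ℂ} (hs : 1 < s.re) :
    logDeriv (LFunction (changeLevel hMN χ)) s = logDeriv (LFunction χ) s +
      ∑ p ∈ N.primeFactors, logDeriv (fun s : ℂ => 1 - χ p * (p : ℂ) ^ (-s)) s := by
  have h1 : ∀ p ∈ N.primeFactors, (fun s : ℂ => 1 - χ p * (p : ℂ) ^ (-s)) s ≠ 0 := fun p hp =>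
    eulerFactor_ne_zero (Nat.prime_of_mem_primeFactors hp).two_le (χ.norm_le_one _) (by linarith)
  have h2 : ∀ p ∈ N.primeFactors, DifferentiableAt ℂ (fun s : ℂ => 1 - χ p * (p : ℂ) ^ (-s)) s :=
    fun p hp => differentiable_eulerFactor (Nat.prime_of_mem_primeFactors hp).ne_zero _ s
  have ne1 : s ≠ 1 := by rintro rfl; simp at hs
  have he : LFunction (changeLevel hMN χ) =ᶠ[nhds s]
      fun s => LFunction χ s * ∏ p ∈ N.primeFactors, (1 - χ p * (p : ℂ) ^ (-s)) := by
    filter_upwards [isOpen_ne.mem_nhds ne1] with z hz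
    exact LFunction_changeLevel hMN χ (Or.inr hz)
  have h3 : (fun s : ℂ => ∏ p ∈ N.primeFactors, (1 - χ p * (p : ℂ) ^ (-s))) s ≠ 0 :=
    Finset.prod_ne_zero_iff.2 h1
  have h4 : DifferentiableAt ℂ (fun s : ℂ => ∏ p ∈ N.primeFactors, (1 - χ p * (p : ℂ) ^ (-s))) s :=
    DifferentiableAt.fun_finsetProd h2
  rw [logDeriv_apply, he.deriv_eq, he.eq_of_nhds, ← logDeriv_apply,
    logDeriv_mul s (LFunction_ne_zero_of_one_le_re χ (Or.inr ne1) hs.le) h3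
      (differentiableAt_LFunction χ s (Or.inl ne1)) h4, logDeriv_prod h1 h2]

lemma stechkinLog_changeLevel_le {M N : ℕ} [NeZero M] [NeZero N] (hMN : M ∣ N)
    (χ : DirichletCharacter ℂ M) {s : ℂ} (hs : 1 < s.re) :
    stechkinLog (LFunction (changeLevel hMN χ)) s ≤ stechkinLog (LFunction χ) s +
      stechkinMain * (Real.log N - Real.log M) + 0.3 := by
  have h1 : 1 < (s + (stechkinShift : ℂ)).re := by
    rw [add_shift_re, stechkinShift]
    linarith
  have e : stechkinLog (LFunction (changeLevel hMN χ)) s = stechkinLog (LFunction χ) s +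
      ∑ p ∈ N.primeFactors, stechkinLog (fun s : ℂ => 1 - χ p * (p : ℂ) ^ (-s)) s := by
    simp only [stechkinLog]
    rw [logDeriv_LFunction_changeLevel hMN χ hs, logDeriv_LFunction_changeLevel hMN χ h1,
      Complex.add_re, Complex.add_re, Complex.re_sum, Complex.re_sum, Finset.sum_sub_distrib,
      ← Finset.mul_sum]
    ring
  set P := N.primeFactors.filter fun p => ¬ p ∣ M with hP
  have e2 : ∑ p ∈ N.primeFactors, stechkinLog (fun s : ℂ => 1 - χ p * (p : ℂ) ^ (-s)) s =
      ∑ p ∈ P, stechkinLog (fun s : ℂ => 1 - χ p * (p : ℂ) ^ (-s)) s := by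
    rw [hP, Finset.sum_filter]
    refine Finset.sum_congr rfl fun p hp => ?_
    split_ifs with h
    · have hp' := Nat.prime_of_mem_primeFactors hp
      have : χ p = 0 := by
        refine χ.map_nonunit fun hu => ?_
        rw [ZMod.isUnit_iff_coprime] at hu
        exact (hp'.coprime_iff_not_dvd.1 hu) h
      rw [this]
      simp [stechkinLog, logDeriv_apply]
    · rfl
  have hPp : ∀ p ∈ P, p.Prime := fun p hp =>
    Nat.prime_of_mem_primeFactors (Finset.mem_filter.1 hp).1
  have b1 : ∑ p ∈ P, stechkinLog (fun s : ℂ => 1 - χ p * (p : ℂ) ^ (-s)) s ≤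
      ∑ p ∈ P, (stechkinMain * Real.log p +
        ((if p = 2 then 0.2095 else 0) + (if p = 3 then 0.09 else 0))) :=
    Finset.sum_le_sum fun p hp =>
      stechkinLog_eulerFactor_le_main (hPp p hp) (χ.norm_le_one _) hs.le
  rw [Finset.sum_add_distrib, Finset.sum_add_distrib, Finset.sum_ite_eq', Finset.sum_ite_eq',
    ← Finset.mul_sum] at b1
  have b2 : ∑ p ∈ P, Real.log p ≤ Real.log N - Real.log M := by
    obtain ⟨k, rfl⟩ := hMN
    have hk : k ≠ 0 := right_ne_zero_of_mul (NeZero.ne (M * k))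
    have hdvd : ∏ p ∈ P, p ∣ k := by
      refine Finset.prod_primes_dvd k (fun p hp => (hPp p hp).prime) fun p hp => ?_
      have h := Finset.mem_filter.1 hp
      exact ((hPp p hp).dvd_mul.1 (Nat.dvd_of_mem_primeFactors h.1)).resolve_left h.2
    have hle := Nat.le_of_dvd (Nat.pos_of_ne_zero hk) hdvd
    rw [Nat.cast_mul, Real.log_mul (by exact_mod_cast NeZero.ne M) (by exact_mod_cast hk),
      add_sub_cancel_left, ← Real.log_prod (fun p hp => by exact_mod_cast (hPp p hp).ne_zero)]
    refine Real.log_le_log (Finset.prod_pos fun p hp => by exact_mod_cast (hPp p hp).pos) ?_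
    rw [← Nat.cast_prod]
    exact Nat.cast_le.2 hle
  have b3 : (if 2 ∈ P then (0.2095 : ℝ) else 0) ≤ 0.2095 := by split_ifs <;> norm_num
  have b4 : (if 3 ∈ P then (0.09 : ℝ) else 0) ≤ 0.09 := by split_ifs <;> norm_num
  have hm : (0 : ℝ) ≤ stechkinMain := by norm_num [stechkinMain, stechkinCoeff]
  have b5 := mul_le_mul_of_nonneg_left b2 hm
  rw [e, e2]
  linarith

end DirichletCharacter

namespace DirichletCharacter

lemma LFunction_changeLevel_eq_zero_iff {M N : ℕ} [NeZero M] [NeZero N] (hMN : M ∣ N)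
    (χ : DirichletCharacter ℂ M) {s : ℂ} (hs : 0 < s.re) (hs' : s ≠ 1) :
    LFunction (changeLevel hMN χ) s = 0 ↔ LFunction χ s = 0 := by
  rw [LFunction_changeLevel hMN χ (Or.inr hs'), mul_eq_zero, or_iff_left]
  exact Finset.prod_ne_zero_iff.2 fun p hp =>
    eulerFactor_ne_zero (Nat.prime_of_mem_primeFactors hp).two_le (χ.norm_le_one _) hs

/-- Upper bound for Stechkin's combination of logarithmic derivatives of a Dirichlet
`L`-function. -/
lemma stechkinLog_LFunction_le {N : ℕ} [NeZero N] (χ : DirichletCharacter ℂ N) {s : ℂ}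
    (hs : 1 < s.re) (hs' : s.re ≤ 1.15) (S : Finset ℂ)
    (hS : ∀ ρ ∈ S, χ.LFunction ρ = 0 ∧ 1 / 2 < ρ.re ∧ ρ ≠ 1) :
    stechkinLog χ.LFunction s ≤ stechkinMain * (Real.log N - Real.log π + stechkinArch s) + 0.345 +
      poleTerm χ s - ∑ ρ ∈ S, stechkinZero s ρ := by
  have : NeZero χ.conductor := ⟨χ.conductor_ne_zero⟩
  have h1 := stechkinLog_changeLevel_le χ.conductor_dvd_level χ.primitiveCharacter hs
  rw [changeLevel_primitiveCharacter] at h1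
  have h2 := χ.primitiveCharacter_isPrimitive.stechkinLog_le hs hs' S (fun ρ hρ => by
    obtain ⟨a, b, c⟩ := hS ρ hρ
    refine ⟨?_, b, c⟩
    rwa [← LFunction_changeLevel_eq_zero_iff χ.conductor_dvd_level _ (by linarith) c,
      changeLevel_primitiveCharacter])
  have h3 : poleTerm χ.primitiveCharacter s = poleTerm χ s := by
    have : χ.primitiveCharacter = 1 ↔ χ = 1 := by
      conv_rhs => rw [← χ.changeLevel_primitiveCharacter]
      exact (changeLevel_eq_one_iff _).symm
    rw [poleTerm, poleTerm]
    congr 1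
    exact propext this
  rw [h3] at h2
  linarith

end DirichletCharacter

lemma log_arch_le {Q M x t u k c : ℝ} (hQ : 0 < Q) (hQM : Q ≤ M) (hQt : Q * t ≤ M) (ht : 0 ≤ t)
    (hu : |u| = k * t) (hx : 0 < x) {m : ℕ} (hc : c = m * (Real.log 2 / 8))
    (hnum : ((x ^ 2 + 1 + k ^ 2) / 39.47) ^ 4 * 2 ^ m ≤ 1) :
    Real.log Q - Real.log π + Real.log ((x ^ 2 + 1 + u ^ 2) / 4) / 2 ≤ Real.log M - c := by
  have hM : 0 < M := by linarith
  have hπ : (39.47 : ℝ) ≤ 4 * π ^ 2 := by nlinarith [Real.pi_gt_d4]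
  have hπ0 := Real.pi_pos
  have hu2 : u ^ 2 = k ^ 2 * t ^ 2 := by rw [← sq_abs, hu]; ring
  have hA : (Q / π) ^ 2 * ((x ^ 2 + 1 + u ^ 2) / 4) ≤ M ^ 2 * ((x ^ 2 + 1 + k ^ 2) / 39.47) := by
    have h1 : (Q * t) ^ 2 ≤ M ^ 2 := pow_le_pow_left₀ (by positivity) hQt 2
    have h2 : Q ^ 2 ≤ M ^ 2 := pow_le_pow_left₀ hQ.le hQM 2
    have h3 : Q ^ 2 * (x ^ 2 + 1 + u ^ 2) ≤ M ^ 2 * (x ^ 2 + 1 + k ^ 2) := by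
      rw [hu2]
      have := mul_le_mul_of_nonneg_left h1 (sq_nonneg k)
      have := mul_le_mul_of_nonneg_right h2 (show 0 ≤ x ^ 2 + 1 by positivity)
      linarith
    calc (Q / π) ^ 2 * ((x ^ 2 + 1 + u ^ 2) / 4) = Q ^ 2 * (x ^ 2 + 1 + u ^ 2) / (4 * π ^ 2) := by
          field_simp
      _ ≤ M ^ 2 * (x ^ 2 + 1 + k ^ 2) / 39.47 := by gcongr
      _ = _ := by ring
  have hB := Real.log_le_log (by positivity) hA
  rw [Real.log_mul (by positivity) (by positivity), Real.log_mul (by positivity) (by positivity),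
    Real.log_pow, Real.log_pow, Real.log_div hQ.ne' hπ0.ne'] at hB
  have hC := Real.log_nonpos (by positivity) hnum
  rw [Real.log_mul (by positivity) (by positivity), Real.log_pow, Real.log_pow] at hC
  push_cast at hB hC
  linarith

namespace DirichletCharacter

lemma stechkinLog_LFunction_le_aux {N : ℕ} [NeZero N] (χ : DirichletCharacter ℂ N) {s : ℂ}
    {M t k d : ℝ} {m : ℕ} (hs : 1 < s.re) (hs' : s.re ≤ 1.1473) (hQM : N ≤ M) (hQt : N * t ≤ M)
    (ht : 0 ≤ t) (hu : |s.im| = k * t) (S : Finset ℂ)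
    (hS : ∀ ρ ∈ S, χ.LFunction ρ = 0 ∧ 1 / 2 < ρ.re ∧ ρ ≠ 1)
    (hnum : ((1.1473 ^ 2 + 1 + k ^ 2) / 39.47) ^ 4 * 2 ^ m ≤ 1)
    (hd : 0.345 - stechkinMain * (m * (0.693147 / 8)) ≤ d) :
    stechkinLog χ.LFunction s ≤ stechkinMain * Real.log M + d +
      poleTerm χ s - ∑ ρ ∈ S, stechkinZero s ρ := by
  have h1 := stechkinLog_LFunction_le χ hs (by linarith) S hS
  have h2 := log_arch_le (x := s.re) (by exact_mod_cast NeZero.pos N) hQM hQt ht hu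
    (by linarith) (m := m) rfl ((mul_le_mul_of_nonneg_right (by gcongr) (by positivity)).trans hnum)
  have hm : (0 : ℝ) ≤ stechkinMain := by norm_num [stechkinMain, stechkinCoeff]
  have h3 := mul_le_mul_of_nonneg_left h2 hm
  have h4 : stechkinMain * (m * (0.693147 / 8)) ≤ stechkinMain * (m * (Real.log 2 / 8)) := by
    have := Real.log_two_gt_d9
    gcongr
    linarith
  rw [stechkinArch] at h1
  linarith

end DirichletCharacter

/-- The nonnegative weights `Λ(n) (n ^ (-σ) - κ n ^ (-σ - τ))`. -/
noncomputable def stechkinWeight (σ : ℝ) (n : ℕ) : ℝ :=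
  ArithmeticFunction.vonMangoldt n *
    ((n : ℝ) ^ (-σ) - stechkinCoeff * (n : ℝ) ^ (-(σ + stechkinShift)))

lemma stechkinWeight_nonneg (σ : ℝ) (n : ℕ) : 0 ≤ stechkinWeight σ n := by
  rcases Nat.eq_zero_or_pos n with rfl | hn
  · simp [stechkinWeight]
  · refine mul_nonneg ArithmeticFunction.vonMangoldt_nonneg ?_
    have h1 : (n : ℝ) ^ (-(σ + stechkinShift)) ≤ (n : ℝ) ^ (-σ) :=
      Real.rpow_le_rpow_of_exponent_le (by exact_mod_cast hn) (by rw [stechkinShift]; linarith)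
    have h2 : 0 ≤ (n : ℝ) ^ (-σ) := by positivity
    rw [stechkinCoeff]
    linarith

namespace DirichletCharacter

lemma re_term_twist_vonMangoldt {N : ℕ} (χ : DirichletCharacter ℂ N) (s : ℂ) (n : ℕ) :
    (LSeries.term ((fun n : ℕ => χ n) * fun n : ℕ => (ArithmeticFunction.vonMangoldt n : ℂ)) s n).re =
      ArithmeticFunction.vonMangoldt n * (n : ℝ) ^ (-s.re) *
        (χ n * (n : ℂ) ^ (-(s.im * Complex.I))).re := by
  rcases Nat.eq_zero_or_pos n with rfl | hn
  · simp
  have hn' : (n : ℂ) ≠ 0 := by exact_mod_cast hn.ne'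
  have e : (n : ℂ) ^ (-s) = ((n : ℝ) ^ (-s.re) : ℝ) * (n : ℂ) ^ (-(s.im * Complex.I)) := by
    rw [Complex.ofReal_cpow (Nat.cast_nonneg n), Complex.ofReal_natCast, ← Complex.cpow_add _ _ hn']
    congr 1
    conv_lhs => rw [← Complex.re_add_im s]
    push_cast
    ring
  rw [LSeries.term_of_ne_zero hn.ne', div_eq_mul_inv, ← Complex.cpow_neg, e, Pi.mul_apply]
  have : χ n * (ArithmeticFunction.vonMangoldt n : ℂ) *
      (((n : ℝ) ^ (-s.re) : ℝ) * (n : ℂ) ^ (-(s.im * Complex.I))) =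
      ((ArithmeticFunction.vonMangoldt n * (n : ℝ) ^ (-s.re) : ℝ) : ℂ) *
        (χ n * (n : ℂ) ^ (-(s.im * Complex.I))) := by
    push_cast
    ring
  rw [this, Complex.re_ofReal_mul]

lemma hasSum_re_neg_logDeriv {N : ℕ} [NeZero N] (χ : DirichletCharacter ℂ N) {s : ℂ}
    (hs : 1 < s.re) :
    HasSum (fun n : ℕ => ArithmeticFunction.vonMangoldt n * (n : ℝ) ^ (-s.re) *
        (χ n * (n : ℂ) ^ (-(s.im * Complex.I))).re) (-(logDeriv χ.LFunction s).re) := by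
  have h := Complex.hasSum_re (LSeriesSummable_twist_vonMangoldt χ hs).hasSum
  have e : (∑' n, LSeries.term ((fun n : ℕ => χ n) * fun n : ℕ =>
      (ArithmeticFunction.vonMangoldt n : ℂ)) s n) = -logDeriv χ.LFunction s := by
    have := LSeries_twist_vonMangoldt_eq χ hs
    rw [LSeries] at this
    rw [this, logDeriv_apply, deriv_LFunction_eq_deriv_LSeries χ hs, LFunction_eq_LSeries χ hs,
      neg_div]
  rw [e, Complex.neg_re] at h
  exact h.congr_fun fun n => (re_term_twist_vonMangoldt χ s n).symm

lemma hasSum_stechkinLog {N : ℕ} [NeZero N] (χ : DirichletCharacter ℂ N) {s : ℂ}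
    (hs : 1 < s.re) :
    HasSum (fun n : ℕ => stechkinWeight s.re n * (χ n * (n : ℂ) ^ (-(s.im * Complex.I))).re)
      (stechkinLog χ.LFunction s) := by
  have h1 : 1 < (s + (stechkinShift : ℂ)).re := by
    rw [add_shift_re, stechkinShift]
    linarith
  have h := (hasSum_re_neg_logDeriv χ hs).sub ((hasSum_re_neg_logDeriv χ h1).mul_left stechkinCoeff)
  rw [add_shift_re, add_shift_im] at h
  have e : stechkinLog χ.LFunction s = -(logDeriv χ.LFunction s).re -
      stechkinCoeff * -(logDeriv χ.LFunction (s + stechkinShift)).re := by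
    rw [stechkinLog]
    ring
  rw [e]
  refine h.congr_fun fun n => ?_
  rw [stechkinWeight]
  ring

/-- A nonnegative trigonometric form gives a nonnegative combination of the `stechkinLog`. -/
lemma sum_stechkinLog_nonneg {N : ℕ} [NeZero N] {ι : Type*} (I : Finset ι) (c u : ι → ℝ)
    (χ : ι → DirichletCharacter ℂ N) {σ : ℝ} (hσ : 1 < σ)
    (h : ∀ n : ℕ, n ≠ 0 →
      0 ≤ ∑ i ∈ I, c i * (χ i n * (n : ℂ) ^ (-(u i * Complex.I))).re) :
    0 ≤ ∑ i ∈ I, c i * stechkinLog (χ i).LFunction (σ + u i * Complex.I) := by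
  have hsum : HasSum (fun n : ℕ => ∑ i ∈ I, c i * (stechkinWeight σ n *
      (χ i n * (n : ℂ) ^ (-(u i * Complex.I))).re))
      (∑ i ∈ I, c i * stechkinLog (χ i).LFunction (σ + u i * Complex.I)) := by
    refine hasSum_sum fun i _ => HasSum.mul_left _ ?_
    have := hasSum_stechkinLog (χ i) (s := σ + u i * Complex.I) (by simpa using hσ)
    simpa using this
  refine hsum.nonneg fun n => ?_
  rcases eq_or_ne n 0 with rfl | hn
  · simp [stechkinWeight]
  · have e : ∑ i ∈ I, c i * (stechkinWeight σ n * (χ i n * (n : ℂ) ^ (-(u i * Complex.I))).re) =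
        stechkinWeight σ n * ∑ i ∈ I, c i * (χ i n * (n : ℂ) ^ (-(u i * Complex.I))).re := by
      rw [Finset.mul_sum]
      exact Finset.sum_congr rfl fun i _ => by ring
    rw [e]
    exact mul_nonneg (stechkinWeight_nonneg σ n) (h n hn)

/-- Enlarging the modulus of the trivial character decreases `stechkinLog` on the real axis. -/
lemma stechkinLog_one_le {N : ℕ} [NeZero N] {σ : ℝ} (hσ : 1 < σ) :
    stechkinLog (1 : DirichletCharacter ℂ N).LFunction σ ≤ stechkinLog riemannZeta σ := by
  have h1 := hasSum_stechkinLog (1 : DirichletCharacter ℂ N) (s := σ) (by simpa using hσ)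
  have h2 := hasSum_stechkinLog (1 : DirichletCharacter ℂ 1) (s := σ) (by simpa using hσ)
  rw [LFunction_modOne_eq] at h2
  refine hasSum_le (fun n => ?_) h1 h2
  rcases eq_or_ne n 0 with rfl | hn
  · simp [stechkinWeight]
  refine mul_le_mul_of_nonneg_left ?_ (stechkinWeight_nonneg _ n)
  have e : (1 : DirichletCharacter ℂ 1) n = 1 := by
    rw [Subsingleton.elim (n : ZMod 1) 1, MulChar.map_one]
  rw [e]
  simp only [Complex.ofReal_im, Complex.ofReal_zero, zero_mul, neg_zero, Complex.cpow_zero, mul_one,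
    Complex.one_re]
  by_cases hu : IsUnit (n : ZMod N)
  · rw [MulChar.one_apply hu]
    simp
  · rw [MulChar.map_nonunit _ hu]
    simp

end DirichletCharacter

lemma trig_polynomial_nonneg {z : ℂ} (hz : ‖z‖ = 1) :
    0 ≤ 11.1859357 + 19.0733441 * z.re + 11.67618784 * (z ^ 2).re + 4.7568 * (z ^ 3).re +
      (z ^ 4).re := by
  have h1 : z.re ^ 2 + z.im ^ 2 = 1 := by
    have := Complex.sq_norm z
    rw [Complex.normSq_apply, hz] at this
    linarith
  have hx : -1 ≤ z.re := (abs_le.1 ((Complex.abs_re_le_norm z).trans hz.le)).1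
  have e2 : (z ^ 2).re = 2 * z.re ^ 2 - 1 := by
    rw [pow_two, Complex.mul_re]
    linarith
  have i2 : (z ^ 2).im = 2 * z.re * z.im := by
    rw [pow_two, Complex.mul_im]
    ring
  have e3 : (z ^ 3).re = 4 * z.re ^ 3 - 3 * z.re := by
    rw [pow_succ, Complex.mul_re, e2, i2]
    linear_combination (-2 * z.re) * h1
  have e4 : (z ^ 4).re = 8 * z.re ^ 4 - 8 * z.re ^ 2 + 1 := by
    rw [show z ^ 4 = z ^ 2 * z ^ 2 by ring, Complex.mul_re, e2, i2]
    linear_combination (-4 * z.re ^ 2) * h1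
  rw [e2, e3, e4]
  nlinarith [sq_nonneg ((0.9126 + z.re) * (0.2766 + z.re))]

namespace DirichletCharacter

lemma norm_eq_one_or_eq_zero {N : ℕ} [NeZero N] (χ : DirichletCharacter ℂ N) (n : ℕ) (u : ℝ) (hn : n ≠ 0) :
    ‖χ n * (n : ℂ) ^ (-(u * Complex.I))‖ = 1 ∨ ¬ IsUnit (n : ZMod N) := by
  by_cases h : IsUnit (n : ZMod N)
  · left
    have h1 : ‖χ n‖ = 1 := by simpa using χ.unit_norm_eq_one h.unit
    rw [norm_mul, h1, Complex.norm_natCast_cpow_of_pos (Nat.pos_of_ne_zero hn)]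
    simp
  · exact Or.inr h

lemma trig_combination_nonneg {N : ℕ} [NeZero N] (χ : DirichletCharacter ℂ N) {σ : ℝ} (hσ : 1 < σ)
    (γ : ℝ) :
    0 ≤ 11.1859357 * stechkinLog (1 : DirichletCharacter ℂ N).LFunction σ +
      19.0733441 * stechkinLog χ.LFunction ⟨σ, 1 * γ⟩ +
      11.67618784 * stechkinLog (χ ^ 2).LFunction ⟨σ, 2 * γ⟩ +
      4.7568 * stechkinLog (χ ^ 3).LFunction ⟨σ, 3 * γ⟩ +
      stechkinLog (χ ^ 4).LFunction ⟨σ, 4 * γ⟩ := by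
  have h := sum_stechkinLog_nonneg (Finset.univ : Finset (Fin 5))
    ![11.1859357, 19.0733441, 11.67618784, 4.7568, 1] ![0, 1 * γ, 2 * γ, 3 * γ, 4 * γ]
    ![(1 : DirichletCharacter ℂ N), χ, χ ^ 2, χ ^ 3, χ ^ 4] hσ (fun n hn => ?_)
  · rw [Fin.sum_univ_five] at h
    simp only [Complex.mk_eq_add_mul_I]
    simpa using h
  · rw [Fin.sum_univ_five]
    rcases χ.norm_eq_one_or_eq_zero n γ hn with hz | hu
    · have key := trig_polynomial_nonneg hz
      have hu : IsUnit (n : ZMod N) := by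
        by_contra h
        rw [χ.map_nonunit h] at hz
        simp at hz
      have e : ∀ k : ℕ, (n : ℂ) ^ (-(((k * γ : ℝ) : ℂ) * Complex.I)) =
          ((n : ℂ) ^ (-(γ * Complex.I))) ^ k := fun k => by
        rw [← Complex.cpow_nat_mul]
        congr 1
        push_cast
        ring
      have p2 := e 2
      have p3 := e 3
      have p4 := e 4
      norm_num at p2 p3 p4
      rw [mul_pow, mul_pow, mul_pow] at key
      simp only [Complex.mul_re] at key
      simp [MulChar.one_apply hu, MulChar.pow_apply', p2, p3, p4]
      linarith
    · simp [MulChar.map_nonunit _ hu]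

end DirichletCharacter

lemma log_ten_ge : 2.302 ≤ Real.log 10 := by
  have h : Real.log ((2 : ℝ) ^ 93) ≤ Real.log (10 ^ 28) :=
    Real.log_le_log (by norm_num) (by norm_num)
  rw [Real.log_pow, Real.log_pow] at h
  push_cast at h
  linarith [Real.log_two_gt_d9]

lemma log_pi_ge : 1.1436 ≤ Real.log π := by
  have h : Real.log ((2 : ℝ) ^ 33) ≤ Real.log (π ^ 20) := by
    refine Real.log_le_log (by norm_num) ?_
    calc (2 : ℝ) ^ 33 ≤ 3.14 ^ 20 := by norm_num
      _ ≤ π ^ 20 := by gcongr; exact Real.pi_gt_d2.le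
  rw [Real.log_pow, Real.log_pow] at h
  push_cast at h
  linarith [Real.log_two_gt_d9]

lemma stechkinMain_eq : stechkinMain = 0.2763935 := by norm_num [stechkinMain, stechkinCoeff]

namespace DirichletCharacter

lemma stechkinLog_one_real_le {N : ℕ} [NeZero N] {σ : ℝ} (hσ : 1 < σ) (hσ' : σ ≤ 1.1473) :
    stechkinLog (1 : DirichletCharacter ℂ N).LFunction σ ≤ 1 / (σ - 1) - 0.85 := by
  have h1 := stechkinLog_one_le (N := N) hσ
  have h2 := stechkinLog_riemannZeta_real_le (s := σ) (by simpa using hσ) (by simpa using hσ')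
    (by simp)
  rw [Complex.ofReal_re, stechkinMain_eq] at h2
  linarith [log_pi_ge]

end DirichletCharacter

lemma stechkinZero_ge_of_im_eq {s ρ : ℂ} (hs : 1 < s.re) (h0 : 0.95 ≤ ρ.re) (h1 : ρ.re ≤ 1)
    (him : s.im = ρ.im) : 1 / (s.re - ρ.re) ≤ stechkinZero s ρ := by
  have h := stechkin_zeroPair_ge hs (add_shift_re s) (add_shift_im s) h0 h1
  have hpos : 0 < s.re - ρ.re := by linarith
  rw [him, sub_self] at h
  refine le_trans (le_of_eq ?_) h
  field_simp
  ring

lemma stechkinZero_ge {s ρ : ℂ} (hs : 1 < s.re) (h0 : 0.95 ≤ ρ.re) (h1 : ρ.re ≤ 1) {x : ℝ}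
    (him : (s.im - ρ.im) ^ 2 = x) :
    (s.re - ρ.re) / ((s.re - ρ.re) ^ 2 + x) - 0.05 ≤ stechkinZero s ρ := by
  refine le_trans ?_ (stechkin_zeroPair_ge hs (add_shift_re s) (add_shift_im s) h0 h1)
  rw [him]
  have hx : 0 ≤ x := him ▸ sq_nonneg _
  have : (1 - ρ.re) * x / (0.9 + x) ≤ 0.05 := by
    rw [div_le_iff₀ (by linarith)]
    nlinarith
  linarith

lemma pole_le_zero {δ δ' x : ℝ} (h0 : 0 < δ) (h1 : δ ≤ δ') (h2 : δ' ≤ 1.306 * δ) (hx : 0 ≤ x) :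
    0.765 * (δ / (δ ^ 2 + x)) ≤ δ' / (δ' ^ 2 + x) := by
  have h3 : 0 < δ' := by linarith
  rw [← mul_div_assoc, div_le_div_iff₀ (by positivity) (by positivity)]
  have : 0 ≤ x * (δ' - 0.765 * δ) := mul_nonneg hx (by linarith)
  have : 0 ≤ δ * δ' * (δ - 0.765 * δ') := mul_nonneg (by positivity) (by linarith)
  nlinarith

lemma stechkin_numeric {L δ η E0 E1 E2 E3 E4 Y1 X2 X3 X4 : ℝ} (hL : 0 < L) (hδ : δ = 0.339 / L)
    (hη0 : 0 < η) (hη : η ≤ 1 / (9.646 * L)) (h0 : E0 ≤ 1 / δ - 0.85)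
    (h1 : E1 ≤ 0.2763935 * L + 0.0098 + (Y1 - 1 / (δ + η)))
    (h2 : E2 ≤ 0.2763935 * L + 0.1056 + X2)
    (h3 : E3 ≤ 0.2763935 * L + 0.1774 + X3) (h4 : E4 ≤ 0.2763935 * L + 0.2493 + X4)
    (h : 0 ≤ 11.1859357 * E0 + 19.0733441 * E1 + 11.67618784 * E2 + 4.7568 * E3 + E4) :
    6.99 ≤ 19.0733441 * Y1 + 11.67618784 * X2 + 4.7568 * X3 + X4 := by
  have e1 : 1 / δ = L / 0.339 := by rw [hδ]; field_simp
  have hδ0 : 0 < δ := by rw [hδ]; positivity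
  have e2 : L / (0.339 + 1 / 9.646) ≤ 1 / (δ + η) := by
    rw [div_le_div_iff₀ (by norm_num) (by positivity)]
    have : L * η ≤ L * (1 / (9.646 * L)) := by gcongr
    have e3 : L * (1 / (9.646 * L)) = 1 / 9.646 := by field_simp
    have e4 : L * δ = 0.339 := by rw [hδ]; field_simp
    linarith
  rw [e1] at h0
  norm_num at *
  linarith

namespace DirichletCharacter

/-- The parameter `σ = 1 + 0.339 / log M`. -/
noncomputable def stechkinAbscissa (M : ℝ) : ℝ := 1 + 0.339 / Real.log M

lemma log_ge_of_ten_le {M : ℝ} (hM : 10 ≤ M) : 2.302 ≤ Real.log M :=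
  log_ten_ge.trans (Real.log_le_log (by norm_num) hM)

lemma one_lt_stechkinAbscissa {M : ℝ} (hM : 10 ≤ M) : 1 < stechkinAbscissa M := by
  have := log_ge_of_ten_le hM
  rw [stechkinAbscissa, lt_add_iff_pos_right]
  positivity

lemma stechkinAbscissa_le {M : ℝ} (hM : 10 ≤ M) : stechkinAbscissa M ≤ 1.1473 := by
  have := log_ge_of_ten_le hM
  have h : 0.339 / Real.log M ≤ 0.339 / 2.302 := by gcongr
  rw [stechkinAbscissa]
  norm_num at h ⊢
  linarith

lemma zero_re_ge {M β : ℝ} (hM : 10 ≤ M) (h : 1 - 1 / (9.646 * Real.log M) ≤ β) : 0.95 ≤ β := by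
  have := log_ge_of_ten_le hM
  have h2 : 1 / (9.646 * Real.log M) ≤ 1 / (9.646 * 2.302) := by gcongr
  have h3 : (1 : ℝ) / (9.646 * 2.302) ≤ 0.05 := by norm_num
  linarith

lemma stechkin_combination {N : ℕ} [NeZero N] (χ : DirichletCharacter ℂ N) {M γ β : ℝ}
    (hM : 10 ≤ M) (hβ : 1 - 1 / (9.646 * Real.log M) ≤ β) (hβ1 : β < 1) {Y1 X2 X3 X4 : ℝ}
    (h1 : stechkinLog χ.LFunction ⟨stechkinAbscissa M, 1 * γ⟩ ≤
      stechkinMain * Real.log M + 0.0098 + (Y1 - 1 / (stechkinAbscissa M - β)))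
    (h2 : stechkinLog (χ ^ 2).LFunction ⟨stechkinAbscissa M, 2 * γ⟩ ≤
      stechkinMain * Real.log M + 0.1056 + X2)
    (h3 : stechkinLog (χ ^ 3).LFunction ⟨stechkinAbscissa M, 3 * γ⟩ ≤
      stechkinMain * Real.log M + 0.1774 + X3)
    (h4 : stechkinLog (χ ^ 4).LFunction ⟨stechkinAbscissa M, 4 * γ⟩ ≤
      stechkinMain * Real.log M + 0.2493 + X4) :
    6.99 ≤ 19.0733441 * Y1 + 11.67618784 * X2 + 4.7568 * X3 + X4 := by
  have hL := log_ge_of_ten_le hM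
  have hσ := one_lt_stechkinAbscissa hM
  have h0 := stechkinLog_one_real_le (N := N) hσ (stechkinAbscissa_le hM)
  rw [stechkinMain_eq] at h1 h2 h3 h4
  refine stechkin_numeric (L := Real.log M) (δ := stechkinAbscissa M - 1) (η := 1 - β)
    (by linarith) ?_ (by linarith) (by linarith) h0 ?_ h2 h3 h4 (χ.trig_combination_nonneg hσ γ)
  · rw [stechkinAbscissa]
    ring
  · rwa [sub_add_sub_cancel]

lemma stechkinLog_pow_le {N : ℕ} [NeZero N] (χ : DirichletCharacter ℂ N) {M γ k d : ℝ} {m : ℕ}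
    (hM : 10 ≤ M) (hNM : N ≤ M) (hNγ : N * |γ| ≤ M) (hk : 0 ≤ k)
    (hnum : ((1.1473 ^ 2 + 1 + k ^ 2) / 39.47) ^ 4 * 2 ^ m ≤ 1)
    (hd : 0.345 - stechkinMain * (m * (0.693147 / 8)) ≤ d) (S : Finset ℂ)
    (hS : ∀ ρ ∈ S, χ.LFunction ρ = 0 ∧ 1 / 2 < ρ.re ∧ ρ ≠ 1) :
    stechkinLog χ.LFunction ⟨stechkinAbscissa M, k * γ⟩ ≤ stechkinMain * Real.log M + d +
      (poleTerm χ ⟨stechkinAbscissa M, k * γ⟩ -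
        ∑ ρ ∈ S, stechkinZero ⟨stechkinAbscissa M, k * γ⟩ ρ) := by
  have := stechkinLog_LFunction_le_aux χ (s := ⟨stechkinAbscissa M, k * γ⟩)
    (one_lt_stechkinAbscissa hM) (stechkinAbscissa_le hM) hNM hNγ (abs_nonneg γ)
    (by rw [abs_mul, abs_of_nonneg hk]) S hS hnum hd
  linarith

end DirichletCharacter

namespace DirichletCharacter

lemma poleTerm_of_ne_one {N : ℕ} {χ : DirichletCharacter ℂ N} (hχ : χ ≠ 1) (s : ℂ) :
    poleTerm χ s = 0 := if_neg hχ

lemma poleTerm_one {N : ℕ} (σ t : ℝ) : poleTerm (1 : DirichletCharacter ℂ N) ⟨σ, t⟩ =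
    (σ - 1) / ((σ - 1) ^ 2 + t ^ 2) + 0.15 := if_pos rfl

/-- A zero of `L(s, χ)`, `s ≠ 1`, in the zero-free region attached to `M` to the left of
the line `re s = 1`, together with the size conditions relating `M` to the modulus. -/
structure IsExceptionalZero {N : ℕ} [NeZero N] (χ : DirichletCharacter ℂ N) (M : ℝ) (ρ : ℂ) :
    Prop where
  ten_le : 10 ≤ M
  level_le : N ≤ M
  level_mul_le : N * |ρ.im| ≤ M
  le_re : 1 - 1 / (9.646 * Real.log M) ≤ ρ.re
  re_lt : ρ.re < 1
  eq_zero : χ.LFunction ρ = 0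

namespace IsExceptionalZero

variable {N : ℕ} [NeZero N] {χ : DirichletCharacter ℂ N} {M : ℝ} {ρ : ℂ}

lemma re_ge (h : IsExceptionalZero χ M ρ) : 0.95 ≤ ρ.re := zero_re_ge h.ten_le h.le_re

lemma ne_one_of_re_eq {z : ℂ} (h : IsExceptionalZero χ M ρ) (hz : z.re = ρ.re) : z ≠ 1 := by
  rintro rfl
  have := h.re_lt
  rw [← hz] at this
  simp at this

lemma mem_cond (h : IsExceptionalZero χ M ρ) :
    χ.LFunction ρ = 0 ∧ 1 / 2 < ρ.re ∧ ρ ≠ 1 :=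
  ⟨h.eq_zero, by linarith [h.re_ge], h.ne_one_of_re_eq rfl⟩

lemma inv_mem_cond (h : IsExceptionalZero χ M ρ) (hχ : χ ≠ 1) :
    χ⁻¹.LFunction (starRingEnd ℂ ρ) = 0 ∧ 1 / 2 < (starRingEnd ℂ ρ).re ∧ starRingEnd ℂ ρ ≠ 1 :=
  ⟨LFunction_inv_conj_eq_zero hχ (by linarith [h.re_ge]) h.eq_zero,
    by rw [Complex.conj_re]; linarith [h.re_ge], h.ne_one_of_re_eq (Complex.conj_re ρ)⟩

lemma pole_le (h : IsExceptionalZero χ M ρ) {x : ℝ} (hx : 0 ≤ x) :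
    0.765 * ((stechkinAbscissa M - 1) / ((stechkinAbscissa M - 1) ^ 2 + x)) ≤
      (stechkinAbscissa M - ρ.re) / ((stechkinAbscissa M - ρ.re) ^ 2 + x) := by
  have hL := log_ge_of_ten_le h.ten_le
  refine pole_le_zero (by linarith [one_lt_stechkinAbscissa h.ten_le]) (by linarith [h.re_lt]) ?_ hx
  have h1 := h.le_re
  have h2 : 1 / (9.646 * Real.log M) ≤ 0.306 * (0.339 / Real.log M) := by
    rw [← mul_div_assoc, div_le_div_iff₀ (by positivity) (by positivity)]
    linarith
  rw [stechkinAbscissa]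
  linarith

lemma stechkinZero_self_ge (h : IsExceptionalZero χ M ρ) :
    1 / (stechkinAbscissa M - ρ.re) ≤ stechkinZero ⟨stechkinAbscissa M, 1 * ρ.im⟩ ρ :=
  stechkinZero_ge_of_im_eq (s := ⟨stechkinAbscissa M, 1 * ρ.im⟩) (one_lt_stechkinAbscissa h.ten_le) h.re_ge h.re_lt.le (one_mul _)

lemma stechkinZero_ge {z : ℂ} (h : IsExceptionalZero χ M ρ) {t x : ℝ} (hz : z.re = ρ.re)
    (hx : (t - z.im) ^ 2 = x) :
    0.765 * ((stechkinAbscissa M - 1) / ((stechkinAbscissa M - 1) ^ 2 + x)) - 0.05 ≤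
      stechkinZero ⟨stechkinAbscissa M, t⟩ z := by
  have h1 := _root_.stechkinZero_ge (s := ⟨stechkinAbscissa M, t⟩) (ρ := z)
    (one_lt_stechkinAbscissa h.ten_le) (hz ▸ h.re_ge) (hz ▸ h.re_lt.le) hx
  have h2 := h.pole_le (hx ▸ sq_nonneg _)
  rw [hz] at h1
  exact (sub_le_sub_right h2 _).trans h1

lemma stechkinLog_le (h : IsExceptionalZero χ M ρ) (ψ : DirichletCharacter ℂ N) {k d : ℝ} {m : ℕ}
    (hk : 0 ≤ k) (hnum : ((1.1473 ^ 2 + 1 + k ^ 2) / 39.47) ^ 4 * 2 ^ m ≤ 1)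
    (hd : 0.345 - stechkinMain * (m * (0.693147 / 8)) ≤ d) (S : Finset ℂ)
    (hS : ∀ ρ ∈ S, ψ.LFunction ρ = 0 ∧ 1 / 2 < ρ.re ∧ ρ ≠ 1) :
    stechkinLog ψ.LFunction ⟨stechkinAbscissa M, k * ρ.im⟩ ≤ stechkinMain * Real.log M + d +
      (poleTerm ψ ⟨stechkinAbscissa M, k * ρ.im⟩ -
        ∑ z ∈ S, stechkinZero ⟨stechkinAbscissa M, k * ρ.im⟩ z) :=
  stechkinLog_pow_le ψ h.ten_le h.level_le h.level_mul_le hk hnum hd S hS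

lemma stechkinLog_one_mul_le (h : IsExceptionalZero χ M ρ) (ψ : DirichletCharacter ℂ N)
    (S : Finset ℂ) (hS : ∀ ρ ∈ S, ψ.LFunction ρ = 0 ∧ 1 / 2 < ρ.re ∧ ρ ≠ 1) :
    stechkinLog ψ.LFunction ⟨stechkinAbscissa M, 1 * ρ.im⟩ ≤ stechkinMain * Real.log M + 0.0098 +
      (poleTerm ψ ⟨stechkinAbscissa M, 1 * ρ.im⟩ -
        ∑ z ∈ S, stechkinZero ⟨stechkinAbscissa M, 1 * ρ.im⟩ z) :=
  h.stechkinLog_le ψ (m := 14) (by norm_num) (by norm_num)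
    (by rw [stechkinMain_eq]; norm_num) S hS

lemma stechkinLog_two_mul_le (h : IsExceptionalZero χ M ρ) (ψ : DirichletCharacter ℂ N)
    (S : Finset ℂ) (hS : ∀ ρ ∈ S, ψ.LFunction ρ = 0 ∧ 1 / 2 < ρ.re ∧ ρ ≠ 1) :
    stechkinLog ψ.LFunction ⟨stechkinAbscissa M, 2 * ρ.im⟩ ≤ stechkinMain * Real.log M + 0.1056 +
      (poleTerm ψ ⟨stechkinAbscissa M, 2 * ρ.im⟩ -
        ∑ z ∈ S, stechkinZero ⟨stechkinAbscissa M, 2 * ρ.im⟩ z) :=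
  h.stechkinLog_le ψ (m := 10) (by norm_num) (by norm_num)
    (by rw [stechkinMain_eq]; norm_num) S hS

lemma stechkinLog_three_mul_le (h : IsExceptionalZero χ M ρ) (ψ : DirichletCharacter ℂ N)
    (S : Finset ℂ) (hS : ∀ ρ ∈ S, ψ.LFunction ρ = 0 ∧ 1 / 2 < ρ.re ∧ ρ ≠ 1) :
    stechkinLog ψ.LFunction ⟨stechkinAbscissa M, 3 * ρ.im⟩ ≤ stechkinMain * Real.log M + 0.1774 +
      (poleTerm ψ ⟨stechkinAbscissa M, 3 * ρ.im⟩ -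
        ∑ z ∈ S, stechkinZero ⟨stechkinAbscissa M, 3 * ρ.im⟩ z) :=
  h.stechkinLog_le ψ (m := 7) (by norm_num) (by norm_num)
    (by rw [stechkinMain_eq]; norm_num) S hS

lemma stechkinLog_four_mul_le (h : IsExceptionalZero χ M ρ) (ψ : DirichletCharacter ℂ N) :
    stechkinLog ψ.LFunction ⟨stechkinAbscissa M, 4 * ρ.im⟩ ≤ stechkinMain * Real.log M + 0.2493 +
      poleTerm ψ ⟨stechkinAbscissa M, 4 * ρ.im⟩ := by
  have := h.stechkinLog_le ψ (k := 4) (d := 0.2493) (m := 4) (by norm_num) (by norm_num)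
    (by rw [stechkinMain_eq]; norm_num) ∅ (by simp)
  simpa using this

/-- The zero-repulsion inequality with one zero inserted for `χ`. -/
lemma combination (h : IsExceptionalZero χ M ρ) (hχ : χ ≠ 1) {X2 X3 X4 : ℝ}
    (h2 : stechkinLog (χ ^ 2).LFunction ⟨stechkinAbscissa M, 2 * ρ.im⟩ ≤
      stechkinMain * Real.log M + 0.1056 + X2)
    (h3 : stechkinLog (χ ^ 3).LFunction ⟨stechkinAbscissa M, 3 * ρ.im⟩ ≤
      stechkinMain * Real.log M + 0.1774 + X3)
    (h4 : stechkinLog (χ ^ 4).LFunction ⟨stechkinAbscissa M, 4 * ρ.im⟩ ≤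
      stechkinMain * Real.log M + 0.2493 + X4) :
    6.99 ≤ 11.67618784 * X2 + 4.7568 * X3 + X4 := by
  have h1 := h.stechkinLog_one_mul_le χ {ρ} (by simpa using h.mem_cond)
  rw [poleTerm_of_ne_one hχ, Finset.sum_singleton] at h1
  have := χ.stechkin_combination h.ten_le h.le_re h.re_lt (Y1 := 0)
    (by linarith [h.stechkinZero_self_ge]) h2 h3 h4
  linarith

lemma stechkinLog_two_mul_le' (h : IsExceptionalZero χ M ρ) (ψ : DirichletCharacter ℂ N) :
    stechkinLog ψ.LFunction ⟨stechkinAbscissa M, 2 * ρ.im⟩ ≤ stechkinMain * Real.log M + 0.1056 +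
      poleTerm ψ ⟨stechkinAbscissa M, 2 * ρ.im⟩ := by
  simpa using h.stechkinLog_two_mul_le ψ ∅ (by simp)

lemma stechkinLog_three_mul_le' (h : IsExceptionalZero χ M ρ) (ψ : DirichletCharacter ℂ N) :
    stechkinLog ψ.LFunction ⟨stechkinAbscissa M, 3 * ρ.im⟩ ≤ stechkinMain * Real.log M + 0.1774 +
      poleTerm ψ ⟨stechkinAbscissa M, 3 * ρ.im⟩ := by
  simpa using h.stechkinLog_three_mul_le ψ ∅ (by simp)

lemma pole_nonneg (h : IsExceptionalZero χ M ρ) {x : ℝ} (hx : 0 ≤ x) :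
    0 ≤ (stechkinAbscissa M - 1) / ((stechkinAbscissa M - 1) ^ 2 + x) := by
  have := one_lt_stechkinAbscissa h.ten_le
  exact div_nonneg (by linarith) (by positivity)

/-- The order of the character is at most four. -/
lemma pow_eq_one (h : IsExceptionalZero χ M ρ) : χ ^ 2 = 1 ∨ χ ^ 3 = 1 ∨ χ ^ 4 = 1 := by
  by_contra! hc
  obtain ⟨hc2, hc3, hc4⟩ := hc
  have hχ : χ ≠ 1 := by rintro rfl; simp at hc2
  have h2 := h.stechkinLog_two_mul_le' (χ ^ 2)
  have h3 := h.stechkinLog_three_mul_le' (χ ^ 3)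
  have h4 := h.stechkinLog_four_mul_le (χ ^ 4)
  rw [poleTerm_of_ne_one ‹_›] at h2 h3 h4
  have := h.combination hχ h2 h3 h4
  norm_num at this

lemma sq_eq_one_of_cube (h : IsExceptionalZero χ M ρ) (h3 : χ ^ 3 = 1) : χ ^ 2 = 1 := by
  by_contra hc
  have hχ : χ ≠ 1 := by rintro rfl; simp at hc
  have h4 : χ ^ 4 ≠ 1 := by rwa [pow_succ, h3, one_mul]
  have hinv : χ ^ 2 = χ⁻¹ := eq_inv_of_mul_eq_one_left (by rw [← pow_succ, h3])
  have e2 := h.stechkinLog_two_mul_le (χ ^ 2) {starRingEnd ℂ ρ}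
    (by simpa [hinv] using h.inv_mem_cond hχ)
  have e3 := h.stechkinLog_three_mul_le' (χ ^ 3)
  have e4 := h.stechkinLog_four_mul_le (χ ^ 4)
  rw [poleTerm_of_ne_one hc, Finset.sum_singleton] at e2
  rw [poleTerm_of_ne_one h4] at e4
  nth_rw 2 [h3] at e3
  rw [poleTerm_one] at e3
  have z := h.stechkinZero_ge (z := starRingEnd ℂ ρ) (t := 2 * ρ.im) (x := (3 * ρ.im) ^ 2)
    (Complex.conj_re ρ) (by rw [Complex.conj_im]; ring)
  have p := h.pole_nonneg (sq_nonneg (3 * ρ.im))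
  have := h.combination hχ (e2.trans (by gcongr)) e3 e4
  norm_num at *
  linarith

lemma sq_eq_one_of_pow_four (h : IsExceptionalZero χ M ρ) (h4 : χ ^ 4 = 1) : χ ^ 2 = 1 := by
  by_contra hc
  have hχ : χ ≠ 1 := by rintro rfl; simp at hc
  have h3 : χ ^ 3 ≠ 1 := by
    intro h3
    rw [pow_succ, h3, one_mul] at h4
    exact hχ h4
  have hinv : χ ^ 3 = χ⁻¹ := eq_inv_of_mul_eq_one_left (by rw [← pow_succ, h4])
  have e2 := h.stechkinLog_two_mul_le' (χ ^ 2)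
  have e3 := h.stechkinLog_three_mul_le (χ ^ 3) {starRingEnd ℂ ρ}
    (by simpa [hinv] using h.inv_mem_cond hχ)
  have e4 := h.stechkinLog_four_mul_le (χ ^ 4)
  rw [poleTerm_of_ne_one hc] at e2
  rw [poleTerm_of_ne_one h3, Finset.sum_singleton] at e3
  nth_rw 2 [h4] at e4
  rw [poleTerm_one] at e4
  have z := h.stechkinZero_ge (z := starRingEnd ℂ ρ) (t := 3 * ρ.im) (x := (4 * ρ.im) ^ 2)
    (Complex.conj_re ρ) (by rw [Complex.conj_im]; ring)
  have p := h.pole_nonneg (sq_nonneg (4 * ρ.im))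
  have := h.combination hχ e2 (e3.trans (by gcongr)) e4
  norm_num at *
  linarith

lemma sq_eq_one (h : IsExceptionalZero χ M ρ) : χ ^ 2 = 1 := by
  rcases h.pow_eq_one with h' | h' | h'
  exacts [h', h.sq_eq_one_of_cube h', h.sq_eq_one_of_pow_four h']

lemma im_eq_zero (h : IsExceptionalZero χ M ρ) (hχ : χ ≠ 1) : ρ.im = 0 := by
  by_contra him
  have h2 := h.sq_eq_one
  have hinv : χ⁻¹ = χ := inv_eq_of_mul_eq_one_left (by rw [← sq, h2])
  have h3 : χ ^ 3 = χ := by rw [pow_succ, h2, one_mul]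
  have h4 : χ ^ 4 = 1 := by rw [pow_succ, h3, ← sq, h2]
  have hne : ρ ≠ starRingEnd ℂ ρ := by
    intro h
    have := congrArg Complex.im h
    rw [Complex.conj_im] at this
    exact him (by linarith)
  have hS : ∀ z ∈ ({ρ, starRingEnd ℂ ρ} : Finset ℂ),
      χ.LFunction z = 0 ∧ 1 / 2 < z.re ∧ z ≠ 1 := by
    intro z hz
    rw [Finset.mem_insert, Finset.mem_singleton] at hz
    rcases hz with rfl | rfl
    · exact h.mem_cond
    · simpa only [hinv] using h.inv_mem_cond hχ
  have e1 := h.stechkinLog_one_mul_le χ _ hS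
  have e2 := h.stechkinLog_two_mul_le' (χ ^ 2)
  have e3 := h.stechkinLog_three_mul_le χ _ hS
  have e4 := h.stechkinLog_four_mul_le (χ ^ 4)
  rw [poleTerm_of_ne_one hχ, Finset.sum_pair hne] at e1 e3
  nth_rw 2 [h4] at e4
  nth_rw 2 [h2] at e2
  rw [poleTerm_one] at e2 e4
  have z1 := h.stechkinZero_ge (z := starRingEnd ℂ ρ) (t := 1 * ρ.im) (x := (2 * ρ.im) ^ 2)
    (Complex.conj_re ρ) (by rw [Complex.conj_im]; ring)
  have z3 := h.stechkinZero_ge (z := ρ) (t := 3 * ρ.im) (x := (2 * ρ.im) ^ 2) rfl (by ring)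
  have z3' := h.stechkinZero_ge (z := starRingEnd ℂ ρ) (t := 3 * ρ.im) (x := (4 * ρ.im) ^ 2)
    (Complex.conj_re ρ) (by rw [Complex.conj_im]; ring)
  have p2 := h.pole_nonneg (sq_nonneg (2 * ρ.im))
  have p4 := h.pole_nonneg (sq_nonneg (4 * ρ.im))
  have z0 := h.stechkinZero_self_ge
  set P2 := (stechkinAbscissa M - 1) / ((stechkinAbscissa M - 1) ^ 2 + (2 * ρ.im) ^ 2)
  set P4 := (stechkinAbscissa M - 1) / ((stechkinAbscissa M - 1) ^ 2 + (4 * ρ.im) ^ 2)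
  have := χ.stechkin_combination h.ten_le h.le_re h.re_lt (γ := ρ.im)
    (Y1 := 0.05 - 0.765 * P2) (X2 := P2 + 0.15) (X3 := 0.1 - 0.765 * P2 - 0.765 * P4)
    (X4 := P4 + 0.15) (by linarith) e2 (by rw [h3]; linarith) e4
  norm_num at this p2 p4
  linarith

end IsExceptionalZero

end DirichletCharacter

lemma re_logDeriv_riemannXi_two_le : (logDeriv riemannXi 2).re ≤ 0.7 := by
  have hz : (logDeriv riemannZeta 2).re ≤ 0 := by
    have h := DirichletCharacter.hasSum_re_neg_logDeriv (1 : DirichletCharacter ℂ 1) (s := 2)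
      (by simp)
    rw [DirichletCharacter.LFunction_modOne_eq] at h
    have := h.nonneg fun n => by
      have h1 : (1 : DirichletCharacter ℂ 1) (n : ZMod 1) = 1 := by
        rw [Subsingleton.elim (n : ZMod 1) 1, map_one]
      have := ArithmeticFunction.vonMangoldt_nonneg (n := n)
      simp [h1]
      positivity
    linarith
  rw [logDeriv_riemannXi (by simp), div_self two_ne_zero, Complex.digamma_one]
  have h1 : ((1 : ℂ) / 2 + 1 / (2 - 1) + (-(Real.log π : ℂ) / 2 +
      -(Real.eulerMascheroniConstant : ℂ) / 2) + logDeriv riemannZeta 2).re =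
      1 / 2 + 1 + (-Real.log π / 2 + -Real.eulerMascheroniConstant / 2) +
        (logDeriv riemannZeta 2).re := by
    have : (1 : ℂ) / 2 + 1 / (2 - 1) + (-(Real.log π : ℂ) / 2 +
        -(Real.eulerMascheroniConstant : ℂ) / 2) =
        ((1 / 2 + 1 + (-Real.log π / 2 + -Real.eulerMascheroniConstant / 2) : ℝ) : ℂ) := by
      push_cast
      norm_num
    rw [this, Complex.add_re, Complex.ofReal_re]
  rw [h1]
  linarith [log_pi_ge, Real.one_half_lt_eulerMascheroniConstant]

lemma zeroPair_two_eq (ρ : ℂ) : zeroPair 2 ρ =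
    (2 - ρ.re) / ((2 - ρ.re) ^ 2 + ρ.im ^ 2) + (1 + ρ.re) / ((1 + ρ.re) ^ 2 + ρ.im ^ 2) := by
  rw [zeroPair_eq]
  norm_num
  ring

lemma riemannZeta_ne_zero_of_abs_im_le_two {ρ : ℂ} (h0 : 0.95 ≤ ρ.re) (h1 : ρ.re < 1)
    (him : |ρ.im| ≤ 2) : riemannZeta ρ ≠ 0 := by
  intro hz
  have hne : ∀ z : ℂ, z.re < 1 → z ≠ 1 := by rintro z hz rfl; simp at hz
  have hxi : ∀ z : ℂ, z.re = ρ.re → riemannZeta z = 0 → riemannXi z = 0 := by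
    intro z hz h
    rw [riemannXi_eq (by linarith) (hne z (by linarith)), h]
    simp
  have hsum : ∀ S : Finset ℂ, (∀ z ∈ S, riemannXi z = 0 ∧ 1 / 2 < z.re) →
      ∑ z ∈ S, zeroPair 2 z ≤ 0.7 := by
    intro S hS
    have h2 := riemannXi_ne_zero (s := 2) (by simp)
    have := symEntire_riemannXi.sum_zeroPair_le (κ := 0) S h2 h2 (fun z hz => by
      have := symEntire_riemannXi.zero_mem_strip hz
      rw [zero_mul]
      exact zeroPair_nonneg (by simp) this.1 this.2) hS
    simp only [zero_mul, sub_zero] at this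
    exact this.trans re_logDeriv_riemannXi_two_le
  by_cases h : ρ.im = 0
  · have := hsum {ρ} (by simpa using ⟨hxi ρ rfl hz, by linarith⟩)
    rw [Finset.sum_singleton, zeroPair_two_eq, h] at this
    have e1 : (0.95 : ℝ) ≤ (2 - ρ.re) / ((2 - ρ.re) ^ 2 + 0 ^ 2) := by
      rw [le_div_iff₀ (by nlinarith)]
      nlinarith
    have e2 : 0 ≤ (1 + ρ.re) / ((1 + ρ.re) ^ 2 + 0 ^ 2) := by
      apply div_nonneg <;> nlinarith
    norm_num at *
    linarith
  · have hne : ρ ≠ starRingEnd ℂ ρ := by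
      intro h'
      have := congrArg Complex.im h'
      rw [Complex.conj_im] at this
      exact h (by linarith)
    have := hsum {ρ, starRingEnd ℂ ρ} (by
      intro z hz'
      rw [Finset.mem_insert, Finset.mem_singleton] at hz'
      rcases hz' with rfl | rfl
      · exact ⟨hxi _ rfl hz, by linarith⟩
      · refine ⟨hxi _ (Complex.conj_re ρ) ?_, by rw [Complex.conj_re]; linarith⟩
        rw [riemannZeta_conj, hz, map_zero])
    rw [Finset.sum_pair hne, zeroPair_two_eq, zeroPair_two_eq, Complex.conj_re, Complex.conj_im,
      neg_sq] at this
    have h4 : ρ.im ^ 2 ≤ 4 := by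
      have := sq_le_sq' (by linarith [abs_le.1 him]) (abs_le.1 him).2
      linarith
    have e1 : (0.2 : ℝ) ≤ (2 - ρ.re) / ((2 - ρ.re) ^ 2 + ρ.im ^ 2) := by
      rw [le_div_iff₀ (by nlinarith)]
      nlinarith
    have e2 : (0.2 : ℝ) ≤ (1 + ρ.re) / ((1 + ρ.re) ^ 2 + ρ.im ^ 2) := by
      rw [le_div_iff₀ (by nlinarith)]
      nlinarith
    norm_num at *
    linarith

namespace DirichletCharacter

lemma LFunction_one_eq_zero_iff {N : ℕ} [NeZero N] {s : ℂ} (hs : 0 < s.re) (hs' : s ≠ 1) :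
    (1 : DirichletCharacter ℂ N).LFunction s = 0 ↔ riemannZeta s = 0 := by
  have h := LFunctionTrivChar_eq_mul_riemannZeta (N := N) hs'
  rw [LFunctionTrivChar] at h
  rw [h, mul_eq_zero, or_iff_right]
  refine Finset.prod_ne_zero_iff.2 fun p hp => ?_
  simpa using eulerFactor_ne_zero (p := p) (a := 1) (Nat.prime_of_mem_primeFactors hp).two_le
    (by simp) hs

lemma IsExceptionalZero.ne_one {N : ℕ} [NeZero N] {χ : DirichletCharacter ℂ N} {M : ℝ} {ρ : ℂ}
    (h : IsExceptionalZero χ M ρ) : χ ≠ 1 := by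
  rintro rfl
  have hz := (LFunction_one_eq_zero_iff (by linarith [h.re_ge]) (h.ne_one_of_re_eq rfl)).1 h.eq_zero
  have him : 2 < |ρ.im| := by
    by_contra! hc
    exact riemannZeta_ne_zero_of_abs_im_le_two h.re_ge h.re_lt hc hz
  have e1 := h.stechkinLog_one_mul_le 1 {ρ} (by simpa using h.mem_cond)
  have e2 := h.stechkinLog_two_mul_le' 1
  have e3 := h.stechkinLog_three_mul_le' 1
  have e4 := h.stechkinLog_four_mul_le 1
  rw [poleTerm_one] at e1 e2 e3 e4
  rw [Finset.sum_singleton] at e1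
  have z0 := h.stechkinZero_self_ge
  have pole : ∀ k : ℝ, 0 < k → (stechkinAbscissa M - 1) / ((stechkinAbscissa M - 1) ^ 2 +
      (k * ρ.im) ^ 2) ≤ 0.1473 / (4 * k ^ 2) := by
    intro k hk
    have h1 := one_lt_stechkinAbscissa h.ten_le
    have h2 := stechkinAbscissa_le h.ten_le
    have h3 : 4 ≤ ρ.im ^ 2 := by
      rw [← sq_abs]
      nlinarith
    apply div_le_div₀ (by norm_num) (by norm_num at h2 ⊢; linarith) (by positivity)
    rw [mul_pow]
    nlinarith [sq_nonneg (stechkinAbscissa M - 1), sq_nonneg k]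
  have p1 := pole 1 (by norm_num)
  have p2 := pole 2 (by norm_num)
  have p3 := pole 3 (by norm_num)
  have p4 := pole 4 (by norm_num)
  have := stechkin_combination (N := N) 1 h.ten_le h.le_re h.re_lt (γ := ρ.im)
    (Y1 := 0.1473 / (4 * 1 ^ 2) + 0.15) (X2 := 0.1473 / (4 * 2 ^ 2) + 0.15)
    (X3 := 0.1473 / (4 * 3 ^ 2) + 0.15) (X4 := 0.1473 / (4 * 4 ^ 2) + 0.15)
    (by linarith) (by rw [one_pow]; linarith) (by rw [one_pow]; linarith)
    (by rw [one_pow]; linarith)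
  norm_num at this

end DirichletCharacter

namespace DirichletCharacter

lemma apply_eq_of_sq_eq_one {N : ℕ} {χ : DirichletCharacter ℂ N} (hχ : χ ^ 2 = 1) (a : ZMod N) :
    χ a = 0 ∨ χ a = 1 ∨ χ a = -1 := by
  by_cases ha : IsUnit a
  · right
    rw [← sq_eq_one_iff, ← MulChar.pow_apply' χ two_ne_zero, hχ, MulChar.one_apply ha]
  · exact Or.inl (χ.map_nonunit ha)

lemma im_apply_eq_zero_of_sq_eq_one {N : ℕ} {χ : DirichletCharacter ℂ N} (hχ : χ ^ 2 = 1)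
    (a : ZMod N) : (χ a).im = 0 := by
  rcases apply_eq_of_sq_eq_one hχ a with h | h | h <;> simp [h]

lemma stechkinLog_add_nonneg {N : ℕ} [NeZero N] {χ : DirichletCharacter ℂ N} (hχ : χ ^ 2 = 1)
    {σ : ℝ} (hσ : 1 < σ) :
    0 ≤ stechkinLog (1 : DirichletCharacter ℂ N).LFunction σ + stechkinLog χ.LFunction σ := by
  have := sum_stechkinLog_nonneg Finset.univ ![1, 1] ![0, 0] ![1, χ] hσ (fun n _ => by
    by_cases ha : IsUnit (n : ZMod N)
    · rcases apply_eq_of_sq_eq_one hχ n with h | h | h <;>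
        simp [Fin.sum_univ_two, MulChar.one_apply ha, h]
    · simp [MulChar.map_nonunit _ ha])
  simpa [Fin.sum_univ_two] using this

lemma stechkinLog_add_add_add_nonneg {N : ℕ} [NeZero N] {χ₁ χ₂ : DirichletCharacter ℂ N}
    (h₁ : χ₁ ^ 2 = 1) (h₂ : χ₂ ^ 2 = 1) {σ : ℝ} (hσ : 1 < σ) :
    0 ≤ stechkinLog (1 : DirichletCharacter ℂ N).LFunction σ + stechkinLog χ₁.LFunction σ +
      stechkinLog χ₂.LFunction σ + stechkinLog (χ₁ * χ₂).LFunction σ := by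
  have := sum_stechkinLog_nonneg Finset.univ ![1, 1, 1, 1] ![0, 0, 0, 0] ![1, χ₁, χ₂, χ₁ * χ₂] hσ
    (fun n _ => by
      by_cases ha : IsUnit (n : ZMod N)
      · rcases apply_eq_of_sq_eq_one h₁ n with h | h | h <;>
        rcases apply_eq_of_sq_eq_one h₂ n with h' | h' | h' <;>
          (simp [Fin.sum_univ_four, MulChar.one_apply ha, h, h'] <;> norm_num)
      · simp [MulChar.map_nonunit _ ha])
  simpa [Fin.sum_univ_four] using this

namespace IsExceptionalZero

variable {N : ℕ} [NeZero N] {χ χ' : DirichletCharacter ℂ N} {M : ℝ} {ρ ρ' : ℂ}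

lemma stechkinLog_real_le (h : IsExceptionalZero χ M ρ) {ψ : DirichletCharacter ℂ N}
    (hψ : ψ ≠ 1) (S : Finset ℂ) (hS : ∀ z ∈ S, IsExceptionalZero ψ M z ∧ z.im = 0) :
    stechkinLog ψ.LFunction (stechkinAbscissa M) ≤ stechkinMain * Real.log M + 0.0098 -
      S.card * (Real.log M / (0.339 + 1 / 9.646)) := by
  have hχ := h.im_eq_zero h.ne_one
  have hL := log_ge_of_ten_le h.ten_le
  have h1 := h.stechkinLog_one_mul_le ψ S fun z hz => (hS z hz).1.mem_cond
  have hs : (⟨stechkinAbscissa M, 1 * ρ.im⟩ : ℂ) = stechkinAbscissa M := by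
    rw [hχ, mul_zero]
    rfl
  have h2 : ∑ z ∈ S, Real.log M / (0.339 + 1 / 9.646) ≤
      ∑ z ∈ S, stechkinZero ⟨stechkinAbscissa M, 1 * ρ.im⟩ z := by
    refine Finset.sum_le_sum fun z hz => le_trans ?_
      (le_of_le_of_eq (hS z hz).1.stechkinZero_self_ge (by rw [hχ, (hS z hz).2]))
    have h3 := (hS z hz).1.le_re
    have h4 := (hS z hz).1.re_lt
    have hpos := one_lt_stechkinAbscissa h.ten_le
    rw [div_le_div_iff₀ (by norm_num) (by linarith), stechkinAbscissa]
    have e1 : Real.log M * (1 + 0.339 / Real.log M - (1 - 1 / (9.646 * Real.log M))) =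
        0.339 + 1 / 9.646 := by
      field_simp
      ring
    rw [one_mul, ← e1]
    gcongr
  rw [poleTerm_of_ne_one hψ, hs] at h1
  rw [Finset.sum_const, nsmul_eq_mul, hs] at h2
  linarith

lemma stechkinLog_principal_le (h : IsExceptionalZero χ M ρ) :
    stechkinLog (1 : DirichletCharacter ℂ N).LFunction (stechkinAbscissa M) ≤
      Real.log M / 0.339 - 0.85 := by
  refine (stechkinLog_one_real_le (one_lt_stechkinAbscissa h.ten_le)
    (stechkinAbscissa_le h.ten_le)).trans (le_of_eq ?_)
  rw [stechkinAbscissa, add_sub_cancel_left, one_div_div]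

lemma eq (h : IsExceptionalZero χ M ρ) (h' : IsExceptionalZero χ' M ρ') : ρ = ρ' := by
  by_contra hne
  have hL := log_ge_of_ten_le h.ten_le
  have hσ := one_lt_stechkinAbscissa h.ten_le
  have him := h.im_eq_zero h.ne_one
  have him' := h'.im_eq_zero h'.ne_one
  have h0 := h.stechkinLog_principal_le
  by_cases hχ : χ = χ'
  · subst hχ
    have h1 := h.stechkinLog_real_le h.ne_one {ρ, ρ'} (by
      intro z hz
      rw [Finset.mem_insert, Finset.mem_singleton] at hz
      rcases hz with rfl | rfl
      exacts [⟨h, him⟩, ⟨h', him'⟩])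
    rw [Finset.card_pair hne, stechkinMain_eq] at h1
    have := stechkinLog_add_nonneg h.sq_eq_one hσ
    norm_num at *
    linarith
  · have hmul : χ * χ' ≠ 1 := by
      intro hc
      apply hχ
      rw [eq_inv_of_mul_eq_one_left hc]
      exact inv_eq_of_mul_eq_one_left (by rw [← sq, h'.sq_eq_one])
    have h1 := h.stechkinLog_real_le h.ne_one {ρ} (by simp [h, him])
    have h2 := h.stechkinLog_real_le h'.ne_one {ρ'} (by simp [h', him'])
    have h3 := h.stechkinLog_real_le hmul ∅ (by simp)
    have := stechkinLog_add_add_add_nonneg h.sq_eq_one h'.sq_eq_one hσ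
    rw [Finset.card_singleton, stechkinMain_eq] at h1 h2
    rw [Finset.card_empty, stechkinMain_eq] at h3
    norm_num at *
    linarith

end IsExceptionalZero

end DirichletCharacter

lemma log_four_mul_pi_le : Real.log (4 * π) ≤ 2.56 := by
  have h : Real.log (π ^ 5) ≤ Real.log (307 : ℝ) := by
    refine Real.log_le_log (by positivity) ?_
    calc π ^ 5 ≤ 3.1416 ^ 5 := by gcongr; exact Real.pi_lt_d4.le
      _ ≤ 307 := by norm_num
  have h2 : Real.log ((307 : ℝ) ^ 3) ≤ Real.log (2 ^ 25) :=
    Real.log_le_log (by norm_num) (by norm_num)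
  rw [Real.log_pow] at h
  rw [Real.log_pow, Real.log_pow] at h2
  have h3 : Real.log 4 = 2 * Real.log 2 := by
    rw [← Real.log_rpow two_pos]
    norm_num
  rw [Real.log_mul (by norm_num) Real.pi_ne_zero, h3]
  push_cast at h h2
  linarith [Real.log_two_lt_d9]

lemma log_three_ge : 1.07 ≤ Real.log 3 := by
  have h : Real.log ((2 : ℝ) ^ 31) ≤ Real.log (3 ^ 20) :=
    Real.log_le_log (by norm_num) (by norm_num)
  rw [Real.log_pow, Real.log_pow] at h
  push_cast at h
  linarith [Real.log_two_gt_d9]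

/-- The ratio `n ^ s ∏_{p ∣ n} (1 - p ^ (-s))` of the trivial L-function, normalised by `n ^ s`,
to the Riemann zeta function. -/
noncomputable def jordanTotient (n : ℕ) (s : ℂ) : ℂ :=
  (n : ℂ) ^ s * ∏ p ∈ n.primeFactors, (1 - 1 * (p : ℂ) ^ (-s))

lemma differentiable_jordanTotient {n : ℕ} (hn : n ≠ 0) : Differentiable ℂ (jordanTotient n) :=
  (differentiable_id.const_cpow (Or.inl (by exact_mod_cast hn))).mul
    (Differentiable.fun_finsetProd fun p hp => fun s =>
      differentiable_eulerFactor (Nat.prime_of_mem_primeFactors hp).ne_zero 1 s)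

lemma jordanTotient_ne_zero {n : ℕ} (hn : n ≠ 0) {s : ℂ} (hs : 0 < s.re) :
    jordanTotient n s ≠ 0 :=
  mul_ne_zero (by rw [Ne, Complex.cpow_eq_zero_iff]; simp [hn]) (Finset.prod_ne_zero_iff.2
    fun p hp => eulerFactor_ne_zero (Nat.prime_of_mem_primeFactors hp).two_le (by simp) hs)

lemma logDeriv_jordanTotient_one {n : ℕ} (hn : n ≠ 0) : logDeriv (jordanTotient n) 1 =
    ((Real.log n + ∑ p ∈ n.primeFactors, Real.log p * ((p : ℝ)⁻¹ / (1 - (p : ℝ)⁻¹)) : ℝ) : ℂ) := by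
  have hn' : (n : ℂ) ≠ 0 := by exact_mod_cast hn
  have h1 : ∀ p ∈ n.primeFactors, (fun s : ℂ => 1 - 1 * (p : ℂ) ^ (-s)) 1 ≠ 0 := fun p hp =>
    eulerFactor_ne_zero (Nat.prime_of_mem_primeFactors hp).two_le (by simp) (by simp)
  have h2 : ∀ p ∈ n.primeFactors, DifferentiableAt ℂ (fun s : ℂ => 1 - 1 * (p : ℂ) ^ (-s)) 1 :=
    fun p hp => differentiable_eulerFactor (Nat.prime_of_mem_primeFactors hp).ne_zero _ 1
  have h3 : (fun s : ℂ => ∏ p ∈ n.primeFactors, (1 - 1 * (p : ℂ) ^ (-s))) 1 ≠ 0 :=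
    Finset.prod_ne_zero_iff.2 h1
  have h4 : DifferentiableAt ℂ (fun s : ℂ => ∏ p ∈ n.primeFactors, (1 - 1 * (p : ℂ) ^ (-s))) 1 :=
    DifferentiableAt.fun_finsetProd h2
  have h5 : HasDerivAt (fun s : ℂ => (n : ℂ) ^ s) ((n : ℂ) ^ (1 : ℂ) * Complex.log n * 1) 1 :=
    (hasDerivAt_id (1 : ℂ)).const_cpow (Or.inl hn')
  have h6 : (fun s : ℂ => (n : ℂ) ^ s) 1 ≠ 0 := by simpa using hn'
  have h7 : jordanTotient n = fun s : ℂ => (fun s : ℂ => (n : ℂ) ^ s) s *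
    (fun s : ℂ => ∏ p ∈ n.primeFactors, (1 - 1 * (p : ℂ) ^ (-s))) s := rfl
  rw [h7, logDeriv_mul 1 h6 h3 h5.differentiableAt h4, logDeriv_prod h1 h2, logDeriv_apply,
    h5.deriv]
  push_cast
  congr 1
  · rw [Complex.cpow_one, mul_one, mul_div_cancel_left₀ _ hn']
  · refine Finset.sum_congr rfl fun p hp => ?_
    rw [logDeriv_eulerFactor (Nat.prime_of_mem_primeFactors hp).ne_zero, one_mul,
      Complex.cpow_neg_one, Complex.natCast_log]

lemma logDeriv_jordanTotient_add_pos {n : ℕ} (hn : 2 ≤ n) :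
    0 < Real.log n + ∑ p ∈ n.primeFactors, Real.log p * ((p : ℝ)⁻¹ / (1 - (p : ℝ)⁻¹)) +
      (Real.eulerMascheroniConstant - Real.log (4 * π)) / 2 := by
  have h1 := log_four_mul_pi_le
  have h2 := Real.one_half_lt_eulerMascheroniConstant
  rcases hn.eq_or_lt with rfl | hn
  · rw [Nat.prime_two.primeFactors, Finset.sum_singleton]
    push_cast
    have := Real.log_two_gt_d9
    norm_num at *
    linarith
  · have h3 : Real.log 3 ≤ Real.log n := Real.log_le_log (by norm_num) (by exact_mod_cast hn)
    have h4 : 0 ≤ ∑ p ∈ n.primeFactors, Real.log p * ((p : ℝ)⁻¹ / (1 - (p : ℝ)⁻¹)) := by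
      refine Finset.sum_nonneg fun p hp => ?_
      have hp' : (1 : ℝ) ≤ p := by exact_mod_cast (Nat.prime_of_mem_primeFactors hp).one_le
      exact mul_nonneg (Real.log_nonneg hp')
        (div_nonneg (by positivity) (sub_nonneg.2 (inv_le_one_of_one_le₀ hp')))
    have := log_three_ge
    norm_num at *
    linarith

namespace DirichletCharacter

lemma jordanTotient_one_eq_sum (N : ℕ) [NeZero N] :
    jordanTotient N 1 = ∑ j : ZMod N, (1 : DirichletCharacter ℂ N) j := by
  have h1 := ZMod.LFunction_residue_one (1 : DirichletCharacter ℂ N)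
  have h := tendsto_nhds_unique h1 (LFunctionTrivChar_residue_one (N := N))
  have hN : (N : ℂ) ≠ 0 := NeZero.ne _
  rw [← Finset.sum_div, div_eq_iff hN] at h
  rw [h, jordanTotient, mul_comm]
  simp only [Complex.cpow_neg_one, Complex.cpow_one, one_mul]

lemma natCast_mul_LFunction_one_one (N : ℕ) [NeZero N] :
    N * (1 : DirichletCharacter ℂ N).LFunction 1 =
      deriv (jordanTotient N) 1 + jordanTotient N 1 * riemannZeta 1 := by
  set S : ℂ → ℂ := fun s => ∑ j : ZMod N, (1 : DirichletCharacter ℂ N) j *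
    HurwitzZeta.hurwitzZeta (ZMod.toAddCircle j) s with hS
  have hN : (N : ℂ) ≠ 0 := NeZero.ne _
  have hL : ∀ s, (N : ℂ) ^ s * (1 : DirichletCharacter ℂ N).LFunction s = S s := by
    intro s
    rw [LFunction, ZMod.LFunction, ← mul_assoc, ← Complex.cpow_add _ _ hN, add_neg_cancel,
      Complex.cpow_zero, one_mul]
  have hζ : ∀ s, s ≠ 1 → S s = jordanTotient N s * riemannZeta s := by
    intro s hs
    have := LFunctionTrivChar_eq_mul_riemannZeta (N := N) hs
    rw [LFunctionTrivChar] at this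
    rw [← hL, this, jordanTotient]
    simp only [one_mul, mul_assoc]
  have t1 : Filter.Tendsto (fun s => ∑ j : ZMod N, (1 : DirichletCharacter ℂ N) j *
      (HurwitzZeta.hurwitzZeta (ZMod.toAddCircle j) s - 1 / (s - 1) / s.Gammaℝ))
      (nhdsWithin 1 {1}ᶜ) (nhds (S 1)) :=
    tendsto_finsetSum _ fun j _ => ((HurwitzZeta.tendsto_hurwitzZeta_sub_one_div_nhds_one
      (ZMod.toAddCircle j)).mono_left nhdsWithin_le_nhds).const_mul _
  have t2 := (differentiable_jordanTotient (NeZero.ne N) 1).hasDerivAt.tendsto_slope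
  have t3 := (t2.mul riemannZeta_residue_one).add
    (ZetaAsymptotics.tendsto_riemannZeta_sub_one_div_Gammaℝ.const_mul (jordanTotient N 1))
  rw [← riemannZeta_one, mul_one] at t3
  rw [← Complex.cpow_one (N : ℂ), hL]
  refine tendsto_nhds_unique t1 (t3.congr' ?_)
  filter_upwards [self_mem_nhdsWithin] with s hs
  have hs' : s - 1 ≠ 0 := sub_ne_zero.2 hs
  simp only [mul_sub]
  rw [Finset.sum_sub_distrib, ← Finset.sum_mul, ← jordanTotient_one_eq_sum]
  change _ = S s - _
  rw [hζ s hs, slope_def_field]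
  field_simp
  ring

lemma LFunction_one_one_ne_zero (N : ℕ) [NeZero N] :
    (1 : DirichletCharacter ℂ N).LFunction 1 ≠ 0 := by
  intro h
  by_cases hN : N = 1
  · subst hN
    rw [LFunction_modOne_eq] at h
    exact riemannZeta_one_ne_zero h
  have h2 : 2 ≤ N := (Nat.two_le_iff N).2 ⟨NeZero.ne N, hN⟩
  have hJ := jordanTotient_ne_zero (NeZero.ne N) (s := 1) (by simp)
  have key := natCast_mul_LFunction_one_one N
  have e : deriv (jordanTotient N) 1 = jordanTotient N 1 * logDeriv (jordanTotient N) 1 := by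
    rw [logDeriv_apply, mul_div_cancel₀ _ hJ]
  have e2 : Complex.log (4 * π) = (Real.log (4 * π) : ℝ) := by
    rw [Complex.ofReal_log (by positivity)]
    push_cast
    rfl
  rw [h, mul_zero, e, ← mul_add, eq_comm, mul_eq_zero, or_iff_right hJ,
    logDeriv_jordanTotient_one (NeZero.ne N), riemannZeta_one, e2] at key
  have := logDeriv_jordanTotient_add_pos h2
  apply this.ne'
  exact_mod_cast key

end DirichletCharacter

lemma DirichletCharacter.isExceptionalZero_of_eq_zero {q : ℕ} [NeZero q]
    {χ : DirichletCharacter ℂ q} {s : ℂ}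
    (hs : 1 - 1 / (9.646 * Real.log (max (max (q : ℝ) ((q : ℝ) * |s.im|)) 10)) ≤ s.re)
    (h : χ.LFunction s = 0) :
    χ.IsExceptionalZero (max (max (q : ℝ) ((q : ℝ) * |s.im|)) 10) s where
  ten_le := le_max_right _ _
  level_le := (le_max_left _ _).trans (le_max_left _ _)
  level_mul_le := (le_max_right _ _).trans (le_max_left _ _)
  le_re := hs
  re_lt := by
    by_contra! hc
    by_cases h1 : χ ≠ 1 ∨ s ≠ 1
    · exact LFunction_ne_zero_of_one_le_re χ h1 hc h
    · push Not at h1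
      obtain ⟨rfl, rfl⟩ := h1
      exact LFunction_one_one_ne_zero q h
  eq_zero := h

/-- McCurley's zero-free region: the product `𝓛_q(s) = ∏_{χ mod q} L(s, χ)` has at most one
zero in the region `σ ≥ 1 − 1/(9.646·log max{q, q|t|, 10})`; if it exists, it is real and is a
zero of `L(s, χ)` for some non-principal real character `χ` mod `q`. -/
theorem product_L_function_zero_free_region (q : ℕ) [NeZero q] :
    let 𝓛 : ℂ → ℂ := fun s => ∏ χ : DirichletCharacter ℂ q,
      DirichletCharacter.LFunction χ s
    let R : Set ℂ := {s : ℂ |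
      1 - 1 / (9.646 * Real.log (max (max (q : ℝ) ((q : ℝ) * |s.im|)) 10)) ≤ s.re}
    (∀ s₁ ∈ R, ∀ s₂ ∈ R, 𝓛 s₁ = 0 → 𝓛 s₂ = 0 → s₁ = s₂) ∧
    (∀ s ∈ R, 𝓛 s = 0 → s.im = 0 ∧
      ∃ χ : DirichletCharacter ℂ q, χ ≠ 1 ∧ (∀ a : ZMod q, (χ a).im = 0) ∧
        DirichletCharacter.LFunction χ s = 0) := by
  intro 𝓛 R
  have key : ∀ s, 𝓛 s = 0 → ∃ χ : DirichletCharacter ℂ q, χ.LFunction s = 0 := by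
    intro s h
    obtain ⟨χ, -, hχ⟩ := Finset.prod_eq_zero_iff.1 h
    exact ⟨χ, hχ⟩
  refine ⟨fun s₁ h₁ s₂ h₂ z₁ z₂ => ?_, fun s hs h => ?_⟩
  · obtain ⟨χ₁, hχ₁⟩ := key s₁ z₁
    obtain ⟨χ₂, hχ₂⟩ := key s₂ z₂
    have e₁ := DirichletCharacter.isExceptionalZero_of_eq_zero h₁ hχ₁
    have e₂ := DirichletCharacter.isExceptionalZero_of_eq_zero h₂ hχ₂
    rw [e₁.im_eq_zero e₁.ne_one] at e₁
    rw [e₂.im_eq_zero e₂.ne_one] at e₂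
    exact e₁.eq e₂
  · obtain ⟨χ, hχ⟩ := key s h
    have e := DirichletCharacter.isExceptionalZero_of_eq_zero hs hχ
    exact ⟨e.im_eq_zero e.ne_one, χ, e.ne_one,
      DirichletCharacter.im_apply_eq_zero_of_sq_eq_one e.sq_eq_one, hχ⟩
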